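/- A polynomial p ∈ ℂ[x,y] is a test polynomial if and only if p does not belong to any proper retract of ℂ[x,y]. -/

import Mathlib

open MvPolynomial

/-- `ℂ[x,y]` as multivariate polynomials in two variables. -/
local notation "P" => MvPolynomial (Fin 2) ℂ

/-- A test polynomial: every `ℂ`-algebra endomorphism fixing it is an automorphism. -/
def IsTestPolynomial (p : P) : Prop :=
  ∀ φ : P →ₐ[ℂ] P, φ p = p → Function.Bijective φ

/-- A retract of `ℂ[x,y]`: the image of an idempotent `ℂ`-algebra endomorphism. -/
def IsRetract (R : Subalgebra ℂ P) : Prop :=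
  ∃ π : P →ₐ[ℂ] P, π.comp π = π ∧ π.range = R

/-- A proper retract: a retract different from `ℂ` and from `ℂ[x,y]`. -/
def IsProperRetract (R : Subalgebra ℂ P) : Prop :=
  IsRetract R ∧ R ≠ ⊥ ∧ R ≠ ⊤

open scoped NNReal

namespace Valuation

section Infinity

variable {K F Γ : Type*} [Field K] [Field F] [Algebra K F] [Algebra (Polynomial K) F]
  [IsScalarTower K (Polynomial K) F] [LinearOrderedCommGroupWithZero Γ]

/-- A valuation is an infinity valuation if it is trivial on the constants and the variable
is large. -/
structure IsInfinity (K : Type*) {F Γ : Type*} [Field K] [Field F] [Algebra K F]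
    [Algebra (Polynomial K) F] [LinearOrderedCommGroupWithZero Γ] (v : Valuation F Γ) : Prop where
  const : ∀ c : K, c ≠ 0 → v (algebraMap K F c) = 1
  large : 1 < v (algebraMap (Polynomial K) F Polynomial.X)

namespace IsInfinity

variable {v : Valuation F Γ}

omit [IsScalarTower K (Polynomial K) F] in
lemma const_le (hv : IsInfinity K v) (c : K) : v (algebraMap K F c) ≤ 1 := by
  by_cases h : c = 0
  · simp [h]
  · exact (hv.const c h).le

lemma map_poly (hv : IsInfinity K v) {f : Polynomial K} (hf : f ≠ 0) :
    v (algebraMap (Polynomial K) F f) =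
      v (algebraMap (Polynomial K) F Polynomial.X) ^ f.natDegree := by
  have key : algebraMap (Polynomial K) F f = ∑ i ∈ Finset.range (f.natDegree + 1),
      algebraMap K F (f.coeff i) * (algebraMap (Polynomial K) F Polynomial.X) ^ i := by
    conv_lhs => rw [f.as_sum_range_C_mul_X_pow]
    simp only [map_sum, map_mul, map_pow]
    exact Finset.sum_congr rfl fun i _ => by
      rw [← Polynomial.algebraMap_eq, ← IsScalarTower.algebraMap_apply K (Polynomial K) F]
  rw [key, Finset.sum_range_succ, Valuation.map_add_eq_of_lt_right]
  · rw [v.map_mul, v.map_pow, hv.const _ (by simpa using hf), one_mul]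
  · have h0 : (0 : Γ) < v (algebraMap (Polynomial K) F Polynomial.X) :=
      zero_lt_one.trans hv.large
    rw [v.map_mul, v.map_pow, hv.const _ (by simpa using hf), one_mul]
    refine v.map_sum_lt (pow_pos h0 _).ne' fun i hi => ?_
    rw [v.map_mul, v.map_pow]
    calc _ ≤ 1 * v (algebraMap (Polynomial K) F Polynomial.X) ^ i := by
          gcongr; exact hv.const_le _
      _ < _ := by
          rw [one_mul]; exact pow_lt_pow_right₀ hv.large (by simpa using hi)

lemma exists_pow_eq (hv : IsInfinity K v) {h : F} (h0 : h ≠ 0)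
    (halg : IsAlgebraic (Polynomial K) h) :
    ∃ m : ℕ, 0 < m ∧ ∃ a : ℤ, v h ^ m = v (algebraMap (Polynomial K) F Polynomial.X) ^ a := by
  obtain ⟨f, hf, hfh⟩ := halg
  set X : Γ := v (algebraMap (Polynomial K) F Polynomial.X) with hX
  have hX0 : X ≠ 0 := (zero_lt_one.trans hv.large).ne'
  have hinj : ∀ c : Polynomial K, c ≠ 0 → v (algebraMap _ F c) ≠ 0 := fun c hc => by
    rw [hv.map_poly hc]; exact pow_ne_zero _ hX0
  have hvh : v h ≠ 0 := by simpa using h0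
  by_contra hcon
  push Not at hcon
  rw [Polynomial.aeval_eq_sum_range' (Nat.lt_succ_self _)] at hfh
  let t : ℕ → F := fun i => f.coeff i • h ^ i
  have ht : ∀ i ∈ f.support, v (t i) = X ^ (f.coeff i).natDegree * v h ^ i := fun i hi => by
    simp only [t, Algebra.smul_def, v.map_mul, v.map_pow]
    rw [hv.map_poly (by simpa using hi)]
  obtain ⟨i, hi, hmax⟩ := Finset.exists_max_image f.support (fun i => v (t i))
    (by simpa using hf)
  have hti : v (t i) ≠ 0 := by
    rw [ht i hi]; exact mul_ne_zero (pow_ne_zero _ hX0) (pow_ne_zero _ hvh)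
  have hlt : ∀ j ∈ f.support, j ≠ i → v (t j) < v (t i) := fun j hj hji => by
    refine lt_of_le_of_ne (hmax j hj) fun heq => ?_
    rw [ht i hi, ht j hj] at heq
    wlog hij : j < i generalizing i j
    · exact this j hj (fun k hk => (hmax k hk).trans (by rw [ht i hi, ht j hj, heq]))
        (by rw [ht j hj, heq, ← ht i hi]; exact hti) i hi hji.symm heq.symm (by omega)
    refine hcon (i - j) (by omega) ((f.coeff j).natDegree - (f.coeff i).natDegree) ?_
    rw [zpow_sub₀ hX0, zpow_natCast, zpow_natCast, eq_div_iff (pow_ne_zero _ hX0)]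
    have : v h ^ i = v h ^ (i - j) * v h ^ j := by rw [← pow_add]; congr 1; omega
    rw [this] at heq
    apply mul_right_cancel₀ (pow_ne_zero j hvh)
    rw [heq]; ac_rfl
  have hsum : ∑ j ∈ f.support, t j = 0 := by
    rw [← hfh]
    refine Finset.sum_subset (fun j hj => ?_) (fun j _ hj => ?_)
    · simpa [Nat.lt_succ_iff] using Polynomial.le_natDegree_of_mem_supp j hj
    · simp only [t]; rw [Polynomial.notMem_support_iff.1 hj, zero_smul]
  rw [← Finset.add_sum_erase _ _ hi] at hsum
  have : v (t i) = v (∑ j ∈ f.support.erase i, t j) := by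
    rw [eq_neg_of_add_eq_zero_left hsum, v.map_neg]
  refine absurd this (ne_of_gt (v.map_sum_lt hti fun j hj => ?_))
  rw [Finset.mem_erase] at hj
  exact hlt j hj.2 hj.1

end IsInfinity

variable (K F) in
lemma exists_isInfinity_valuationSubring
    (hinj : Function.Injective (algebraMap (Polynomial K) F)) :
    ∃ V : ValuationSubring F, IsInfinity K V.valuation := by
  have hx : algebraMap (Polynomial K) F Polynomial.X ∉ (integralClosure K F).toSubring := by
    intro h
    obtain ⟨f, hf, hf0⟩ : IsIntegral K (algebraMap (Polynomial K) F Polynomial.X) := h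
    rw [← Polynomial.aeval_def, Polynomial.aeval_algebraMap_apply, Polynomial.aeval_X_left_apply]
      at hf0
    exact hf.ne_zero (hinj (by rw [hf0, map_zero]))
  have : IsIntegrallyClosedIn (integralClosure K F).toSubring F :=
    inferInstanceAs (IsIntegrallyClosedIn (integralClosure K F) F)
  obtain ⟨V, hV1, hV2⟩ := Subring.exists_le_valuationSubring_of_isIntegrallyClosedIn hx
  refine ⟨V, fun c hc => ?_, ?_⟩
  · have h1 : ∀ c : K, V.valuation (algebraMap K F c) ≤ 1 := fun c =>
      (V.valuation_le_one_iff _).2 (hV1 (algebraMap_mem (integralClosure K F) c))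
    refine le_antisymm (h1 c) ?_
    have h2 := h1 c⁻¹
    rw [map_inv₀, map_inv₀] at h2
    exact (inv_le_one₀ (by simpa [zero_lt_iff] using hc)).1 h2
  · rwa [← not_le, V.valuation_le_one_iff]

variable (K F) in
/-- The infinity valuation extends to algebraic extensions, with real values. -/
lemma exists_isInfinity_nnreal (hinj : Function.Injective (algebraMap (Polynomial K) F))
    [Algebra.IsAlgebraic (Polynomial K) F] :
    ∃ w : Valuation F ℝ≥0, IsInfinity K w ∧
      w (algebraMap (Polynomial K) F Polynomial.X) = 2 := by
  obtain ⟨V, hV⟩ := exists_isInfinity_valuationSubring K F hinj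
  set x := algebraMap (Polynomial K) F Polynomial.X with hx
  set v := V.valuation with hv
  have hX := hV.large
  have hX0 : v x ≠ 0 := (zero_lt_one.trans hX).ne'
  have hx0 : x ≠ 0 := fun h => hX0 (by rw [h, map_zero])
  choose! m hm a ha using fun (h : F) (h0 : h ≠ 0) => hV.exists_pow_eq h0
    (Algebra.IsAlgebraic.isAlgebraic (R := Polynomial K) h)
  have hle : ∀ {g h : F} {k l : ℕ} {b c : ℤ}, 0 < k → 0 < l → v g ^ k = v x ^ b →
      v h ^ l = v x ^ c → (v g ≤ v h ↔ (b / k : ℝ) ≤ c / l) := by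
    intro g h k l b c hk hl h1 h2
    rw [div_le_div_iff₀ (by positivity) (by positivity)]
    rw [← pow_le_pow_iff_left₀ zero_le zero_le (mul_pos hk hl).ne', pow_mul, h1, mul_comm k l,
      pow_mul, h2, ← zpow_natCast, ← zpow_natCast, ← zpow_mul, ← zpow_mul,
      zpow_le_zpow_iff_right₀ hX]
    exact_mod_cast Iff.rfl
  let q : F → ℝ := fun h => a h / m h
  have hq : ∀ {h : F} {k : ℕ} {b : ℤ}, h ≠ 0 → 0 < k → v h ^ k = v x ^ b → q h = b / k := by
    intro h k b h0 hk h1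
    exact le_antisymm ((hle (hm h h0) hk (ha h h0) h1).1 le_rfl)
      ((hle hk (hm h h0) h1 (ha h h0)).1 le_rfl)
  have hqle : ∀ {g h : F}, g ≠ 0 → h ≠ 0 → (v g ≤ v h ↔ q g ≤ q h) := fun {g h} hg hh =>
    hle (hm g hg) (hm h hh) (ha g hg) (ha h hh)
  have hmono : ∀ {g h : F}, g ≠ 0 → h ≠ 0 →
      (v g ≤ v h ↔ (2 : ℝ≥0) ^ q g ≤ (2 : ℝ≥0) ^ q h) := fun {g h} hg hh => by
    rw [hqle hg hh, ← NNReal.coe_le_coe, NNReal.coe_rpow, NNReal.coe_rpow,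
      Real.rpow_le_rpow_left_iff (by norm_num)]
  classical
  let w : Valuation F ℝ≥0 :=
    { toFun := fun h => if h = 0 then 0 else (2 : ℝ≥0) ^ q h
      map_zero' := by simp
      map_one' := by
        have : q 1 = 0 := by
          rw [hq one_ne_zero one_pos (b := 0) (by simp)]; simp
        simp [this]
      map_mul' := by
        intro g h
        by_cases hg : g = 0
        · simp [hg]
        by_cases hh : h = 0
        · simp [hh]
        have : q (g * h) = q g + q h := by
          have hmg := hm g hg
          have hmh := hm h hh
          rw [hq (mul_ne_zero hg hh) (mul_pos hmg hmh)
            (b := a g * m h + a h * m g)]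
          · simp only [q]; push_cast; field_simp
          · rw [v.map_mul, mul_pow, pow_mul, ha g hg, mul_comm (m g), pow_mul, ha h hh,
              ← zpow_natCast, ← zpow_natCast, ← zpow_mul, ← zpow_mul, zpow_add₀ hX0]
        simp [hg, hh, this, NNReal.rpow_add]
      map_add_le_max' := by
        intro g h
        by_cases hg : g = 0
        · simp [hg]
        by_cases hh : h = 0
        · simp [hh]
        by_cases hgh : g + h = 0
        · simp [hgh]
        simp only [hg, hh, hgh, if_false]
        rcases le_total (v g) (v h) with hl | hl
        · rw [max_eq_right ((hmono hg hh).1 hl)]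
          exact (hmono hgh hh).1 ((v.map_add g h).trans_eq (max_eq_right hl))
        · rw [max_eq_left ((hmono hh hg).1 hl)]
          exact (hmono hgh hg).1 ((v.map_add g h).trans_eq (max_eq_left hl)) }
  have hw : ∀ h, h ≠ 0 → w h = (2 : ℝ≥0) ^ q h := fun h h0 => if_neg h0
  have hwx : w x = 2 := by
    rw [hw x hx0, hq hx0 one_pos (b := 1) (by simp)]; simp
  refine ⟨w, ⟨fun c hc => ?_, by rw [← hx, hwx]; norm_num⟩, hwx⟩
  have hc' : algebraMap K F c ≠ 0 := by simpa using hc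
  rw [hw _ hc', hq hc' one_pos (b := 0) (by rw [pow_one, zpow_zero]; exact hV.const c hc)]
  simp

end Infinity
end Valuation

namespace Places

open Valuation

variable {K L : Type*} [Field K] [CharZero K] [Field L] [Algebra K L] [Algebra (Polynomial K) L]
  [Algebra (RatFunc K) L] [IsScalarTower K (Polynomial K) L]
  [IsScalarTower (Polynomial K) (RatFunc K) L] [FiniteDimensional (RatFunc K) L]

/-- The valuation on `L` induced by an embedding in the algebraic closure of `K(X)`. -/
noncomputable def place (w : Valuation (AlgebraicClosure (RatFunc K)) ℝ≥0)
    (σ : L →ₐ[RatFunc K] AlgebraicClosure (RatFunc K)) : Valuation L ℝ≥0 :=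
  w.comap σ.toRingHom

variable {w : Valuation (AlgebraicClosure (RatFunc K)) ℝ≥0}

omit [CharZero K] [Algebra K L] [Algebra (Polynomial K) L] [IsScalarTower K (Polynomial K) L]
  [IsScalarTower (Polynomial K) (RatFunc K) L] [FiniteDimensional (RatFunc K) L] in
lemma place_apply (σ : L →ₐ[RatFunc K] AlgebraicClosure (RatFunc K)) (h : L) :
    place w σ h = w (σ h) := rfl

omit [CharZero K] [Algebra K L] [Algebra (Polynomial K) L] [IsScalarTower K (Polynomial K) L]
  [IsScalarTower (Polynomial K) (RatFunc K) L] [FiniteDimensional (RatFunc K) L] in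
lemma place_ratFunc (σ : L →ₐ[RatFunc K] AlgebraicClosure (RatFunc K)) (c : RatFunc K) :
    place w σ (algebraMap _ L c) = w (algebraMap _ _ c) := by
  rw [place_apply, σ.commutes]

omit [CharZero K] [Algebra K L] [IsScalarTower K (Polynomial K) L]
  [FiniteDimensional (RatFunc K) L] in
lemma place_poly (σ : L →ₐ[RatFunc K] AlgebraicClosure (RatFunc K)) (c : Polynomial K) :
    place w σ (algebraMap _ L c) = w (algebraMap _ _ c) := by
  rw [IsScalarTower.algebraMap_apply (Polynomial K) (RatFunc K) L, place_ratFunc,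
    ← IsScalarTower.algebraMap_apply]

omit [CharZero K] [FiniteDimensional (RatFunc K) L] in
lemma isInfinity_place (hw : IsInfinity K w)
    (σ : L →ₐ[RatFunc K] AlgebraicClosure (RatFunc K)) : IsInfinity K (place w σ) := by
  refine ⟨fun c hc => ?_, ?_⟩
  · rw [IsScalarTower.algebraMap_apply K (Polynomial K) L, place_poly,
      ← IsScalarTower.algebraMap_apply]
    exact hw.const c hc
  · rw [place_poly]; exact hw.large

omit [Algebra K L] [Algebra (Polynomial K) L] [IsScalarTower K (Polynomial K) L]
  [IsScalarTower (Polynomial K) (RatFunc K) L] in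
lemma prod_place (h : L) : ∏ σ : L →ₐ[RatFunc K] AlgebraicClosure (RatFunc K), place w σ h =
    w (algebraMap _ _ (Algebra.norm (RatFunc K) h)) := by
  rw [Algebra.norm_eq_prod_embeddings, map_prod]; rfl

omit [Algebra K L] [Algebra (Polynomial K) L] [IsScalarTower K (Polynomial K) L]
  [IsScalarTower (Polynomial K) (RatFunc K) L] in
lemma trace_le (h : L) {M : ℝ≥0} (hM : ∀ σ, place w σ h ≤ M) :
    w (algebraMap _ _ (Algebra.trace (RatFunc K) L h)) ≤ M := by
  rw [trace_eq_sum_embeddings (AlgebraicClosure (RatFunc K))]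
  exact w.map_sum_le fun σ _ => hM σ

omit [Algebra K L] [Algebra (Polynomial K) L] [IsScalarTower K (Polynomial K) L]
  [IsScalarTower (Polynomial K) (RatFunc K) L] in
variable (w) in
lemma exists_repr_le {ι : Type*} [Finite ι] (b : Module.Basis ι (RatFunc K) L) :
    ∃ C : ℝ≥0, 0 < C ∧ ∀ (h : L) (M : ℝ≥0), (∀ σ, place w σ h ≤ M) →
      ∀ i, w (algebraMap _ _ (b.repr h i)) ≤ C * M := by
  classical
  have := Fintype.ofFinite ι
  let C : ℝ≥0 := 1 + ∑ σ : L →ₐ[RatFunc K] AlgebraicClosure (RatFunc K),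
    ∑ i, place w σ (b.traceDual i)
  have hC : ∀ σ i, place w σ (b.traceDual i) ≤ C := fun σ i =>
    (Finset.single_le_sum (f := fun i => place w σ (b.traceDual i)) (fun _ _ => zero_le)
      (Finset.mem_univ i)).trans <|
    (Finset.single_le_sum (f := fun σ => ∑ i, place w σ (b.traceDual i)) (fun _ _ => zero_le)
      (Finset.mem_univ σ)).trans le_add_self
  refine ⟨C, by positivity, fun h M hM i => ?_⟩
  have : b.repr h i = Algebra.trace (RatFunc K) L (b.traceDual i * h) := by
    conv_lhs => rw [← b.traceDual_traceDual]
    rw [Module.Basis.traceDual_repr_apply, Algebra.traceForm_apply, mul_comm]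
  rw [this]
  refine trace_le _ fun σ => ?_
  rw [Valuation.map_mul]
  exact mul_le_mul' (hC σ i) (hM σ)

section Integral

local notation "S" => integralClosure (Polynomial K) L

variable (K L) in
omit [CharZero K] [Algebra K L] [IsScalarTower K (Polynomial K) L]
  [FiniteDimensional (RatFunc K) L] in
lemma algebraMap_poly_injective : Function.Injective (algebraMap (Polynomial K) L) := by
  rw [IsScalarTower.algebraMap_eq (Polynomial K) (RatFunc K) L]
  exact (algebraMap (RatFunc K) L).injective.comp (IsFractionRing.injective _ _)

lemma exists_quotient_bound (hw : IsInfinity K w)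
    (hw2 : w (algebraMap (Polynomial K) _ Polynomial.X) = 2) {a : L} (ha : a ∈ S) (ha0 : a ≠ 0) :
    ∃ d : ℕ, ∏ σ, place w σ a = 2 ^ d ∧ ∀ V : Submodule K L, (∀ h ∈ V, h ∈ S) →
      (∀ h ∈ V, ∀ g ∈ S, h = a * g → h = 0) → Module.Finite K V ∧ Module.finrank K V ≤ d := by
  have hinj := algebraMap_poly_injective K L
  have : FaithfulSMul (Polynomial K) L := (faithfulSMul_iff_algebraMap_injective _ _).2 hinj
  have : Module.IsTorsionFree (Polynomial K) L := inferInstance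
  have hfree : Module.Free (Polynomial K) S :=
    IsIntegralClosure.module_free (Polynomial K) (RatFunc K) L S
  have hfin : Module.Finite (Polynomial K) S :=
    IsIntegralClosure.finite (Polynomial K) (RatFunc K) L S
  let b := Module.Free.chooseBasis (Polynomial K) S
  let a' : S := ⟨a, ha⟩
  have ha' : a' ≠ 0 := fun h => ha0 (congrArg Subtype.val h)
  have hloc : IsLocalization (Algebra.algebraMapSubmonoid S (nonZeroDivisors (Polynomial K))) L :=
    IsIntegralClosure.isLocalization (Polynomial K) (RatFunc K) L S
  have hnorm := Algebra.norm_localization (Polynomial K) (nonZeroDivisors (Polynomial K))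
    (Rₘ := RatFunc K) (Sₘ := L) a'
  have hn0 : Algebra.norm (Polynomial K) a' ≠ 0 := Algebra.norm_ne_zero_iff.2 ha'
  have hrank := finrank_quotient_span_eq_natDegree_norm b ha'
  have hI := Ideal.span_singleton_eq_bot.not.2 ha'
  have hqfin : Module.Finite K (S ⧸ Ideal.span ({a'} : Set S)) := by
    have := Fintype.ofFinite (Module.Free.ChooseBasisIndex (Polynomial K) S)
    exact Module.Finite.equiv (Ideal.quotientEquivDirectSum K b hI).symm
  refine ⟨(Algebra.norm (Polynomial K) a').natDegree, ?_, fun V hVS hV => ?_⟩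
  · rw [prod_place]
    have : (a : L) = algebraMap S L a' := rfl
    rw [this, hnorm, ← IsScalarTower.algebraMap_apply, hw.map_poly hn0, hw2]
  · let f : V →ₗ[K] (S ⧸ Ideal.span ({a'} : Set S)) :=
      { toFun := fun h => Ideal.Quotient.mk _ ⟨h, hVS h h.2⟩
        map_add' := fun g h => by rw [← map_add]; rfl
        map_smul' := fun c h => by
          rw [RingHom.id_apply, ← Ideal.Quotient.mkₐ_eq_mk K, ← map_smul]
          congr 1 }
    have hf : Function.Injective f := by
      rw [injective_iff_map_eq_zero]
      intro h hh
      have h1 : (⟨h, hVS h h.2⟩ : S) ∈ Ideal.span ({a'} : Set S) :=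
        Ideal.Quotient.eq_zero_iff_mem.1 hh
      obtain ⟨g, hg⟩ := Ideal.mem_span_singleton'.1 h1
      refine Subtype.ext (hV h h.2 g g.2 ?_)
      rw [mul_comm]; exact (congrArg Subtype.val hg).symm
    exact ⟨Module.Finite.of_injective f hf, (LinearMap.finrank_le_finrank_of_injective hf).trans
      hrank.le⟩

end Integral

end Places

namespace Places

open Valuation

variable {K L : Type*} [Field K] [CharZero K] [Field L] [Algebra K L] [Algebra (Polynomial K) L]
  [Algebra (RatFunc K) L] [IsScalarTower K (Polynomial K) L]
  [IsScalarTower (Polynomial K) (RatFunc K) L] [FiniteDimensional (RatFunc K) L]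

variable {w : Valuation (AlgebraicClosure (RatFunc K)) ℝ≥0}

variable (K L) in
omit [CharZero K] [Algebra K L] [IsScalarTower K (Polynomial K) L] in
lemma isAlgebraic_poly : Algebra.IsAlgebraic (Polynomial K) L :=
  have : Algebra.IsAlgebraic (Polynomial K) (RatFunc K) := IsLocalization.isAlgebraic _
    (nonZeroDivisors (Polynomial K))
  Algebra.IsAlgebraic.trans (Polynomial K) (RatFunc K) L

section Unique

variable {ν : Valuation L ℝ≥0}

omit [CharZero K] [FiniteDimensional (RatFunc K) L] in
lemma eq_on_ratFunc (hw : IsInfinity K w)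
    (hw2 : w (algebraMap (Polynomial K) _ Polynomial.X) = 2) (hν : IsInfinity K ν)
    (hν2 : ν (algebraMap (Polynomial K) _ Polynomial.X) = 2) (c : RatFunc K) :
    ν (algebraMap _ L c) = w (algebraMap _ _ c) := by
  have hp : ∀ f : Polynomial K, ν (algebraMap _ L f) = w (algebraMap _ _ f) := fun f => by
    by_cases hf : f = 0
    · simp [hf]
    · rw [hν.map_poly hf, hw.map_poly hf, hw2, hν2]
  obtain ⟨a, b, hb, rfl⟩ := IsFractionRing.div_surjective (A := Polynomial K) c
  simp only [map_div₀, ← IsScalarTower.algebraMap_apply, hp]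

lemma exists_le_place (hw : IsInfinity K w)
    (hw2 : w (algebraMap (Polynomial K) _ Polynomial.X) = 2) (hν : IsInfinity K ν)
    (hν2 : ν (algebraMap (Polynomial K) _ Polynomial.X) = 2) (h : L) :
    ∃ σ, ν h ≤ place w σ h := by
  classical
  by_contra! hcon
  have hne : Nonempty (L →ₐ[RatFunc K] AlgebraicClosure (RatFunc K)) := ⟨IsAlgClosed.lift⟩
  set M : ℝ≥0 := Finset.univ.sup fun σ => place w σ h with hM
  have hle : ∀ σ, place w σ h ≤ M := fun σ =>
    Finset.le_sup (f := fun σ => place w σ h) (Finset.mem_univ σ)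
  have hpos : 0 < ν h := lt_of_le_of_lt zero_le (hcon hne.some)
  have hlt : M < ν h := by
    rw [hM, Finset.sup_lt_iff (by simpa using hpos)]
    exact fun σ _ => hcon σ
  let b := Module.finBasis (RatFunc K) L
  obtain ⟨C, hC, hb⟩ := exists_repr_le w b
  set B : ℝ≥0 := Finset.univ.sup fun i => ν (b i)
  have hB : ∀ i, ν (b i) ≤ B := fun i =>
    Finset.le_sup (f := fun i => ν (b i)) (Finset.mem_univ i)
  have key : ∀ m : ℕ, ν h ^ m ≤ C * M ^ m * B := fun m => by
    rw [← Valuation.map_pow, ← b.sum_repr (h ^ m)]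
    refine ν.map_sum_le fun i _ => ?_
    rw [Algebra.smul_def, Valuation.map_mul, eq_on_ratFunc hw hw2 hν hν2]
    refine mul_le_mul' (hb _ _ (fun σ => ?_) i) (hB i)
    rw [Valuation.map_pow]; exact pow_le_pow_left' (hle σ) m
  have hCB : 0 < (C * B + 1)⁻¹ := by positivity
  obtain ⟨n, hn⟩ := exists_pow_lt_of_lt_one hCB ((div_lt_one hpos).2 hlt)
  rw [div_pow, div_lt_iff₀ (pow_pos hpos n), inv_mul_eq_div, lt_div_iff₀ (by positivity)] at hn
  refine absurd (hn.trans_le (key n)) (not_lt.2 ?_)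
  calc C * M ^ n * B = M ^ n * (C * B) := by ring
    _ ≤ M ^ n * (C * B + 1) := by gcongr; simp

lemma exists_place_eq_apply (hw : IsInfinity K w)
    (hw2 : w (algebraMap (Polynomial K) _ Polynomial.X) = 2) (hν : IsInfinity K ν)
    (hν2 : ν (algebraMap (Polynomial K) _ Polynomial.X) = 2) {h : L} (h0 : h ≠ 0) :
    ∃ σ, place w σ h = ν h := by
  by_contra! hcon
  have hX0 : algebraMap (Polynomial K) L Polynomial.X ≠ 0 := fun h => by simp [h] at hν2
  have := isAlgebraic_poly K L
  obtain ⟨m, hm, a, hma⟩ := hν.exists_pow_eq h0 (Algebra.IsAlgebraic.isAlgebraic h)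
  set x := algebraMap (Polynomial K) L Polynomial.X with hx
  have hpx : ∀ σ, place w σ x = 2 := fun σ => by rw [hx, place_poly, hw2]
  set y := h ^ m * x ^ (-a) with hy
  have hνy : ν y = 1 := by
    rw [hy, Valuation.map_mul, Valuation.map_pow, hma, map_zpow₀, ← zpow_add₀ (by rw [hν2]; simp)]
    simp
  have hpy : ∀ σ, place w σ y ≠ 1 := fun σ h1 => hcon σ <| by
    rw [hy, Valuation.map_mul, Valuation.map_pow, map_zpow₀, zpow_neg,
      mul_inv_eq_one₀ (by rw [hpx]; exact zpow_ne_zero _ two_ne_zero), hpx, ← hν2, ← hma] at h1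
    exact (pow_left_inj₀ zero_le zero_le hm.ne').1 h1
  have h1y : ∀ σ, place w σ (y / (1 + y) ^ 2) < 1 := fun σ => by
    rcases lt_or_gt_of_ne (hpy σ) with h1 | h1
    · rw [map_div₀, Valuation.map_pow, Valuation.map_add_eq_of_lt_left _ (by simpa using h1)]
      simpa using h1
    · rw [map_div₀, Valuation.map_pow, Valuation.map_add_eq_of_lt_right _ (by simpa using h1)]
      have h2 := zero_lt_one.trans h1
      rw [div_lt_one (pow_pos h2 2), sq]
      exact lt_mul_of_one_lt_right h2 h1
  obtain ⟨σ, hσ⟩ := exists_le_place hw hw2 hν hν2 (y / (1 + y) ^ 2)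
  refine absurd (hσ.trans_lt (h1y σ)) (not_lt.2 ?_)
  have hle : ν (1 + y) ≤ 1 := (ν.map_add _ _).trans (by simp [hνy])
  have hne : 1 + y ≠ 0 := fun h0 => hpy σ <| by
    rw [show y = -1 by linear_combination h0]; simp
  rw [map_div₀, Valuation.map_pow, hνy, one_div]
  have : 0 < ν (1 + y) := by simpa [zero_lt_iff] using hne
  exact one_le_inv_iff₀.2 ⟨by positivity, pow_le_one' hle 2⟩

open scoped Pointwise in
lemma exists_place_eq (hw : IsInfinity K w)
    (hw2 : w (algebraMap (Polynomial K) _ Polynomial.X) = 2) (hν : IsInfinity K ν)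
    (hν2 : ν (algebraMap (Polynomial K) _ Polynomial.X) = 2) :
    ∃ σ, ν = place w σ := by
  classical
  let f : (L →ₐ[RatFunc K] AlgebraicClosure (RatFunc K)) → Lˣ →* ℝ≥0 := fun σ =>
    (place w σ : L →* ℝ≥0).comp (Units.coeHom L)
  let g : Lˣ →* ℝ≥0 := (ν : L →* ℝ≥0).comp (Units.coeHom L)
  have hcov : ⋃ σ ∈ (Finset.univ : Finset (L →ₐ[RatFunc K] AlgebraicClosure (RatFunc K))),
      (1 : Lˣ) • ((f σ).eqLocus g : Set Lˣ) = Set.univ := by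
    rw [Set.eq_univ_iff_forall]
    intro u
    obtain ⟨σ, hσ⟩ := exists_place_eq_apply hw hw2 hν hν2 u.ne_zero
    simp only [one_smul, Set.mem_iUnion]
    exact ⟨σ, Finset.mem_univ _, hσ⟩
  obtain ⟨σ, -, hσ⟩ := Subgroup.exists_finiteIndex_of_leftCoset_cover hcov
  refine ⟨σ, Valuation.ext fun h => ?_⟩
  by_cases h0 : h = 0
  · simp [h0]
  have hn := Subgroup.FiniteIndex.index_ne_zero (H := (f σ).eqLocus g)
  have h1 : Units.mk0 h h0 ^ ((f σ).eqLocus g).index ∈ (f σ).eqLocus g :=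
    Subgroup.pow_index_mem _ _
  have h2 : place w σ (h ^ ((f σ).eqLocus g).index) = ν (h ^ ((f σ).eqLocus g).index) := h1
  rw [Valuation.map_pow, Valuation.map_pow] at h2
  exact ((pow_left_inj₀ zero_le zero_le hn).1 h2).symm

end Unique

end Places

namespace Places

open Valuation

variable {K L : Type*} [Field K] [CharZero K] [Field L] [Algebra K L] [Algebra (Polynomial K) L]
  [Algebra (RatFunc K) L] [IsScalarTower K (Polynomial K) L]
  [IsScalarTower (Polynomial K) (RatFunc K) L] [FiniteDimensional (RatFunc K) L]

variable {w : Valuation (AlgebraicClosure (RatFunc K)) ℝ≥0}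

omit [CharZero K] [Algebra (RatFunc K) L] [IsScalarTower (Polynomial K) (RatFunc K) L]
  [FiniteDimensional (RatFunc K) L] in
lemma derivation_poly (D : Derivation K L L) (f : Polynomial K) :
    D (algebraMap _ L f) = algebraMap _ L (Polynomial.derivative f) *
      D (algebraMap (Polynomial K) L Polynomial.X) := by
  have h : ∀ g : Polynomial K, algebraMap _ L g =
      Polynomial.aeval (algebraMap (Polynomial K) L Polynomial.X) g := fun g => by
    rw [Polynomial.aeval_algebraMap_apply, Polynomial.aeval_X_left_apply]
  rw [h, D.map_aeval, ← h, smul_eq_mul]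

omit [CharZero K] [FiniteDimensional (RatFunc K) L] in
lemma place_derivation_poly_le (hw : IsInfinity K w) (D : Derivation K L L)
    (σ : L →ₐ[RatFunc K] AlgebraicClosure (RatFunc K)) (f : Polynomial K) :
    place w σ (D (algebraMap _ L f)) ≤
      place w σ (D (algebraMap (Polynomial K) L Polynomial.X)) * place w σ (algebraMap _ L f) := by
  have hσ := isInfinity_place hw σ
  rw [derivation_poly, Valuation.map_mul, mul_comm]
  refine mul_le_mul' le_rfl ?_
  by_cases hf : Polynomial.derivative f = 0
  · simp [hf]
  have hf0 : f ≠ 0 := by rintro rfl; simp at hf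
  rw [hσ.map_poly hf, hσ.map_poly hf0]
  exact pow_le_pow_right₀ hσ.large.le ((Polynomial.natDegree_derivative_le f).trans (by omega))

omit [CharZero K] [FiniteDimensional (RatFunc K) L] in
lemma place_derivation_ratFunc_le (hw : IsInfinity K w) (D : Derivation K L L)
    (σ : L →ₐ[RatFunc K] AlgebraicClosure (RatFunc K)) (c : RatFunc K) :
    place w σ (D (algebraMap _ L c)) ≤
      place w σ (D (algebraMap (Polynomial K) L Polynomial.X)) * place w σ (algebraMap _ L c) := by
  obtain ⟨a, b, hb, rfl⟩ := IsFractionRing.div_surjective (A := Polynomial K) c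
  have hb0 : algebraMap (Polynomial K) L b ≠ 0 := by
    rw [Ne, map_eq_zero_iff _ (algebraMap_poly_injective K L)]
    exact nonZeroDivisors.ne_zero hb
  simp only [map_div₀, ← IsScalarTower.algebraMap_apply]
  rw [D.leibniz_div, smul_eq_mul, smul_eq_mul, smul_eq_mul, Valuation.map_mul]
  set a' := algebraMap (Polynomial K) L a
  set b' := algebraMap (Polynomial K) L b
  have hvb : place w σ b' ≠ 0 := by simpa using hb0
  have h1 : place w σ (b' * D a' - a' * D b') ≤
      place w σ (D (algebraMap (Polynomial K) L Polynomial.X)) * place w σ a' * place w σ b' := by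
    refine (Valuation.map_sub _ _ _).trans (max_le ?_ ?_)
    · rw [Valuation.map_mul, mul_comm]
      exact mul_le_mul' (place_derivation_poly_le hw D σ a) le_rfl
    · rw [Valuation.map_mul, mul_right_comm, mul_comm]
      exact mul_le_mul' (place_derivation_poly_le hw D σ b) le_rfl
  calc _ ≤ place w σ (b'⁻¹ ^ 2) * _ := mul_le_mul' le_rfl h1
    _ = _ := by rw [Valuation.map_pow, map_inv₀]; field_simp

lemma exists_derivation_le (hw : IsInfinity K w) (D : Derivation K L L) :
    ∃ C : ℝ≥0, 0 < C ∧ ∀ h M, (∀ σ, place w σ h ≤ M) → ∀ σ, place w σ (D h) ≤ C * M := by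
  classical
  let b := Module.finBasis (RatFunc K) L
  obtain ⟨C, hC, hb⟩ := exists_repr_le w b
  let B : ℝ≥0 := Finset.univ.sup fun σ => Finset.univ.sup fun i => place w σ (b i)
  have hB : ∀ σ i, place w σ (b i) ≤ B := fun σ i =>
    (Finset.le_sup (f := fun i => place w σ (b i)) (Finset.mem_univ i)).trans
    (Finset.le_sup (f := fun σ => Finset.univ.sup fun i => place w σ (b i)) (Finset.mem_univ σ))
  let B' : ℝ≥0 := Finset.univ.sup fun σ => Finset.univ.sup fun i => place w σ (D (b i))
  have hB' : ∀ σ i, place w σ (D (b i)) ≤ B' := fun σ i =>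
    (Finset.le_sup (f := fun i => place w σ (D (b i))) (Finset.mem_univ i)).trans
    (Finset.le_sup (f := fun σ => Finset.univ.sup fun i => place w σ (D (b i)))
      (Finset.mem_univ σ))
  let Z : ℝ≥0 := Finset.univ.sup fun σ => place w σ (D (algebraMap (Polynomial K) L Polynomial.X))
  have hZ : ∀ σ, place w σ (D (algebraMap (Polynomial K) L Polynomial.X)) ≤ Z := fun σ =>
    Finset.le_sup (f := fun σ => place w σ (D (algebraMap (Polynomial K) L Polynomial.X)))
      (Finset.mem_univ σ)
  refine ⟨C * (B' + Z * B) + 1, by positivity, fun h M hM σ => ?_⟩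
  have hc : ∀ i, place w σ (algebraMap _ L (b.repr h i)) ≤ C * M := fun i => by
    rw [place_ratFunc]; exact hb h M hM i
  calc place w σ (D h) ≤ C * M * (B' + Z * B) := ?_
    _ = C * (B' + Z * B) * M := by ring
    _ ≤ _ := by gcongr; simp
  conv_lhs => rw [← b.sum_repr h]
  rw [map_sum]
  refine Valuation.map_sum_le _ fun i _ => ?_
  rw [Algebra.smul_def, D.leibniz, smul_eq_mul, smul_eq_mul]
  refine (Valuation.map_add _ _ _).trans (max_le ?_ ?_)
  · rw [Valuation.map_mul]
    exact mul_le_mul' (hc i) ((hB' σ i).trans (by simp))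
  · rw [Valuation.map_mul, mul_comm]
    calc _ ≤ Z * (C * M) * B := mul_le_mul' ((place_derivation_ratFunc_le hw D σ _).trans
          (mul_le_mul' (hZ σ) (hc i))) (hB σ i)
      _ = C * M * (Z * B) := by ring
      _ ≤ _ := by gcongr; simp

omit [CharZero K] [Algebra (RatFunc K) L] [IsScalarTower (Polynomial K) (RatFunc K) L]
  [FiniteDimensional (RatFunc K) L] [IsScalarTower K (Polynomial K) L] in
lemma exists_natCast_one_le [CharZero K] {ι : Type*} [Finite ι] {v : ι → Valuation L ℝ≥0}
    (hv : ∀ i, IsInfinity K (v i)) (h : L) : ∃ n : ℕ, ∀ i, 1 ≤ v i (h - n) := by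
  by_contra! hcon
  choose f hf using hcon
  obtain ⟨m, n, hmn, hfmn⟩ := Finite.exists_ne_map_eq_of_infinite f
  have h1 := Valuation.map_sub_lt _ (hf m) (hfmn ▸ hf n)
  have h2 : h - (m : L) - (h - n) = algebraMap K L (n - m) := by simp
  rw [h2, (hv _).const _ (by rw [sub_ne_zero]; exact_mod_cast hmn.symm)] at h1
  exact lt_irrefl _ h1

lemma exists_place_derivation_le (hw : IsInfinity K w)
    (hw2 : w (algebraMap (Polynomial K) _ Polynomial.X) = 2) (D : Derivation K L L) :
    ∃ C : ℝ≥0, 0 < C ∧ ∀ σ h, place w σ (D h) ≤ C * place w σ h := by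
  classical
  obtain ⟨C, hC, hD⟩ := exists_derivation_le hw D
  have hv := isInfinity_place (L := L) hw
  set x := algebraMap (Polynomial K) L Polynomial.X with hx
  have hpx : ∀ σ, place w σ x = 2 := fun σ => by rw [hx, place_poly, hw2]
  have hx0 : x ≠ 0 := fun h0 => by
    simpa [h0] using hpx (IsAlgClosed.lift (M := AlgebraicClosure (RatFunc K)))
  have key : ∀ σ h, place w σ h ≤ 1 → place w σ (D h) ≤ C := fun σ h hh => by
    obtain ⟨n, hn⟩ := exists_natCast_one_le hv h
    have hn0 : h - n ≠ 0 := fun h0 => by simpa [h0] using hn σ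
    have h1 := hD (h - n)⁻¹ 1 (fun σ => by
      rw [map_inv₀]; exact inv_le_one_of_one_le₀ (hn σ)) σ
    have h2 : D h = -((h - n) ^ 2 * D (h - n)⁻¹) := by
      rw [D.leibniz_inv, _root_.map_sub, D.map_natCast, sub_zero, smul_eq_mul]
      field_simp
    have h3 : place w σ (h - n) ≤ 1 := by
      refine (Valuation.map_sub _ _ _).trans (max_le hh ?_)
      have := (hv σ).const_le (n : K)
      rwa [map_natCast] at this
    rw [h2, Valuation.map_neg, Valuation.map_mul, Valuation.map_pow]
    calc _ ≤ 1 * (C * 1) := mul_le_mul' (pow_le_one' h3 2) h1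
      _ = C := by ring
  refine ⟨C, hC, fun σ h => ?_⟩
  by_cases h0 : h = 0
  · simp [h0]
  have := isAlgebraic_poly K L
  obtain ⟨m, hm, a, hma⟩ := (hv σ).exists_pow_eq h0 (Algebra.IsAlgebraic.isAlgebraic h)
  have hCx : place w σ (D x) ≤ C * 2 := by
    refine hD x 2 (fun σ => (hpx σ).le) σ
  set y := h ^ m * x ^ (-a) with hy
  have hy1 : place w σ y = 1 := by
    rw [hy, Valuation.map_mul, Valuation.map_pow, hma, map_zpow₀,
      ← zpow_add₀ (by rw [hpx]; simp)]
    simp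
  have hy0 : y ≠ 0 := mul_ne_zero (pow_ne_zero _ h0) (zpow_ne_zero _ hx0)
  have hDy : D y = y * (m * D h / h - a * D x / x) := by
    rw [hy, D.leibniz, D.leibniz_pow, D.leibniz_zpow]
    simp only [smul_eq_mul, nsmul_eq_mul, zsmul_eq_mul]
    obtain ⟨k, rfl⟩ := Nat.exists_eq_succ_of_ne_zero hm.ne'
    rw [zpow_sub_one₀ hx0]
    simp only [Nat.succ_eq_add_one, Nat.add_sub_cancel]
    push_cast
    field_simp
    ring
  have hDh : algebraMap K L m * (D h / h) = D y / y + algebraMap K L a * (D x / x) := by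
    rw [hDy, mul_div_cancel_left₀ _ hy0, map_natCast, map_intCast]
    ring
  have h4 := congrArg (place w σ) hDh
  rw [Valuation.map_mul, (hv σ).const _ (by exact_mod_cast hm.ne'), one_mul, map_div₀] at h4
  have h5 : place w σ (D h) / place w σ h ≤ C := by
    rw [h4]
    refine (Valuation.map_add _ _ _).trans (max_le ?_ ?_)
    · rw [map_div₀, hy1, div_one]; exact key σ y hy1.le
    · rw [Valuation.map_mul, map_div₀, hpx]
      calc _ ≤ 1 * (C * 2 / 2) := by gcongr; exact (hv σ).const_le _
        _ = C := by field_simp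
  rwa [div_le_iff₀ (by simpa [zero_lt_iff] using h0)] at h5

end Places

lemma isAlgebraic_adjoin_singleton_of_trdeg_le_one {k B : Type*} [Field k] [CommRing B] [IsDomain B]
    [Algebra k B] (h : Algebra.trdeg k B ≤ 1) {s : B} (hs : Transcendental k s) :
    Algebra.IsAlgebraic (Algebra.adjoin k {s}) B := by
  have h1 : AlgebraicIndependent k (fun _ : Unit => s) :=
    algebraicIndependent_unique_type_iff.2 hs
  have h2 := h1.isTranscendenceBasis_of_lift_trdeg_le_of_finite (by simpa using h)
  have := h2.isAlgebraic
  rwa [Set.range_const] at this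

lemma exists_ringHom_comp_eq {L M Ω : Type*} [Field L] [Field M] [Field Ω] [IsAlgClosed Ω]
    (φ : L →+* M) (h : ∀ t : M, ∃ f : Polynomial L, f ≠ 0 ∧ f.eval₂ φ t = 0) (σ : L →+* Ω) :
    ∃ τ : M →+* Ω, τ.comp φ = σ := by
  let : Algebra L M := φ.toAlgebra
  let : Algebra L Ω := σ.toAlgebra
  have : Algebra.IsAlgebraic L M := ⟨h⟩
  let τ : M →ₐ[L] Ω := IsAlgClosed.lift
  exact ⟨τ.toRingHom, τ.comp_algebraMap⟩

namespace Places

open Valuation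

variable {K L : Type*} [Field K] [CharZero K] [Field L] [Algebra K L] [Algebra (Polynomial K) L]
  [Algebra (RatFunc K) L] [IsScalarTower K (Polynomial K) L]
  [IsScalarTower (Polynomial K) (RatFunc K) L] [FiniteDimensional (RatFunc K) L]

variable {w : Valuation (AlgebraicClosure (RatFunc K)) ℝ≥0}

variable (K L) in
omit [CharZero K] [FiniteDimensional (RatFunc K) L] in
lemma transcendental_X : Transcendental K (algebraMap (Polynomial K) L Polynomial.X) := by
  rw [transcendental_iff]
  intro p hp
  rw [Polynomial.aeval_algebraMap_apply, Polynomial.aeval_X_left_apply] at hp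
  exact (map_eq_zero_iff _ (algebraMap_poly_injective K L)).1 hp

variable (K L) in
omit [CharZero K] in
lemma trdeg_le_one : Algebra.trdeg K L ≤ 1 := by
  have h1 := isAlgebraic_poly K L
  have h2 : Algebra.IsAlgebraic (Algebra.adjoin K {algebraMap (Polynomial K) L Polynomial.X})
      L := by
    refine ⟨fun t => ?_⟩
    obtain ⟨f, hf, hft⟩ := h1.isAlgebraic t
    have hmem : ∀ g : Polynomial K, algebraMap _ L g ∈
        Algebra.adjoin K {algebraMap (Polynomial K) L Polynomial.X} := fun g => by
      rw [← Polynomial.aeval_X_left_apply g, ← Polynomial.aeval_algebraMap_apply]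
      exact Polynomial.aeval_mem_adjoin_singleton _ _
    let ψ : Polynomial K →+* Algebra.adjoin K {algebraMap (Polynomial K) L Polynomial.X} :=
      (algebraMap (Polynomial K) L).codRestrict _ hmem
    have hψ : Function.Injective ψ := fun a b hab =>
      algebraMap_poly_injective K L (congrArg Subtype.val hab)
    refine ⟨f.map ψ, (Polynomial.map_ne_zero_iff hψ).2 hf, ?_⟩
    rw [Polynomial.aeval_def, Polynomial.eval₂_map]
    exact hft
  have := Algebra.IsAlgebraic.trdeg_le_cardinalMk K {algebraMap (Polynomial K) L Polynomial.X}
  simpa using this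

lemma exists_place_rpow (hw : IsInfinity K w)
    (hw2 : w (algebraMap (Polynomial K) _ Polynomial.X) = 2) {ν : Valuation L ℝ≥0}
    (hν : IsInfinity K ν) : ∃ c : ℝ, 0 < c ∧ ∃ σ, ∀ h, ν h = place w σ h ^ c := by
  set a := ν (algebraMap (Polynomial K) L Polynomial.X) with ha
  have ha1 : 1 < a := hν.large
  set c := Real.logb 2 a with hc
  have hc0 : 0 < c := Real.logb_pos (by norm_num) (by exact_mod_cast ha1)
  have h2c : (2 : ℝ≥0) ^ c = a := by
    rw [← NNReal.coe_inj]
    push_cast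
    exact Real.rpow_logb (by norm_num) (by norm_num) (by positivity)
  let f : ℝ≥0 →*₀ ℝ≥0 :=
    { toFun := fun x => x ^ c⁻¹
      map_zero' := NNReal.zero_rpow (inv_ne_zero hc0.ne')
      map_one' := NNReal.one_rpow _
      map_mul' := fun x y => NNReal.mul_rpow }
  have hf : Monotone f := fun x y hxy => NNReal.rpow_le_rpow hxy (inv_nonneg.2 hc0.le)
  have hfν : ∀ h, ν.map f hf h = ν h ^ c⁻¹ := fun _ => rfl
  have h1 : IsInfinity K (ν.map f hf) :=
    ⟨fun t ht => by rw [hfν, hν.const t ht, NNReal.one_rpow], by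
      rw [hfν]; exact NNReal.one_lt_rpow ha1 (inv_pos.2 hc0)⟩
  obtain ⟨σ, hσ⟩ := exists_place_eq hw hw2 h1 (by
    rw [hfν, ← ha, ← h2c, ← NNReal.rpow_mul, mul_inv_cancel₀ hc0.ne', NNReal.rpow_one])
  refine ⟨c, hc0, σ, fun h => ?_⟩
  rw [← hσ, hfν, ← NNReal.rpow_mul, inv_mul_cancel₀ hc0.ne', NNReal.rpow_one]

omit [CharZero K] [Algebra (RatFunc K) L] [IsScalarTower (Polynomial K) (RatFunc K) L]
  [FiniteDimensional (RatFunc K) L] in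
lemma le_one_of_isIntegral {ν : Valuation L ℝ≥0} (hc : ∀ c : K, ν (algebraMap K L c) ≤ 1)
    (hX : ν (algebraMap (Polynomial K) L Polynomial.X) ≤ 1) {h : L}
    (hh : IsIntegral (Polynomial K) h) : ν h ≤ 1 := by
  have hp : ∀ f : Polynomial K, ν (algebraMap _ L f) ≤ 1 := fun f => by
    induction f using Polynomial.induction_on' with
    | add f g hf hg => rw [map_add]; exact (Valuation.map_add _ _ _).trans (max_le hf hg)
    | monomial n a =>
      rw [← Polynomial.C_mul_X_pow_eq_monomial, map_mul, map_pow, ← Polynomial.algebraMap_eq,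
        ← IsScalarTower.algebraMap_apply, Valuation.map_mul, Valuation.map_pow]
      exact mul_le_one' (hc a) (pow_le_one' hX n)
  let ψ : Polynomial K →+* ν.integer := (algebraMap (Polynomial K) L).codRestrict _ hp
  have : IsIntegral ν.integer h := by
    obtain ⟨f, hf, hfh⟩ := hh
    refine ⟨f.map ψ, hf.map ψ, ?_⟩
    rw [Polynomial.eval₂_map]
    exact hfh
  exact (Valuation.integer.integers ν).mem_of_integral this

lemma exists_pullback_place (hw : IsInfinity K w)
    (hw2 : w (algebraMap (Polynomial K) _ Polynomial.X) = 2) (φ : L →ₐ[K] L)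
    (hφ : IsIntegral (Polynomial K) (φ (algebraMap (Polynomial K) L Polynomial.X)))
    (σ : L →ₐ[RatFunc K] AlgebraicClosure (RatFunc K)) :
    ∃ c : ℝ, 0 < c ∧ ∃ τ, ∀ h, place w τ (φ h) = place w σ h ^ c := by
  let x := algebraMap (Polynomial K) L Polynomial.X
  have hφx : Transcendental K (φ x) := fun h =>
    transcendental_X K L ((isAlgebraic_algHom_iff φ φ.injective).1 h)
  have halg := isAlgebraic_adjoin_singleton_of_trdeg_le_one (trdeg_le_one K L) hφx
  obtain ⟨τ, hτ⟩ := exists_ringHom_comp_eq φ.toRingHom (fun t => by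
    obtain ⟨f, hf, hft⟩ := halg.isAlgebraic t
    have hle : ∀ g ∈ Algebra.adjoin K {φ x}, g ∈ φ.range := fun g hg =>
      Algebra.adjoin_le (S := φ.range) (by simp) hg
    let ψ : Algebra.adjoin K {φ x} →+* L :=
      ((AlgEquiv.ofInjective φ φ.injective).symm : φ.range →+* L).comp
        (Subalgebra.inclusion hle : Algebra.adjoin K {φ x} →+* φ.range)
    have hψ : φ.toRingHom.comp ψ = algebraMap (Algebra.adjoin K {φ x}) L := by
      ext g
      exact congrArg Subtype.val ((AlgEquiv.ofInjective φ φ.injective).apply_symm_apply _)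
    have hψi : Function.Injective ψ := by
      refine Function.Injective.of_comp (f := φ.toRingHom) ?_
      rw [← RingHom.coe_comp, hψ]
      exact Subtype.val_injective
    refine ⟨f.map ψ, (Polynomial.map_ne_zero_iff hψi).2 hf, ?_⟩
    rw [Polynomial.eval₂_map, hψ]
    exact hft) σ.toRingHom
  have hτ' : ∀ h, τ (φ h) = σ h := fun h => congrArg (· h) hτ
  have hσ := isInfinity_place hw σ
  have hconst : ∀ c : K, τ (algebraMap K L c) = σ (algebraMap K L c) := fun c => by
    rw [← hτ', φ.commutes]
  have hν : IsInfinity K (w.comap τ) := by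
    have hc : ∀ c : K, c ≠ 0 → w.comap τ (algebraMap K L c) = 1 := fun c h0 => by
      rw [Valuation.comap_apply, hconst]; exact hσ.const c h0
    refine ⟨hc, ?_⟩
    by_contra! hlt
    have h1 := le_one_of_isIntegral (fun c => by
      by_cases h0 : c = 0
      · simp [h0]
      · exact (hc c h0).le) hlt hφ
    rw [Valuation.comap_apply, hτ'] at h1
    exact absurd hσ.large (not_lt.2 h1)
  obtain ⟨c, hc, ρ, hρ⟩ := exists_place_rpow hw hw2 hν
  refine ⟨c⁻¹, inv_pos.2 hc, ρ, fun h => ?_⟩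
  have h1 := hρ (φ h)
  rw [Valuation.comap_apply, hτ'] at h1
  rw [place_apply, place_apply, h1, ← NNReal.rpow_mul, mul_inv_cancel₀ hc.ne', NNReal.rpow_one]
  rfl

end Places

/-- A finite family of valuations of `L` playing the role of the places at infinity (with
multiplicities) of a curve over `K` with a finite map `X` to the affine line. -/
structure IsPlaceSystem (K : Type*) {L ι : Type*} [Field K] [Field L] [Algebra K L]
    [Algebra (Polynomial K) L] [Fintype ι] (v : ι → Valuation L ℝ≥0) : Prop where
  nonempty : Nonempty ι
  isInfinity : ∀ i, Valuation.IsInfinity K (v i)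
  apply_X : ∀ i, v i (algebraMap (Polynomial K) L Polynomial.X) = 2
  quotient_bound : ∀ a : L, IsIntegral (Polynomial K) a → a ≠ 0 → ∃ d : ℕ,
    ∏ i, v i a = 2 ^ d ∧ ∀ V : Submodule K L, (∀ h ∈ V, IsIntegral (Polynomial K) h) →
      (∀ h ∈ V, ∀ g, IsIntegral (Polynomial K) g → h = a * g → h = 0) →
      Module.Finite K V ∧ Module.finrank K V ≤ d
  exists_large : ∃ B : ℝ≥0, 1 ≤ B ∧ ∀ n : ℕ, ∃ V : Submodule K L,
    (∀ h ∈ V, IsIntegral (Polynomial K) h) ∧ Module.finrank K V = Fintype.card ι * (n + 1) ∧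
      ∀ h ∈ V, ∀ i, v i h ≤ B * 2 ^ n
  pullback : ∀ φ : L →ₐ[K] L,
    IsIntegral (Polynomial K) (φ (algebraMap (Polynomial K) L Polynomial.X)) →
    ∀ i, ∃ c : ℝ, 0 < c ∧ ∃ j, ∀ h, v j (φ h) = v i h ^ c
  derivation_le : ∀ D : Derivation K L L, ∃ C : ℝ≥0, 0 < C ∧ ∀ i h, v i (D h) ≤ C * v i h

namespace Places

open Valuation

variable {K L : Type*} [Field K] [CharZero K] [Field L] [Algebra K L] [Algebra (Polynomial K) L]
  [Algebra (RatFunc K) L] [IsScalarTower K (Polynomial K) L]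
  [IsScalarTower (Polynomial K) (RatFunc K) L] [FiniteDimensional (RatFunc K) L]

variable {w : Valuation (AlgebraicClosure (RatFunc K)) ℝ≥0}

lemma exists_large (hw : IsInfinity K w)
    (hw2 : w (algebraMap (Polynomial K) _ Polynomial.X) = 2) :
    ∃ B : ℝ≥0, 1 ≤ B ∧ ∀ n : ℕ, ∃ V : Submodule K L,
    (∀ h ∈ V, IsIntegral (Polynomial K) h) ∧ Module.finrank K V =
      Fintype.card (L →ₐ[RatFunc K] AlgebraicClosure (RatFunc K)) * (n + 1) ∧
      ∀ h ∈ V, ∀ i, place w i h ≤ B * 2 ^ n := by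
  classical
  have hinj := algebraMap_poly_injective K L
  have : FaithfulSMul (Polynomial K) L := (faithfulSMul_iff_algebraMap_injective _ _).2 hinj
  have : Module.IsTorsionFree (Polynomial K) L := inferInstance
  let S := integralClosure (Polynomial K) L
  have hfree : Module.Free (Polynomial K) S :=
    IsIntegralClosure.module_free (Polynomial K) (RatFunc K) L S
  have hfin : Module.Finite (Polynomial K) S :=
    IsIntegralClosure.finite (Polynomial K) (RatFunc K) L S
  have hrank := IsIntegralClosure.rank (Polynomial K) (RatFunc K) L S
  let b := Module.Free.chooseBasis (Polynomial K) S
  have hcard : Fintype.card (L →ₐ[RatFunc K] AlgebraicClosure (RatFunc K)) =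
      Fintype.card (Module.Free.ChooseBasisIndex (Polynomial K) S) := by
    rw [AlgHom.card, ← hrank, Module.finrank_eq_card_chooseBasisIndex]
  let B : ℝ≥0 := 1 + ∑ σ : L →ₐ[RatFunc K] AlgebraicClosure (RatFunc K),
    ∑ i, place w σ (b i : L)
  have hB : ∀ σ i, place w σ (b i : L) ≤ B := fun σ i =>
    (Finset.single_le_sum (f := fun i => place w σ (b i : L)) (fun _ _ => zero_le)
      (Finset.mem_univ i)).trans <|
    (Finset.single_le_sum (f := fun σ => ∑ i, place w σ (b i : L)) (fun _ _ => zero_le)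
      (Finset.mem_univ σ)).trans le_add_self
  let e := (Polynomial.basisMonomials K).smulTower b
  have he : LinearIndependent K fun t => (e t : L) := by
    have h1 := e.linearIndependent.map' (S.val.toLinearMap.restrictScalars K)
      (LinearMap.ker_eq_bot.2 Subtype.val_injective)
    exact h1
  refine ⟨B, by simp [B], fun n => ?_⟩
  let u : Fin (n + 1) × Module.Free.ChooseBasisIndex (Polynomial K) S → L :=
    fun t => (e (t.1, t.2) : L)
  have hu : LinearIndependent K u :=
    he.comp (fun t : Fin (n + 1) × Module.Free.ChooseBasisIndex (Polynomial K) S =>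
      ((t.1 : ℕ), t.2)) (fun s t hst => by
        simp only [Prod.mk.injEq] at hst
        exact Prod.ext (Fin.ext hst.1) hst.2)
  refine ⟨Submodule.span K (Set.range u), fun h hh => ?_, ?_, fun h hh σ => ?_⟩
  · have : Submodule.span K (Set.range u) ≤
        (Subalgebra.toSubmodule (integralClosure (Polynomial K) L)).restrictScalars K := by
      rw [Submodule.span_le]
      rintro _ ⟨t, rfl⟩
      exact (e (t.1, t.2)).2
    exact this hh
  · rw [finrank_span_eq_card hu, Fintype.card_prod, Fintype.card_fin, hcard, mul_comm]
  · have hσ := isInfinity_place hw σ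
    induction hh using Submodule.span_induction with
    | mem _ ht =>
      obtain ⟨t, rfl⟩ := ht
      have : u t = algebraMap (Polynomial K) L (Polynomial.X) ^ (t.1 : ℕ) * (b t.2 : L) := by
        simp only [u, e, Module.Basis.smulTower_apply, Polynomial.coe_basisMonomials]
        rw [← map_pow, Polynomial.X_pow_eq_monomial, ← Algebra.smul_def]
        rfl
      rw [this, Valuation.map_mul, Valuation.map_pow, place_poly, hw2, mul_comm]
      exact mul_le_mul' (hB σ _) (pow_le_pow_right₀ one_le_two (by have := t.1.2; omega))
    | zero => simp
    | add x y _ _ hx hy => exact (Valuation.map_add _ _ _).trans (max_le hx hy)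
    | smul a x _ hx =>
      rw [Algebra.smul_def, Valuation.map_mul]
      exact (mul_le_of_le_one_left' (hσ.const_le a)).trans hx

variable (K L) in
/-- The places at infinity form a place system. -/
theorem exists_isPlaceSystem : ∃ v : (L →ₐ[RatFunc K] AlgebraicClosure (RatFunc K)) →
    Valuation L ℝ≥0, IsPlaceSystem K v := by
  have : Algebra.IsAlgebraic (Polynomial K) (RatFunc K) := IsLocalization.isAlgebraic _
    (nonZeroDivisors (Polynomial K))
  have : Algebra.IsAlgebraic (Polynomial K) (AlgebraicClosure (RatFunc K)) :=
    Algebra.IsAlgebraic.trans (Polynomial K) (RatFunc K) _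
  obtain ⟨w, hw, hw2⟩ := exists_isInfinity_nnreal K (AlgebraicClosure (RatFunc K)) (by
    rw [IsScalarTower.algebraMap_eq (Polynomial K) (RatFunc K)]
    exact (algebraMap (RatFunc K) _).injective.comp (IsFractionRing.injective _ _))
  exact ⟨place w, ⟨IsAlgClosed.lift⟩, isInfinity_place hw, fun σ => by rw [place_poly, hw2],
    fun a ha ha0 => exists_quotient_bound hw hw2 ha ha0, exists_large hw hw2,
    fun φ hφ => exists_pullback_place hw hw2 φ hφ,
    fun D => exists_place_derivation_le hw hw2 D⟩

end Places

namespace IsPlaceSystem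

open Valuation

variable {K L ι : Type*} [Field K] [Field L] [Algebra K L] [Algebra (Polynomial K) L]
  [IsScalarTower K (Polynomial K) L] [Fintype ι] {v : ι → Valuation L ℝ≥0}

omit [IsScalarTower K (Polynomial K) L] in
lemma one_le_prod (hv : IsPlaceSystem K v) {a : L} (ha : IsIntegral (Polynomial K) a)
    (ha0 : a ≠ 0) : 1 ≤ ∏ i, v i a := by
  obtain ⟨d, hd, -⟩ := hv.quotient_bound a ha ha0
  rw [hd]
  exact one_le_pow₀ one_le_two

/-- The integral elements with all valuations bounded by `R`. -/
def bounded (hv : IsPlaceSystem K v) (R : ℝ≥0) : Submodule K L where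
  carrier := {h | IsIntegral (Polynomial K) h ∧ ∀ i, v i h ≤ R}
  zero_mem' := ⟨isIntegral_zero, by simp⟩
  add_mem' := fun hx hy => ⟨hx.1.add hy.1, fun i =>
    (Valuation.map_add _ _ _).trans (max_le (hx.2 i) (hy.2 i))⟩
  smul_mem' := fun c h hh => by
    refine ⟨?_, fun i => ?_⟩
    · rw [Algebra.smul_def, IsScalarTower.algebraMap_apply K (Polynomial K) L]
      exact isIntegral_algebraMap.mul hh.1
    · rw [Algebra.smul_def, Valuation.map_mul]
      exact (mul_le_of_le_one_left' ((hv.isInfinity i).const_le c)).trans (hh.2 i)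

omit [IsScalarTower K (Polynomial K) L] in
lemma X_ne_zero (hv : IsPlaceSystem K v) : algebraMap (Polynomial K) L Polynomial.X ≠ 0 := by
  obtain ⟨i⟩ := hv.nonempty
  intro h
  simpa [h] using hv.apply_X i

lemma finite_bounded (hv : IsPlaceSystem K v) (R : ℝ≥0) : Module.Finite K (hv.bounded R) := by
  obtain ⟨m, hm⟩ := pow_unbounded_of_one_lt R (one_lt_two : (1 : ℝ≥0) < 2)
  obtain ⟨d, -, hd⟩ := hv.quotient_bound (algebraMap (Polynomial K) L Polynomial.X ^ m)
    (isIntegral_algebraMap.pow m) (pow_ne_zero _ hv.X_ne_zero)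
  refine (hd (hv.bounded R) (fun h hh => hh.1) fun h hh g hg hhg => ?_).1
  by_contra h0
  have hg0 : g ≠ 0 := fun h1 => h0 (by rw [hhg, h1, mul_zero])
  have h1 := hv.one_le_prod hg hg0
  have hne := hv.nonempty
  have h2 : ∏ i, v i h < ∏ _i : ι, (2 : ℝ≥0) ^ m := by
    refine Finset.prod_lt_prod_of_nonempty (fun i _ => ?_) (fun i _ => (hh.2 i).trans_lt hm)
      Finset.univ_nonempty
    simpa [zero_lt_iff] using h0
  rw [hhg] at h2
  simp only [Valuation.map_mul, Valuation.map_pow, hv.apply_X, Finset.prod_mul_distrib] at h2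
  exact absurd h2 (not_lt.2 (le_mul_of_one_le_right' h1))

lemma isAlgebraic_of_le_one (hv : IsPlaceSystem K v) {h : L} (hh : IsIntegral (Polynomial K) h)
    (h1 : ∀ i, v i h ≤ 1) : IsAlgebraic K h := by
  have := hv.finite_bounded 1
  by_contra ht
  have hli : LinearIndependent K fun n : ℕ => h ^ n := by
    have h2 := (Polynomial.basisMonomials K).linearIndependent.map'
      (Polynomial.aeval h).toLinearMap
      (LinearMap.ker_eq_bot.2 (transcendental_iff_injective.1 ht))
    refine (funext fun n => ?_ : _ = fun n : ℕ => h ^ n) ▸ h2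
    simp [← Polynomial.X_pow_eq_monomial]
  have hmem : ∀ n : ℕ, h ^ n ∈ hv.bounded 1 := fun n =>
    ⟨hh.pow n, fun i => by rw [Valuation.map_pow]; exact pow_le_one' (h1 i) n⟩
  have h2 : LinearIndependent K fun n : ℕ => (⟨h ^ n, hmem n⟩ : hv.bounded 1) :=
    LinearIndependent.of_comp (hv.bounded 1).subtype hli
  exact Set.infinite_univ (Set.finite_univ_iff.2 h2.finite)

omit [IsScalarTower K (Polynomial K) L] in
lemma exists_le_of_finite (hv : IsPlaceSystem K v) (U : Submodule K L) [Module.Finite K U] :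
    ∃ R : ℝ≥0, ∀ h ∈ U, ∀ i, v i h ≤ R := by
  classical
  let b := Module.finBasis K U
  refine ⟨Finset.univ.sup fun i => Finset.univ.sup fun j => v i (b j : L), fun h hh i => ?_⟩
  have : h = ∑ j, b.repr ⟨h, hh⟩ j • (b j : L) := by
    have := congrArg U.subtype (b.sum_repr ⟨h, hh⟩)
    rw [map_sum] at this
    exact this.symm
  rw [this]
  refine Valuation.map_sum_le _ fun j _ => ?_
  rw [Algebra.smul_def, Valuation.map_mul]
  refine (mul_le_of_le_one_left' ((hv.isInfinity i).const_le _)).trans ?_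
  exact (Finset.le_sup (f := fun j => v i (b j : L)) (Finset.mem_univ j)).trans
    (Finset.le_sup (f := fun i => Finset.univ.sup fun j => v i (b j : L)) (Finset.mem_univ i))

omit [IsScalarTower K (Polynomial K) L] in
lemma le_one_of_isAlgebraic (hv : IsPlaceSystem K v) {a : L} (ha : IsAlgebraic K a) (i : ι) :
    v i a ≤ 1 := by
  have h1 : IsIntegral K a := ha.isIntegral
  obtain ⟨f, hf, hfa⟩ := h1
  refine (Valuation.integer.integers (v i)).mem_of_integral
    ⟨f.map ((algebraMap K L).codRestrict _ (hv.isInfinity i).const_le), hf.map _, ?_⟩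
  rw [Polynomial.eval₂_map]
  exact hfa

omit [IsScalarTower K (Polynomial K) L] in
lemma eq_one_of_isAlgebraic (hv : IsPlaceSystem K v) {a : L} (ha : IsAlgebraic K a) (h0 : a ≠ 0)
    (i : ι) : v i a = 1 := by
  refine le_antisymm (hv.le_one_of_isAlgebraic ha i) ?_
  have := hv.le_one_of_isAlgebraic ha.inv i
  rw [map_inv₀] at this
  exact (inv_le_one₀ (by simpa [zero_lt_iff] using h0)).1 this

lemma isIntegral_map (φ : L →ₐ[K] L)
    (hφ : IsIntegral (Polynomial K) (φ (algebraMap (Polynomial K) L Polynomial.X))) {h : L}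
    (hh : IsIntegral (Polynomial K) h) : IsIntegral (Polynomial K) (φ h) := by
  have hp : ∀ f : Polynomial K, IsIntegral (Polynomial K) (φ (algebraMap _ L f)) := fun f => by
    induction f using Polynomial.induction_on' with
    | add f g hf hg => rw [map_add, map_add]; exact hf.add hg
    | monomial n a =>
      rw [← Polynomial.C_mul_X_pow_eq_monomial, map_mul, map_pow, ← Polynomial.algebraMap_eq,
        ← IsScalarTower.algebraMap_apply, map_mul, map_pow, φ.commutes,
        IsScalarTower.algebraMap_apply K (Polynomial K) L]
      exact isIntegral_algebraMap.mul (hφ.pow n)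
  let ψ : Polynomial K →+* integralClosure (Polynomial K) L :=
    (φ.toRingHom.comp (algebraMap (Polynomial K) L)).codRestrict _ hp
  obtain ⟨f, hf, hfh⟩ := hh
  have h1 : IsIntegral (integralClosure (Polynomial K) L) (φ h) := by
    refine ⟨f.map ψ, hf.map ψ, ?_⟩
    rw [Polynomial.eval₂_map]
    change f.eval₂ (φ.toRingHom.comp (algebraMap (Polynomial K) L)) (φ.toRingHom h) = 0
    rw [← Polynomial.hom_eval₂, hfh, map_zero]
  exact isIntegral_trans (R := Polynomial K) _ h1

omit [IsScalarTower K (Polynomial K) L] in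
/-- Some power of an endomorphism fixes all the places. -/
lemma exists_pow_pullback (hv : IsPlaceSystem K v) (φ : L →ₐ[K] L)
    (hφ : IsIntegral (Polynomial K) (φ (algebraMap (Polynomial K) L Polynomial.X))) :
    ∃ n : ℕ, 0 < n ∧ ∀ i, ∃ c : ℝ, 0 < c ∧ ∀ h, v i ((φ ^ n) h) = v i h ^ c := by
  classical
  have hpull : ∀ x : Set.range v, ∃ y : Set.range v, ∃ c : ℝ, 0 < c ∧
      ∀ h, y.1 (φ h) = x.1 h ^ c := by
    rintro ⟨_, i, rfl⟩
    obtain ⟨c, hc, j, hj⟩ := hv.pullback φ hφ i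
    exact ⟨⟨v j, j, rfl⟩, c, hc, hj⟩
  choose F c hc hF using hpull
  have hX : ∀ x : Set.range v, x.1 (algebraMap (Polynomial K) L Polynomial.X) = 2 := by
    rintro ⟨_, i, rfl⟩
    exact hv.apply_X i
  have hinj : Function.Injective F := by
    intro x y hxy
    have h1 : ∀ h, x.1 h ^ c x = y.1 h ^ c y := fun h => by rw [← hF, ← hF, hxy]
    have h2 : c x = c y := by
      have := h1 (algebraMap (Polynomial K) L Polynomial.X)
      rw [hX, hX] at this
      exact (NNReal.rpow_right_inj (by norm_num) (by norm_num)).1 this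
    refine Subtype.ext (Valuation.ext fun h => ?_)
    have := h1 h
    rw [h2] at this
    exact NNReal.rpow_left_injective (hc y).ne' this
  let e : Equiv.Perm (Set.range v) :=
    Equiv.ofBijective F (Finite.injective_iff_bijective.1 hinj)
  have hpow : ∀ n : ℕ, ∀ x : Set.range v, ∃ c : ℝ, 0 < c ∧
      ∀ h, ((e ^ n) x).1 ((φ ^ n) h) = x.1 h ^ c := by
    intro n
    induction n with
    | zero => exact fun x => ⟨1, one_pos, fun h => by simp⟩
    | succ n ih =>
      intro x
      obtain ⟨c', hc', h'⟩ := ih x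
      refine ⟨c' * c ((e ^ n) x), mul_pos hc' (hc _), fun h => ?_⟩
      rw [pow_succ', pow_succ', NNReal.rpow_mul, ← h']
      exact hF _ _
  refine ⟨orderOf e, orderOf_pos e, fun i => ?_⟩
  obtain ⟨c, hc, h⟩ := hpow (orderOf e) ⟨v i, i, rfl⟩
  rw [pow_orderOf_eq_one] at h
  exact ⟨c, hc, h⟩

end IsPlaceSystem

lemma sum_filter_eq_nonneg_of_sum_pow_mul_nonneg {ι : Type*} [Fintype ι] {d l : ι → ℝ} {D : ℝ}
    (hd : ∀ i, 0 < d i) (hD : ∀ i, d i ≤ D) (hD0 : 0 < D)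
    (h : ∀ m : ℕ, 0 ≤ ∑ i, d i ^ m * l i) : 0 ≤ ∑ i with d i = D, l i := by
  have ht : Filter.Tendsto (fun m : ℕ => ∑ i, (d i / D) ^ m * l i) Filter.atTop
      (nhds (∑ i, if d i = D then l i else 0)) := by
    refine tendsto_finsetSum _ fun i _ => ?_
    split_ifs with hi
    · rw [hi, div_self hD0.ne']; simp
    · have h1 : d i / D < 1 := (div_lt_one hD0).2 (lt_of_le_of_ne (hD i) hi)
      simpa using (tendsto_pow_atTop_nhds_zero_of_lt_one
        (div_nonneg (hd i).le hD0.le) h1).mul_const (l i)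
  rw [Finset.sum_filter]
  refine ge_of_tendsto' ht fun m => ?_
  have : ∑ i, (d i / D) ^ m * l i = (∑ i, d i ^ m * l i) / D ^ m := by
    rw [Finset.sum_div]
    exact Finset.sum_congr rfl fun i _ => by rw [div_pow]; ring
  rw [this]
  exact div_nonneg (h m) (by positivity)

namespace IsPlaceSystem

open Valuation

variable {K L ι : Type*} [Field K] [Field L] [Algebra K L] [Algebra (Polynomial K) L]
  [IsScalarTower K (Polynomial K) L] [Fintype ι] {v : ι → Valuation L ℝ≥0}

section Scaling

variable {φ : L →ₐ[K] L} {d : ι → ℝ}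

omit [Algebra (Polynomial K) L] [IsScalarTower K (Polynomial K) L] [Fintype ι] in
lemma apply_pow (hd : ∀ i h, v i (φ h) = v i h ^ d i) (m : ℕ) (i : ι) (h : L) :
    v i ((φ ^ m) h) = v i h ^ (d i ^ m) := by
  induction m with
  | zero => simp
  | succ m ih => rw [pow_succ', AlgHom.mul_apply, hd, ih, pow_succ, NNReal.rpow_mul]

lemma isIntegral_pow
    (hφ : IsIntegral (Polynomial K) (φ (algebraMap (Polynomial K) L Polynomial.X))) {h : L}
    (hh : IsIntegral (Polynomial K) h) (m : ℕ) : IsIntegral (Polynomial K) ((φ ^ m) h) := by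
  induction m with
  | zero => simpa using hh
  | succ m ih => rw [pow_succ', AlgHom.mul_apply]; exact isIntegral_map φ hφ ih

omit [IsScalarTower K (Polynomial K) L] in
lemma sum_logb_nonneg (hv : IsPlaceSystem K v) {g : L} (hg : IsIntegral (Polynomial K) g)
    (hg0 : g ≠ 0) : 0 ≤ ∑ i, Real.logb 2 (v i g) := by
  rw [← Real.logb_prod _ _ fun i _ => by simpa using hg0]
  refine Real.logb_nonneg (by norm_num) ?_
  exact_mod_cast hv.one_le_prod hg hg0

lemma exists_eq_scaling (hv : IsPlaceSystem K v)
    (hφ : IsIntegral (Polynomial K) (φ (algebraMap (Polynomial K) L Polynomial.X)))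
    (hd0 : ∀ i, 0 < d i) (hd : ∀ i h, v i (φ h) = v i h ^ d i) :
    ∃ D : ℝ, 1 ≤ D ∧ ∀ i, d i = D := by
  classical
  have hne := hv.nonempty
  obtain ⟨i₀, hi₀⟩ := Finite.exists_max d
  set D := d i₀ with hD
  have hD0 : 0 < D := hd0 i₀
  set x := algebraMap (Polynomial K) L Polynomial.X with hx
  have hφx0 : φ x ≠ 0 := by
    rw [Ne, map_eq_zero_iff φ φ.injective]; exact hv.X_ne_zero
  have hfilter : ∀ g, IsIntegral (Polynomial K) g → g ≠ 0 →
      0 ≤ ∑ i with d i = D, Real.logb 2 (v i g) := fun g hg hg0 => by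
    refine sum_filter_eq_nonneg_of_sum_pow_mul_nonneg hd0 hi₀ hD0 fun m => ?_
    have h1 := hv.sum_logb_nonneg (isIntegral_pow hφ hg m) (by
      rwa [Ne, map_eq_zero_iff (φ ^ m) (φ ^ m).injective])
    refine h1.trans (Finset.sum_le_sum fun i _ => ?_)
    rw [apply_pow hd, NNReal.coe_rpow, Real.logb_rpow_eq_mul_logb_of_pos]
    have : v i g ≠ 0 := by simpa using hg0
    positivity
  obtain ⟨B, hB1, hB⟩ := hv.exists_large
  set β := Real.logb 2 B with hβ
  have hbound : ∀ r n : ℕ, (n : ℝ) + β < r * D →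
      (Fintype.card ι * (n + 1) : ℝ) ≤ r * ∑ i, d i := fun r n hrn => by
    obtain ⟨V, hVint, hVrank, hVle⟩ := hB n
    obtain ⟨e, he, hrank⟩ := hv.quotient_bound (φ x ^ r) (hφ.pow r) (pow_ne_zero _ hφx0)
    have h1 := (hrank V hVint fun h hh g hg hhg => ?_).2
    · rw [hVrank] at h1
      have h2 : (e : ℝ) = r * ∑ i, d i := by
        have := congrArg (fun t : ℝ≥0 => Real.logb 2 t) he
        simp only [Valuation.map_pow, hd, hx, hv.apply_X] at this
        push_cast at this
        rw [Real.logb_prod _ _ fun i _ => by positivity, Real.logb_pow,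
          Real.logb_self_eq_one (by norm_num), mul_one] at this
        rw [← this, Finset.mul_sum]
        refine Finset.sum_congr rfl fun i _ => ?_
        rw [Real.logb_pow, Real.logb_rpow (by norm_num) (by norm_num)]
      rw [← h2]
      exact_mod_cast h1
    · by_contra h0
      have hg0 : g ≠ 0 := fun h1 => h0 (by rw [hhg, h1, mul_zero])
      refine absurd (hfilter g hg hg0) (not_le.2 ?_)
      refine Finset.sum_neg (fun i hi => ?_) ⟨i₀, by simp [hD]⟩
      have hi' : d i = D := by simpa using hi
      have h2 : v i h = (2 ^ D) ^ r * v i g := by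
        rw [hhg, Valuation.map_mul, Valuation.map_pow, hd, hx, hv.apply_X, hi']
      have h3 := hVle h hh i
      have hvg : 0 < v i g := by simpa [zero_lt_iff] using hg0
      have h4 : Real.logb 2 (((2 ^ D) ^ r * v i g : ℝ≥0) : ℝ) ≤
          Real.logb 2 ((B * 2 ^ n : ℝ≥0) : ℝ) := by
        refine Real.logb_le_logb_of_le (by norm_num) ?_ ?_
        · exact_mod_cast (by positivity : 0 < (2 ^ D) ^ r * v i g)
        · rw [h2] at h3; exact_mod_cast h3
      push_cast at h4
      rw [Real.logb_mul (by positivity) (by positivity), Real.logb_pow,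
        Real.logb_rpow (by norm_num) (by norm_num),
        Real.logb_mul (by positivity) (by positivity), Real.logb_pow,
        Real.logb_self_eq_one (by norm_num)] at h4
      linarith
  have hNpos : (0 : ℝ) < Fintype.card ι := by exact_mod_cast Fintype.card_pos
  have hle : Fintype.card ι * D ≤ ∑ i, d i := by
    by_contra! hlt
    obtain ⟨r, hr⟩ := exists_nat_gt
      (max ((β + 1) / D) (Fintype.card ι * β / (Fintype.card ι * D - ∑ i, d i)))
    have hr1 := (le_max_left _ _).trans_lt hr
    have hr2 := (le_max_right _ _).trans_lt hr
    rw [div_lt_iff₀ hD0] at hr1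
    rw [div_lt_iff₀ (by linarith)] at hr2
    have hpos : 0 < r * D - β := by linarith
    have hn1 : (⌈r * D - β⌉₊ : ℝ) < r * D - β + 1 := Nat.ceil_lt_add_one hpos.le
    have hn2 : r * D - β ≤ ⌈r * D - β⌉₊ := Nat.le_ceil _
    have hn3 : 0 < ⌈r * D - β⌉₊ := Nat.ceil_pos.2 hpos
    obtain ⟨n, hn⟩ := Nat.exists_eq_succ_of_ne_zero hn3.ne'
    rw [hn] at hn1 hn2
    push_cast at hn1 hn2
    have h1 := hbound r n (by linarith)
    have h2 : (Fintype.card ι : ℝ) * (r * D - β) ≤ Fintype.card ι * (n + 1) := by gcongr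
    nlinarith
  have hall : ∀ i, d i = D := by
    have h1 : ∑ i, d i = ∑ _i : ι, D := by
      refine le_antisymm (Finset.sum_le_sum fun i _ => hi₀ i) ?_
      simpa using hle
    exact fun i => (Finset.sum_eq_sum_iff_of_le fun i _ => hi₀ i).1 h1 i (Finset.mem_univ i)
  refine ⟨D, ?_, hall⟩
  by_contra! hD1
  obtain ⟨m, hm⟩ := exists_pow_lt_of_lt_one (by positivity : 0 < (Fintype.card ι : ℝ)⁻¹) hD1
  obtain ⟨e, he, -⟩ := hv.quotient_bound ((φ ^ m) x) (isIntegral_pow hφ isIntegral_algebraMap m)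
    (by rw [Ne, map_eq_zero_iff (φ ^ m) (φ ^ m).injective]; exact hv.X_ne_zero)
  have h2 : (e : ℝ) = Fintype.card ι * D ^ m := by
    have := congrArg (fun t : ℝ≥0 => Real.logb 2 t) he
    simp only [apply_pow hd, hx, hv.apply_X, hall] at this
    push_cast at this
    rw [Finset.prod_const, Real.logb_pow, Real.logb_pow, Real.logb_self_eq_one (by norm_num),
      mul_one, Real.logb_rpow (by norm_num) (by norm_num)] at this
    rw [← this]; simp
  have h3 : (e : ℝ) < 1 := by
    rw [h2]
    calc _ < (Fintype.card ι : ℝ) * (Fintype.card ι : ℝ)⁻¹ := by gcongr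
      _ = 1 := mul_inv_cancel₀ hNpos.ne'
  have h4 : (0 : ℝ) < e := by rw [h2]; positivity
  have h5 : e < 1 := by exact_mod_cast h3
  have h6 : 0 < e := by exact_mod_cast h4
  omega

end Scaling

end IsPlaceSystem

lemma nonpos_of_nat_mul_le {a b : ℝ} (h : ∀ m : ℕ, a * m ≤ b) : a ≤ 0 := by
  by_contra! ha
  obtain ⟨m, hm⟩ := exists_nat_gt (b / a)
  rw [div_lt_iff₀ ha] at hm
  linarith [h m]

lemma div_add_le_of_geom_sum {a y z c d : ℝ} (hd : 1 < d)
    (h : ∀ m : ℕ, a * (∑ k ∈ Finset.range m, d ^ k) + y * d ^ m ≤ c + z * d ^ m) :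
    a / (d - 1) + y ≤ z := by
  have hd1 : 0 < d - 1 := by linarith
  set t := a / (d - 1) + y - z with ht
  suffices t ≤ 0 by linarith
  by_contra! h0
  obtain ⟨m, hm⟩ := pow_unbounded_of_one_lt ((c + a / (d - 1)) / t) hd
  have h1 := h m
  rw [geom_sum_eq hd.ne'] at h1
  rw [div_lt_iff₀ h0] at hm
  have h2 : a * ((d ^ m - 1) / (d - 1)) = a / (d - 1) * (d ^ m - 1) := by ring
  rw [h2] at h1
  rw [ht] at hm
  nlinarith

namespace IsPlaceSystem

open Valuation

variable {K L ι : Type*} [Field K] [Field L] [Algebra K L] [Algebra (Polynomial K) L]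
  [IsScalarTower K (Polynomial K) L] [Fintype ι] {v : ι → Valuation L ℝ≥0}

/-- An element with recurrent orbit in a finite dimensional space under an expanding endomorphism
is algebraic. -/
lemma isAlgebraic_of_frequently_mem (hv : IsPlaceSystem K v) {φ : L →ₐ[K] L} {d : ℝ} (hd1 : 1 < d)
    (hd : ∀ i h, v i (φ h) = v i h ^ d) {a : L} (ha : IsIntegral (Polynomial K) a)
    (U : Submodule K L) [Module.Finite K U] (hU : ∀ N, ∃ m ≥ N, (φ ^ m) a ∈ U) :
    IsAlgebraic K a := by
  obtain ⟨R, hR⟩ := hv.exists_le_of_finite U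
  refine hv.isAlgebraic_of_le_one ha fun i => ?_
  by_contra! h1
  have hlog : 0 < Real.logb 2 (v i a) := Real.logb_pos (by norm_num) (by exact_mod_cast h1)
  have hRpos : 0 < R := by
    obtain ⟨m, -, hm⟩ := hU 0
    refine lt_of_lt_of_le ?_ (hR _ hm i)
    rw [apply_pow (d := fun _ => d) hd]
    exact NNReal.rpow_pos (zero_lt_one.trans h1)
  obtain ⟨N, hN⟩ := pow_unbounded_of_one_lt (Real.logb 2 R / Real.logb 2 (v i a)) hd1
  obtain ⟨m, hm, hmU⟩ := hU N
  have h2 := hR _ hmU i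
  rw [apply_pow (d := fun _ => d) hd] at h2
  have h3 : Real.logb 2 ((v i a : ℝ) ^ (d ^ m)) ≤ Real.logb 2 R :=
    Real.logb_le_logb_of_le (by norm_num) (Real.rpow_pos_of_pos (by
      exact_mod_cast zero_lt_one.trans h1) _) (by exact_mod_cast h2)
  rw [Real.logb_rpow_eq_mul_logb_of_pos (by exact_mod_cast zero_lt_one.trans h1)] at h3
  rw [div_lt_iff₀ hlog] at hN
  have h4 : d ^ N ≤ d ^ m := pow_le_pow_right₀ hd1.le hm
  nlinarith

/-- Integral elements have orbits satisfying linear recurrences under a non-expanding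
endomorphism. -/
lemma exists_aeval_eq_zero (hv : IsPlaceSystem K v) {φ : L →ₐ[K] L}
    (hφ : IsIntegral (Polynomial K) (φ (algebraMap (Polynomial K) L Polynomial.X)))
    (hd : ∀ i h, v i (φ h) = v i h) {h : L} (hh : IsIntegral (Polynomial K) h) :
    ∃ f : Polynomial K, f.coeff 0 ≠ 0 ∧
      Polynomial.aeval (R := K) (A := Module.End K L) φ.toLinearMap f h = 0 := by
  set T : Module.End K L := φ.toLinearMap with hT
  set U := hv.bounded (Finset.univ.sup fun i => v i h)
  have hfin : Module.Finite K U := hv.finite_bounded _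
  have hmem : ∀ n, (T ^ n) h ∈ U := fun n => by
    have e : (T ^ n) h = (φ ^ n) h := by
      induction n with
      | zero => simp
      | succ n ih => rw [pow_succ', Module.End.mul_apply, ih, pow_succ' φ, AlgHom.mul_apply]; rfl
    rw [e]
    refine ⟨isIntegral_pow hφ hh n, fun i => ?_⟩
    rw [apply_pow (d := fun _ => 1) (by simpa using hd)]
    simpa using Finset.le_sup (f := fun i => v i h) (Finset.mem_univ i)
  have hmem' : ∀ f : Polynomial K, Polynomial.aeval T f h ∈ U := fun f => by
    rw [Polynomial.aeval_eq_sum_range, LinearMap.sum_apply]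
    exact Submodule.sum_mem _ fun n _ => U.smul_mem _ (hmem n)
  let ev : Polynomial K →ₗ[K] U :=
    ((LinearMap.applyₗ h).comp (Polynomial.aeval T).toLinearMap).codRestrict U hmem'
  have hninj : ¬ Function.Injective ev := fun hi =>
    Polynomial.not_finite (R := K) (Module.Finite.of_injective ev hi)
  obtain ⟨f, hf, hf0⟩ : ∃ f, ev f = 0 ∧ f ≠ 0 := by
    by_contra! hcon
    exact hninj ((injective_iff_map_eq_zero ev).2 hcon)
  have hf' : Polynomial.aeval T f h = 0 := congrArg Subtype.val hf
  obtain ⟨g, hg, hndvd⟩ := f.exists_eq_pow_rootMultiplicity_mul_and_not_dvd hf0 0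
  refine ⟨g, ?_, ?_⟩
  · rwa [Polynomial.C_0, sub_zero, Polynomial.X_dvd_iff] at hndvd
  · rw [hg, Polynomial.C_0, sub_zero, map_mul, Module.End.mul_apply, map_pow,
      Polynomial.aeval_X] at hf'
    have hinj : Function.Injective (T ^ f.rootMultiplicity 0) := by
      rw [Module.End.coe_pow]
      exact Function.Injective.iterate φ.injective _
    exact hinj (by rw [hf', map_zero])

section Derivation

variable {φ : L →ₐ[K] L} {D : Derivation K L L} {J : L} {d : ℝ}

omit [Algebra (Polynomial K) L] [IsScalarTower K (Polynomial K) L] in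
lemma derivation_pow_apply (hJ : ∀ h, D (φ h) = J * φ (D h)) (m : ℕ) (h : L) :
    D ((φ ^ m) h) = (∏ k ∈ Finset.range m, (φ ^ k) J) * (φ ^ m) (D h) := by
  induction m generalizing h with
  | zero => simp
  | succ m ih =>
    rw [pow_succ, AlgHom.mul_apply, ih, hJ, map_mul, Finset.prod_range_succ, AlgHom.mul_apply,
      mul_assoc]

omit [IsScalarTower K (Polynomial K) L] in
lemma exists_logb_le (hv : IsPlaceSystem K v) (hd : ∀ i h, v i (φ h) = v i h ^ d)
    (hJ : ∀ h, D (φ h) = J * φ (D h)) (hJ0 : J ≠ 0) :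
    ∃ c : ℝ, ∀ i h, D h ≠ 0 → ∀ m : ℕ,
      Real.logb 2 (v i J) * (∑ k ∈ Finset.range m, d ^ k) + Real.logb 2 (v i (D h)) * d ^ m ≤
        c + Real.logb 2 (v i h) * d ^ m := by
  obtain ⟨C, hC0, hC⟩ := hv.derivation_le D
  refine ⟨Real.logb 2 C, fun i h hh m => ?_⟩
  have hpos : ∀ g : L, g ≠ 0 → 0 < (v i g : ℝ) := fun g hg => by
    have : v i g ≠ 0 := by simpa using hg
    positivity
  have hlog : ∀ g : L, g ≠ 0 → ∀ k, Real.logb 2 (v i ((φ ^ k) g)) = Real.logb 2 (v i g) * d ^ k :=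
    fun g hg k => by
      rw [apply_pow (d := fun _ => d) hd, NNReal.coe_rpow,
        Real.logb_rpow_eq_mul_logb_of_pos (hpos g hg), mul_comm]
  have hne : ∀ g : L, g ≠ 0 → ∀ k, (φ ^ k) g ≠ 0 := fun g hg k =>
    (map_ne_zero_iff (φ ^ k) (φ ^ k).injective).2 hg
  have hh0 : h ≠ 0 := by rintro rfl; simp at hh
  have h1 := hC i ((φ ^ m) h)
  rw [derivation_pow_apply hJ, map_mul, map_prod] at h1
  have h2 : Real.logb 2 ((∏ k ∈ Finset.range m, (v i ((φ ^ k) J) : ℝ)) * v i ((φ ^ m) (D h))) ≤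
      Real.logb 2 (C * v i ((φ ^ m) h)) := by
    refine Real.logb_le_logb_of_le (by norm_num) (mul_pos (Finset.prod_pos fun k _ =>
      hpos _ (hne _ hJ0 k)) (hpos _ (hne _ hh m))) (by exact_mod_cast h1)
  rw [Real.logb_mul (Finset.prod_ne_zero_iff.2 fun k _ => (hpos _ (hne _ hJ0 k)).ne')
    (hpos _ (hne _ hh m)).ne', Real.logb_prod _ _ fun k _ => (hpos _ (hne _ hJ0 k)).ne',
    Real.logb_mul (by positivity) (hpos _ (hne _ hh0 m)).ne', hlog _ hh, hlog _ hh0] at h2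
  simpa only [hlog _ hJ0, ← Finset.mul_sum] using h2

omit [IsScalarTower K (Polynomial K) L] in
lemma logb_derivation_le (hv : IsPlaceSystem K v) (hd1 : 1 < d) (hd : ∀ i h, v i (φ h) = v i h ^ d)
    (hJ : ∀ h, D (φ h) = J * φ (D h)) (hJ0 : J ≠ 0) (i : ι) {h : L} (hh : D h ≠ 0) :
    Real.logb 2 (v i J) / (d - 1) + Real.logb 2 (v i (D h)) ≤ Real.logb 2 (v i h) := by
  obtain ⟨c, hc⟩ := exists_logb_le hv hd hJ hJ0
  exact div_add_le_of_geom_sum hd1 (hc i h hh)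

omit [IsScalarTower K (Polynomial K) L] in
/-- A derivation scaled by an expanding endomorphism by an algebraic factor does not increase the
valuations. -/
lemma derivation_le_of_isAlgebraic (hv : IsPlaceSystem K v) (hd1 : 1 < d)
    (hd : ∀ i h, v i (φ h) = v i h ^ d) (hJ : ∀ h, D (φ h) = J * φ (D h)) (hJ0 : J ≠ 0)
    (hJa : IsAlgebraic K J) (i : ι) (h : L) : v i (D h) ≤ v i h := by
  by_cases hh : D h = 0
  · simp [hh]
  have h1 := logb_derivation_le hv hd1 hd hJ hJ0 i hh
  rw [hv.eq_one_of_isAlgebraic hJa hJ0, NNReal.coe_one, Real.logb_one, zero_div, zero_add] at h1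
  have hh0 : h ≠ 0 := by rintro rfl; simp at hh
  have hpos : ∀ g : L, g ≠ 0 → 0 < (v i g : ℝ) := fun g hg => by
    have : v i g ≠ 0 := by simpa using hg
    positivity
  exact_mod_cast (Real.logb_le_logb (by norm_num) (hpos _ hh) (hpos _ hh0)).1 h1

lemma isAlgebraic_of_scaling_eq_one (hv : IsPlaceSystem K v)
    (hd : ∀ i h, v i (φ h) = v i h) (hJ : ∀ h, D (φ h) = J * φ (D h)) (hJ0 : J ≠ 0)
    (hJi : IsIntegral (Polynomial K) J) (hD0 : D ≠ 0) : IsAlgebraic K J := by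
  refine hv.isAlgebraic_of_le_one hJi fun i => ?_
  obtain ⟨h, hh⟩ : ∃ h, D h ≠ 0 := by
    by_contra! hcon
    exact hD0 (Derivation.ext hcon)
  obtain ⟨c, hc⟩ := exists_logb_le (d := 1) hv (by simpa using hd) hJ hJ0
  have h1 : Real.logb 2 (v i J) ≤ 0 :=
    nonpos_of_nat_mul_le (b := c + Real.logb 2 (v i h) - Real.logb 2 (v i (D h))) fun m => by
      have := hc i h hh m
      simp only [one_pow, Finset.sum_const, Finset.card_range, nsmul_eq_mul, mul_one] at this
      linarith
  have hpos : 0 < (v i J : ℝ) := by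
    have : v i J ≠ 0 := by simpa using hJ0
    positivity
  rw [← Real.logb_one (b := 2), Real.logb_le_logb (by norm_num) hpos one_pos] at h1
  exact_mod_cast h1

/-- If the scaling factor of a derivation under an expanding endomorphism is not invertible, then
the derivation is locally nilpotent. -/
lemma exists_mul_eq_one_or_locally_nilpotent (hv : IsPlaceSystem K v) (hd1 : 1 < d)
    (hd : ∀ i h, v i (φ h) = v i h ^ d) (hJ : ∀ h, D (φ h) = J * φ (D h)) (hJ0 : J ≠ 0)
    (hJi : IsIntegral (Polynomial K) J)
    (hD : ∀ h, IsIntegral (Polynomial K) h → IsIntegral (Polynomial K) (D h)) :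
    (∃ g, IsIntegral (Polynomial K) g ∧ J * g = 1) ∨
      ∀ h, IsIntegral (Polynomial K) h → ∃ m, D^[m] h = 0 := by
  by_cases hs : ∑ i, Real.logb 2 (v i J) = 0
  · left
    obtain ⟨e, he, hV⟩ := hv.quotient_bound J hJi hJ0
    have he0 : e = 0 := by
      rw [← Real.logb_prod _ _ fun i _ => by simpa using hJ0] at hs
      have h2 := congrArg (fun t : ℝ≥0 => Real.logb 2 t) he
      push_cast at h2
      rw [hs, Real.logb_pow, Real.logb_self_eq_one (by norm_num)] at h2
      have : (e : ℝ) = 0 := by linarith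
      exact_mod_cast this
    subst he0
    have hconst : ∀ c : K, IsIntegral (Polynomial K) (algebraMap K L c) := fun c => by
      rw [IsScalarTower.algebraMap_apply K (Polynomial K) L]
      exact isIntegral_algebraMap
    by_contra! hcon
    have := (hV (Submodule.span K {1}) (fun h hh => ?_) fun h hh g hg hhg => ?_).2
    · rw [finrank_span_singleton one_ne_zero] at this
      omega
    · obtain ⟨c, rfl⟩ := Submodule.mem_span_singleton.1 hh
      rw [Algebra.smul_def, mul_one]
      exact hconst c
    · obtain ⟨c, rfl⟩ := Submodule.mem_span_singleton.1 hh
      by_contra hc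
      have hc0 : c ≠ 0 := by rintro rfl; simp at hc
      refine hcon (algebraMap K L c⁻¹ * g) ((hconst _).mul hg) ?_
      rw [mul_left_comm, ← hhg, ← Algebra.smul_def, smul_smul, inv_mul_cancel₀ hc0, one_smul]
  · right
    have hs' : 0 < ∑ i, Real.logb 2 (v i J) := lt_of_le_of_ne (hv.sum_logb_nonneg hJi hJ0)
      (Ne.symm hs)
    intro h hh
    by_contra! hcon
    have hint : ∀ m, IsIntegral (Polynomial K) (D^[m] h) := fun m => by
      induction m with
      | zero => exact hh
      | succ m ih => rw [Function.iterate_succ_apply']; exact hD _ ih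
    have hle : ∀ m : ℕ, ∀ i, Real.logb 2 (v i J) / (d - 1) * m + Real.logb 2 (v i (D^[m] h)) ≤
        Real.logb 2 (v i h) := fun m i => by
      induction m with
      | zero => simp
      | succ m ih =>
        have := logb_derivation_le hv hd1 hd hJ hJ0 i (h := D^[m] h)
          (by rw [← Function.iterate_succ_apply' (f := D)]; exact hcon _)
        rw [← Function.iterate_succ_apply' (f := D)] at this
        push_cast
        linarith
    have h1 : (∑ i, Real.logb 2 (v i J)) / (d - 1) ≤ 0 :=
      nonpos_of_nat_mul_le (b := ∑ i, Real.logb 2 (v i h)) fun m => by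
        have h2 := Finset.sum_le_sum fun i (_ : i ∈ Finset.univ) => hle m i
        rw [Finset.sum_add_distrib, ← Finset.sum_mul, ← Finset.sum_div] at h2
        linarith [hv.sum_logb_nonneg (hint m) (hcon m)]
    exact absurd h1 (not_le.2 (div_pos hs' (by linarith)))

end Derivation

end IsPlaceSystem

/-- In characteristic zero, a derivation vanishing on a subalgebra vanishes on the elements
algebraic over it. -/
lemma Derivation.eq_zero_of_isAlgebraic {k B : Type*} [CommRing k] [CommRing B] [IsDomain B]
    [CharZero B] [Algebra k B] (d : Derivation k B B) {S : Subalgebra k B} (hS : ∀ s ∈ S, d s = 0)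
    {h : B} (hh : IsAlgebraic S h) : d h = 0 := by
  obtain ⟨f, hf0, hf⟩ := hh
  induction hn : f.natDegree using Nat.strong_induction_on generalizing f with
  | _ n ih =>
  have h1 : d (Polynomial.aeval h f) = Polynomial.aeval h (Polynomial.derivative f) * d h := by
    clear hn hf hf0 ih
    induction f using Polynomial.induction_on' with
    | add f g hf hg => simp only [map_add, hf, hg, add_mul]
    | monomial m a =>
      rw [Polynomial.aeval_monomial, Polynomial.derivative_monomial, Polynomial.aeval_monomial,
        Derivation.leibniz, show algebraMap S B a = (a : B) from rfl, hS _ a.2, smul_zero, add_zero,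
        Derivation.leibniz_pow, smul_eq_mul, _root_.map_mul, _root_.map_natCast, smul_eq_mul,
        nsmul_eq_mul,
        show algebraMap S B a = (a : B) from rfl]
      ring
  rw [hf, map_zero] at h1
  rcases mul_eq_zero.1 h1.symm with h2 | h2
  · have hn0 : f.natDegree ≠ 0 := fun h0 => by
      rw [Polynomial.natDegree_eq_zero] at h0
      obtain ⟨a, rfl⟩ := h0
      rw [Polynomial.aeval_C] at hf
      exact hf0 (by rw [show a = 0 from Subtype.val_injective hf, map_zero])
    refine ih _ ?_ (Polynomial.derivative f) ?_ h2 rfl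
    · exact hn ▸ Polynomial.natDegree_derivative_lt hn0
    · intro h0
      exact hn0 (Polynomial.derivative_eq_zero.1 h0)
  · exact h2

lemma Derivation.eq_zero_of_mem_adjoin_singleton {k B : Type*} [CommRing k] [CommRing B]
    [Algebra k B] (d : Derivation k B B) {p : B} (hp : d p = 0) :
    ∀ s ∈ Algebra.adjoin k {p}, d s = 0 := fun s hs =>
  Derivation.eqOn_adjoin (D1 := d) (D2 := 0) (s := {p}) (by simpa using hp) hs

lemma exists_algebraMap_eq_of_isAlgebraic {k B : Type*} [Field k] [IsAlgClosed k] [CommRing B]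
    [IsDomain B] [Algebra k B] {s : B} (hs : IsAlgebraic k s) : ∃ c, algebraMap k B c = s := by
  have : Algebra.IsIntegral k (Algebra.adjoin k {s}) :=
    Algebra.IsIntegral.adjoin (by simpa using hs.isIntegral)
  obtain ⟨c, hc⟩ := (IsAlgClosed.algebraMap_bijective_of_isIntegral (k := k)
    (K := Algebra.adjoin k {s})).2 ⟨s, Algebra.self_mem_adjoin_singleton k s⟩
  exact ⟨c, congrArg Subtype.val hc⟩

namespace MvPolynomial

lemma trdeg_le_one_of_not_injective {B : Type*} [CommRing B] [IsDomain B] [Algebra ℂ B]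
    (ψ : P →ₐ[ℂ] B) (hs : Function.Surjective ψ) (hψ : ¬ Function.Injective ψ) :
    Algebra.trdeg ℂ B ≤ 1 := by
  set y : Fin 2 → B := fun i => ψ (X i) with hy
  have hay : aeval y = ψ := algHom_ext fun i => by simp [hy]
  have htop : Algebra.adjoin ℂ (Set.range y) = ⊤ := by
    rw [Algebra.adjoin_range_eq_range_aeval, hay]
    exact (AlgHom.range_eq_top ψ).2 hs
  have halg : Algebra.IsAlgebraic (Algebra.adjoin ℂ (Set.range y)) B := by
    refine ⟨fun b => ?_⟩
    have hb : b ∈ Algebra.adjoin ℂ (Set.range y) := by rw [htop]; trivial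
    exact isAlgebraic_algebraMap (A := B) (⟨b, hb⟩ : Algebra.adjoin ℂ (Set.range y))
  obtain ⟨t, hts, ht⟩ := exists_isTranscendenceBasis_subset (R := ℂ) (Set.range y)
  rw [← ht.cardinalMk_eq_trdeg, Cardinal.mk_le_one_iff_set_subsingleton]
  by_contra hns
  rw [Set.not_subsingleton_iff] at hns
  obtain ⟨a, ha, b, hb, hab⟩ := hns
  refine hψ ?_
  have hyt : ∀ i, y i ∈ t := by
    obtain ⟨i, rfl⟩ := hts ha
    obtain ⟨j, rfl⟩ := hts hb
    have hij : i ≠ j := fun h => hab (h ▸ rfl)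
    intro k
    have : k = i ∨ k = j := by omega
    rcases this with rfl | rfl <;> assumption
  have hyinj : Function.Injective fun i => (⟨y i, hyt i⟩ : t) := by
    obtain ⟨i, rfl⟩ := hts ha
    obtain ⟨j, rfl⟩ := hts hb
    intro k l hkl
    have hkl' : y k = y l := congrArg Subtype.val hkl
    by_contra hne
    have : (k = i ∧ l = j) ∨ (k = j ∧ l = i) := by
      have hij : i ≠ j := fun h => hab (h ▸ rfl)
      omega
    rcases this with ⟨rfl, rfl⟩ | ⟨rfl, rfl⟩
    · exact hab hkl'
    · exact hab hkl'.symm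
  have := ht.1.comp _ hyinj
  rw [← hay]
  exact this

lemma isAlgebraic_adjoin_of_not_injective {B : Type*} [CommRing B] [IsDomain B] [Algebra ℂ B]
    (ψ : P →ₐ[ℂ] B) (hψ : ¬ Function.Injective ψ) {s : P} (hs : Transcendental ℂ (ψ s)) (t : P) :
    IsAlgebraic (Algebra.adjoin ℂ {ψ s}) (ψ t) := by
  have h1 := trdeg_le_one_of_not_injective ψ.rangeRestrict ψ.rangeRestrict_surjective
    fun h => hψ fun a b hab => h (Subtype.ext hab)
  have hs' : Transcendental ℂ (ψ.rangeRestrict s) := fun h =>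
    hs (by simpa using h.algHom ψ.range.val)
  obtain ⟨f, hf0, hf⟩ :=
    (isAlgebraic_adjoin_singleton_of_trdeg_le_one h1 hs').isAlgebraic (ψ.rangeRestrict t)
  have hmap : ∀ x ∈ Algebra.adjoin ℂ {ψ.rangeRestrict s},
      ψ.range.val x ∈ Algebra.adjoin ℂ {ψ s} := fun x hx => by
    have : ψ.range.val x ∈ (Algebra.adjoin ℂ {ψ.rangeRestrict s}).map ψ.range.val := ⟨x, hx, rfl⟩
    rw [AlgHom.map_adjoin, Set.image_singleton] at this
    exact this
  let θ : Algebra.adjoin ℂ {ψ.rangeRestrict s} →+* Algebra.adjoin ℂ {ψ s} :=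
    (ψ.range.val.toRingHom.comp (Subalgebra.val _).toRingHom).codRestrict
      (Algebra.adjoin ℂ {ψ s}) fun x => hmap x x.2
  have hθ : Function.Injective θ := fun a b hab => by
    have h2 : (θ a : B) = θ b := congrArg Subtype.val hab
    exact Subtype.ext (Subtype.ext h2)
  refine ⟨f.map θ, (Polynomial.map_ne_zero_iff hθ).2 hf0, ?_⟩
  have := congrArg ψ.range.val hf
  rw [map_zero, Polynomial.aeval_def, ← RingHom.coe_coe, Polynomial.hom_eval₂] at this
  rw [Polynomial.aeval_def, Polynomial.eval₂_map]
  exact this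

/-- The Poisson bracket (Jacobian determinant) with `f`. -/
noncomputable def poisson (f : P) : Derivation ℂ P P :=
    pderiv 0 f • pderiv 1 - pderiv 1 f • pderiv 0

lemma poisson_apply (f g : P) :
    poisson f g = pderiv 0 f * pderiv 1 g - pderiv 1 f * pderiv 0 g := rfl

lemma poisson_swap (f g : P) : poisson f g = - poisson g f := by
  simp only [poisson_apply]; ring

@[simp] lemma poisson_self (f : P) : poisson f f = 0 := by
  simp only [poisson_apply]; ring

lemma derivation_apply_algHom {B : Type*} [CommRing B] [Algebra ℂ B] (D : Derivation ℂ B B)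
    (φ : P →ₐ[ℂ] B) (g : P) :
    D (φ g) = φ (pderiv 0 g) * D (φ (X 0)) + φ (pderiv 1 g) * D (φ (X 1)) := by
  induction g using MvPolynomial.induction_on with
  | C a => simp [← MvPolynomial.algebraMap_eq]
  | add f g hf hg => simp only [map_add, hf, hg]; ring
  | mul_X f i hf =>
    fin_cases i <;> simp [hf, pderiv_X] <;> ring

lemma poisson_map (φ : P →ₐ[ℂ] P) (f g : P) :
    poisson (φ f) (φ g) = poisson (φ (X 0)) (φ (X 1)) * φ (poisson f g) := by
  rw [derivation_apply_algHom, poisson_swap _ (φ (X 0)), poisson_swap _ (φ (X 1)),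
    derivation_apply_algHom, derivation_apply_algHom _ _ f, poisson_self, poisson_self,
    poisson_swap (φ (X 1)), poisson_apply f g]
  simp only [map_sub, map_mul]
  ring

lemma eq_C_of_pderiv_eq_zero {f : P} (h : ∀ i, pderiv i f = 0) : ∃ c, f = C c := by
  refine ⟨coeff 0 f, ?_⟩
  ext m
  rw [coeff_C]
  split_ifs with hm
  · rw [hm]
  · obtain ⟨i, hi⟩ : ∃ i, m i ≠ 0 := by
      by_contra! hcon
      exact hm (Finsupp.ext hcon).symm
    have h1 := coeff_pderiv (i := i) f (m - Finsupp.single i 1)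
    rw [h, coeff_zero, tsub_add_cancel_of_le (by simpa [Nat.one_le_iff_ne_zero] using hi)] at h1
    rcases mul_eq_zero.1 h1.symm with h2 | h2
    · exact h2
    · exact absurd h2 (Nat.cast_add_one_ne_zero _)

lemma exists_eq_C_of_poisson_eq_zero {f : P} (h : poisson f = 0) : ∃ c, f = C c := by
  refine eq_C_of_pderiv_eq_zero fun i => ?_
  fin_cases i
  · simpa [poisson_apply, pderiv_X, Pi.single_apply] using DFunLike.congr_fun h (X 1)
  · simpa [poisson_apply, pderiv_X, Pi.single_apply] using DFunLike.congr_fun h (X 0)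

/-- A polynomial killed by a nonzero derivation of the residue ring of a prime `ϖ` is constant
modulo `ϖ`. -/
lemma exists_dvd_sub_C {ϖ : P} (hϖ : Prime ϖ) (δ : Derivation ℂ P P) (h1 : ϖ ∣ δ ϖ)
    {g s : P} (hg : ¬ ϖ ∣ δ g) (hs : ϖ ∣ δ s) : ∃ c, ϖ ∣ s - C c := by
  set I := Ideal.span {ϖ} with hI
  have hprime : I.IsPrime := (Ideal.span_singleton_prime hϖ.ne_zero).2 hϖ
  let q : P →ₐ[ℂ] P ⧸ I := Ideal.Quotient.mkₐ ℂ I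
  have hq : Function.Surjective q := Ideal.Quotient.mkₐ_surjective ℂ I
  have hq0 : ∀ a, q a = 0 ↔ ϖ ∣ a := fun a => by
    rw [← Ideal.mem_span_singleton, ← hI]; exact Ideal.Quotient.eq_zero_iff_mem
  let δ' : Derivation ℂ (P ⧸ I) (P ⧸ I) := Derivation.liftOfSurjective (f := q) hq (d := δ)
    fun a ha => by
      rw [hq0] at ha ⊢
      obtain ⟨b, rfl⟩ := ha
      rw [Derivation.leibniz, smul_eq_mul, smul_eq_mul]
      exact dvd_add (dvd_mul_right _ _) (h1.mul_left _)
  have hδ' : ∀ a, δ' (q a) = q (δ a) := fun a => Derivation.liftOfSurjective_apply hq _ a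
  have : CharZero (P ⧸ I) := charZero_of_injective_algebraMap (algebraMap ℂ (P ⧸ I)).injective
  have hinj : ¬ Function.Injective q := fun h =>
    hϖ.ne_zero (h (by rw [map_zero, hq0]))
  by_cases ht : Transcendental ℂ (q s)
  · refine absurd ?_ hg
    rw [← hq0, ← hδ']
    refine δ'.eq_zero_of_isAlgebraic (δ'.eq_zero_of_mem_adjoin_singleton (p := q s) ?_)
      (isAlgebraic_adjoin_of_not_injective q hinj ht g)
    rwa [hδ', hq0]
  · obtain ⟨c, hc⟩ := exists_algebraMap_eq_of_isAlgebraic (not_not.1 ht)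
    refine ⟨c, ?_⟩
    rw [← hq0, map_sub, ← hc, ← MvPolynomial.algebraMap_eq, AlgHom.commutes, sub_self]

end MvPolynomial

lemma AlgHom.eq_id_of_comp_self_of_range_eq_top {k B : Type*} [CommSemiring k] [Semiring B]
    [Algebra k B] {π : B →ₐ[k] B} (hπ : π.comp π = π) (h : π.range = ⊤) : π = AlgHom.id k B := by
  ext b
  obtain ⟨a, rfl⟩ := (AlgHom.range_eq_top π).1 h b
  exact DFunLike.congr_fun hπ a

lemma map_aeval_adjoin_singleton {k B : Type*} [CommRing k] [CommRing B]
    [Algebra k B] {φ : B →ₐ[k] B} {p : B} (hp : φ p = p) (u : B)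
    (f : Polynomial (Algebra.adjoin k {p})) :
    φ (Polynomial.aeval u f) = Polynomial.aeval (φ u) f := by
  have hfix : ∀ a : Algebra.adjoin k {p}, φ a = a := fun a =>
    AlgHom.adjoin_le_equalizer φ (AlgHom.id k B) (s := {p}) (by simpa using hp) a.2
  rw [Polynomial.aeval_def, ← RingHom.coe_coe φ, Polynomial.hom_eval₂, Polynomial.aeval_def]
  congr 1
  ext a
  exact hfix a

lemma eq_zero_of_isAlgebraic_of_map_eq_zero {k B : Type*} [CommRing k] [CommRing B] [IsDomain B]
    [Algebra k B] {φ : B →ₐ[k] B} {p : B} (hp : φ p = p) {u : B}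
    (hu : IsAlgebraic (Algebra.adjoin k {p}) u) (h0 : φ u = 0) : u = 0 := by
  by_contra hu0
  obtain ⟨f, hf, hfu⟩ := hu.exists_nonzero_coeff_and_aeval_eq_zero
      (mem_nonZeroDivisors_of_ne_zero hu0)
  have h1 := map_aeval_adjoin_singleton hp u f
  rw [hfu, h0, map_zero, ← Polynomial.coeff_zero_eq_aeval_zero'] at h1
  exact hf (Subtype.val_injective h1.symm)

namespace MvPolynomial

lemma totalDegree_pderiv_lt {σ R : Type*} [CommSemiring R] {f : MvPolynomial σ R} {i : σ}
    (h : pderiv i f ≠ 0) : (pderiv i f).totalDegree < f.totalDegree := by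
  classical
  have key : ∀ m ∈ (pderiv i f).support, (m.sum fun _ e => e) < f.totalDegree := fun m hm => by
    rw [mem_support_iff, coeff_pderiv] at hm
    have h1 := le_totalDegree (mem_support_iff.2 (left_ne_zero_of_mul hm))
    rw [Finsupp.sum_add_index' (by simp) (by simp), Finsupp.sum_single_index rfl] at h1
    exact h1
  obtain ⟨m, hm⟩ := support_nonempty.2 h
  exact (Finset.sup_lt_iff (bot_le.trans_lt (key m hm))).2 key

/-- `p` is fixed by a nontrivial idempotent endomorphism whose image is not the constants. -/
def IsRetractive (p : P) : Prop :=
  ∃ π : P →ₐ[ℂ] P, π.comp π = π ∧ π.range ≠ ⊥ ∧ π.range ≠ ⊤ ∧ π p = p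

lemma isRetractive_of_idempotent {p : P} (hp : poisson p ≠ 0) {π : P →ₐ[ℂ] P} (hπ : π.comp π = π)
    (hid : π ≠ AlgHom.id ℂ P) (hπp : π p = p) : IsRetractive p := by
  refine ⟨π, hπ, fun h => ?_, fun h => hid (AlgHom.eq_id_of_comp_self_of_range_eq_top hπ h), hπp⟩
  have : p ∈ π.range := ⟨p, hπp⟩
  rw [h, Algebra.mem_bot] at this
  obtain ⟨c, rfl⟩ := this
  exact hp (by ext1 g; simp [poisson_apply, MvPolynomial.algebraMap_eq])

lemma isRetractive_C (c : ℂ) : IsRetractive (C c) := by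
  refine ⟨aeval ![X 0, 0], algHom_ext fun i => ?_, fun h => ?_, fun h => ?_, by
    simp [← MvPolynomial.algebraMap_eq]⟩
  · fin_cases i <;> simp
  · have : (X 0 : P) ∈ (aeval ![X 0, 0] : P →ₐ[ℂ] P).range := ⟨X 0, by simp⟩
    rw [h, Algebra.mem_bot] at this
    obtain ⟨c, hc⟩ := this
    have := congrArg totalDegree hc
    rw [MvPolynomial.algebraMap_eq, totalDegree_C, totalDegree_X] at this
    omega
  · have h1 := AlgHom.eq_id_of_comp_self_of_range_eq_top (π := (aeval ![X 0, 0] : P →ₐ[ℂ] P))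
      (algHom_ext fun i => by fin_cases i <;> simp) h
    have := DFunLike.congr_fun h1 (X 1)
    simp only [aeval_X, AlgHom.id_apply, Matrix.cons_val_one, Matrix.cons_val_fin_one] at this
    exact X_ne_zero 1 this.symm

lemma transcendental_of_poisson_ne_zero {p : P} (hp : poisson p ≠ 0) : Transcendental ℂ p := by
  intro h
  obtain ⟨c, rfl⟩ := exists_algebraMap_eq_of_isAlgebraic h
  exact hp (by ext1 g; simp [poisson_apply, MvPolynomial.algebraMap_eq])

/-- A polynomial fixed by a non-injective endomorphism lies in a proper retract. -/
lemma isRetractive_of_not_injective {p : P} (hp : poisson p ≠ 0) {φ : P →ₐ[ℂ] P} (hφp : φ p = p)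
    (hφ : ¬ Function.Injective φ) : IsRetractive p := by
  have halg : ∀ t, IsAlgebraic (Algebra.adjoin ℂ {p}) (φ t) := fun t => by
    have := isAlgebraic_adjoin_of_not_injective φ hφ (s := p)
      (by rw [hφp]; exact transcendental_of_poisson_ne_zero hp) t
    rwa [hφp] at this
  have hpow : ∀ k, (φ ^ k) p = p := fun k => by
    induction k with
    | zero => simp
    | succ k ih => rw [pow_succ', AlgHom.mul_apply, ih, hφp]
  have hper : ∀ t, ∃ k, 0 < k ∧ (φ ^ k) (φ t) = φ t := fun t => by
    obtain ⟨f, hf0, hf⟩ := halg t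
    have hroot : ∀ n, Polynomial.aeval ((φ ^ n) (φ t)) f = 0 := fun n => by
      rw [← map_aeval_adjoin_singleton (hpow n), hf, map_zero]
    obtain ⟨i, j, hij, he⟩ : ∃ i j : ℕ, i < j ∧ (φ ^ i) (φ t) = (φ ^ j) (φ t) := by
      obtain ⟨i, j, hij, he⟩ := Finite.exists_ne_map_eq_of_infinite
        fun n : ℕ => (⟨(φ ^ n) (φ t), Polynomial.mem_rootSet.2 ⟨hf0, hroot n⟩⟩ : f.rootSet P)
      have he' : (φ ^ i) (φ t) = (φ ^ j) (φ t) := congrArg Subtype.val he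
      rcases lt_or_gt_of_ne hij with h | h
      · exact ⟨i, j, h, he'⟩
      · exact ⟨j, i, h, he'.symm⟩
    refine ⟨j - i, by omega, ?_⟩
    rw [← sub_eq_zero]
    refine eq_zero_of_isAlgebraic_of_map_eq_zero (hpow i) ?_ ?_
    · rw [← AlgHom.mul_apply, ← pow_succ, show j - i + 1 = 1 + (j - i) by omega, pow_add, pow_one,
        AlgHom.mul_apply]
      exact (halg _).sub (halg _)
    · rw [map_sub, ← AlgHom.mul_apply, ← pow_add, he, sub_eq_zero]
      congr 2; omega
  obtain ⟨k, hk, hkx⟩ := hper (X 0)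
  obtain ⟨l, hl, hly⟩ := hper (X 1)
  have hfix : φ ^ (k * l) * φ = φ := algHom_ext fun i => by
    have hmul : ∀ (t : P) (a b : ℕ), (φ ^ a) t = t → (φ ^ (a * b)) t = t := fun t a b h => by
      induction b with
      | zero => simp
      | succ b ih => rw [Nat.mul_succ, pow_add, AlgHom.mul_apply, h, ih]
    rw [AlgHom.mul_apply]
    fin_cases i
    · exact hmul _ _ _ hkx
    · rw [mul_comm]; exact hmul _ _ _ hly
  obtain ⟨m, hm⟩ : ∃ m, k * l = m + 1 := ⟨k * l - 1, by
    have := Nat.mul_pos hk hl; omega⟩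
  refine isRetractive_of_idempotent hp (π := φ ^ (k * l)) ?_ (fun h => hφ ?_) (hpow _)
  · change φ ^ (k * l) * φ ^ (k * l) = φ ^ (k * l)
    nth_rw 2 [hm]
    rw [pow_succ', ← mul_assoc, hfix, ← pow_succ', hm]
  · rw [hm, pow_succ] at h
    intro a b hab
    have := DFunLike.congr_fun h
    rw [← AlgHom.id_apply (R := ℂ) a, ← AlgHom.id_apply (R := ℂ) b, ← this, ← this,
      AlgHom.mul_apply, AlgHom.mul_apply, hab]

end MvPolynomial

namespace MvPolynomial

lemma poisson_C (c : ℂ) : poisson (C c) = 0 := by ext1 g; simp [poisson_apply]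

lemma poisson_apply_C (f : P) (c : ℂ) : poisson f (C c) = 0 := by simp

lemma poisson_eq_zero_of_poisson_eq_zero {p u r : P} (hp : poisson p ≠ 0) (hu : poisson p u = 0)
    (hr : poisson p r = 0) : poisson u r = 0 := by
  rw [poisson_apply] at *
  have h0 : pderiv 0 p * (pderiv 0 u * pderiv 1 r - pderiv 1 u * pderiv 0 r) = 0 := by
    linear_combination pderiv 0 u * hr - pderiv 0 r * hu
  have h1 : pderiv 1 p * (pderiv 0 u * pderiv 1 r - pderiv 1 u * pderiv 0 r) = 0 := by
    linear_combination pderiv 1 u * hr - pderiv 1 r * hu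
  rcases mul_eq_zero.1 h0 with h0 | h0
  · rcases mul_eq_zero.1 h1 with h1 | h1
    · exact absurd (by ext1 g; simp [poisson_apply, h0, h1]) hp
    · exact h1
  · exact h0

/-- The bracket with a nonconstant polynomial is not divisible by a polynomial of at least the same
degree. -/
lemma exists_not_dvd_poisson {u w : P} (hu : poisson u ≠ 0) (hw : u.totalDegree ≤ w.totalDegree) :
    ∃ g, ¬ w ∣ poisson u g := by
  have key : ∀ i, pderiv i u ≠ 0 → ¬ w ∣ pderiv i u := fun i hi hdvd => by
    have := totalDegree_le_of_dvd_of_isDomain hdvd hi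
    have := totalDegree_pderiv_lt hi
    omega
  by_cases h0 : pderiv 0 u = 0
  · by_cases h1 : pderiv 1 u = 0
    · exact absurd (by ext1 g; simp [poisson_apply, h0, h1]) hu
    · exact ⟨X 0, by simpa [poisson_apply, pderiv_X] using key 1 h1⟩
  · exact ⟨X 1, by simpa [poisson_apply, pderiv_X] using key 0 h0⟩

/-- The kernel of the bracket with `p` is factorially closed. -/
def FactoriallyClosed (p : P) : Prop :=
  ∀ a b, a * b ≠ 0 → poisson p (a * b) = 0 → poisson p a = 0

lemma FactoriallyClosed.of_dvd {p a r : P} (h : FactoriallyClosed p) (hr0 : r ≠ 0)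
    (hr : poisson p r = 0) (har : a ∣ r) : poisson p a = 0 := by
  obtain ⟨b, rfl⟩ := har
  exact h a b hr0 hr

lemma totalDegree_sub_C (u : P) (c : ℂ) : (u - C c).totalDegree = u.totalDegree := by
  by_cases hu : u.totalDegree = 0
  · rw [totalDegree_eq_zero_iff_eq_C] at hu
    rw [hu, ← C_sub, totalDegree_C, totalDegree_C]
  · rw [sub_eq_add_neg, ← C_neg, totalDegree_add_eq_left_of_totalDegree_lt]
    rw [totalDegree_C]; omega

/-- A factorially closed kernel is a polynomial ring in one variable. -/
lemma FactoriallyClosed.exists_generator {p : P} (hp : poisson p ≠ 0) (h : FactoriallyClosed p) :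
    ∃ u : P, poisson u ≠ 0 ∧ poisson p u = 0 ∧ (∀ c, Prime (u - C c)) ∧
      ∀ r, poisson p r = 0 → ∃ f : Polynomial ℂ, Polynomial.aeval u f = r := by
  classical
  have hex : ∃ n : ℕ, ∃ u : P, poisson u ≠ 0 ∧ poisson p u = 0 ∧ u.totalDegree = n :=
    ⟨_, p, hp, poisson_self p, rfl⟩
  obtain ⟨u, hu, hpu, hun⟩ := Nat.find_spec hex
  have hmin : ∀ r, poisson p r = 0 → r.totalDegree < u.totalDegree → ∃ c, r = C c :=
    fun r hr hlt => exists_eq_C_of_poisson_eq_zero <| by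
      by_contra hr0
      exact Nat.find_min hex (hun ▸ hlt) ⟨r, hr0, hr, rfl⟩
  have hupos : u.totalDegree ≠ 0 := fun h0 => by
    rw [totalDegree_eq_zero_iff_eq_C] at h0
    exact hu (h0 ▸ poisson_C _)
  have hsub : ∀ c, u - C c ≠ 0 := fun c h0 => hupos
      (by rw [← totalDegree_sub_C u c, h0, totalDegree_zero])
  have hprime : ∀ c, Prime (u - C c) := fun c => by
    rw [← irreducible_iff_prime]
    refine ⟨fun hunit => ?_, fun a b hab => ?_⟩
    · exact hupos (by rw [← totalDegree_sub_C u c]; exact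
          (MvPolynomial.isUnit_iff_totalDegree_of_isReduced.1 hunit).2)
    · have hk : poisson p (u - C c) = 0 := by rw [map_sub, hpu, poisson_apply_C, sub_zero]
      have ha0 : a ≠ 0 := fun h0 => hsub c (by rw [hab, h0, zero_mul])
      have hb0 : b ≠ 0 := fun h0 => hsub c (by rw [hab, h0, mul_zero])
      have ha := h.of_dvd (hsub c) hk ⟨b, hab⟩
      have hb := h.of_dvd (hsub c) hk ⟨a, by rw [hab, mul_comm]⟩
      have hdeg := congrArg totalDegree hab
      rw [totalDegree_sub_C, totalDegree_mul_of_isDomain ha0 hb0] at hdeg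
      have hunit : ∀ w : P, w ≠ 0 → (∃ e, w = C e) → IsUnit w := by
        rintro _ hw ⟨e, rfl⟩
        exact (isUnit_iff_ne_zero.2 fun h0 => hw (by rw [h0, C_0])).map C
      by_cases had : a.totalDegree < u.totalDegree
      · exact Or.inl (hunit a ha0 (hmin a ha had))
      · exact Or.inr (hunit b hb0 (hmin b hb (by omega)))
  refine ⟨u, hu, hpu, hprime, fun r hr => ?_⟩
  induction hn : r.totalDegree using Nat.strong_induction_on generalizing r with
  | _ n ih =>
  obtain ⟨g, hg⟩ := exists_not_dvd_poisson hu le_rfl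
  obtain ⟨c, w, hw⟩ := exists_dvd_sub_C (ϖ := u) (by simpa using hprime 0) (poisson u)
    (by simp) hg (s := r) (by rw [poisson_eq_zero_of_poisson_eq_zero hp hpu hr]; exact dvd_zero _)
  by_cases hr0 : r - C c = 0
  · exact ⟨Polynomial.C c, by rw [Polynomial.aeval_C, MvPolynomial.algebraMap_eq,
      sub_eq_zero.1 hr0]⟩
  have hw0 : w ≠ 0 := fun h0 => hr0 (by rw [hw, h0, mul_zero])
  have hu0 : u ≠ 0 := fun h0 => hr0 (by rw [hw, h0, zero_mul])
  have hpw : poisson p w = 0 := h.of_dvd hr0 (by rw [map_sub, hr, poisson_apply_C, sub_zero])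
    ⟨u, by rw [hw, mul_comm]⟩
  obtain ⟨f, hf⟩ := ih w.totalDegree (by
    rw [← hn, ← totalDegree_sub_C r c, hw, totalDegree_mul_of_isDomain hu0 hw0]; omega) w hpw rfl
  refine ⟨Polynomial.X * f + Polynomial.C c, ?_⟩
  rw [map_add, map_mul, Polynomial.aeval_X, hf, ← hw, Polynomial.aeval_C,
    MvPolynomial.algebraMap_eq, sub_add_cancel]

end MvPolynomial

/-- Iterates of a locally nilpotent derivation on a product. -/
lemma Derivation.exists_iterate_mul_eq {k B : Type*} [CommRing k] [CommRing B] [Algebra k B]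
    (d : Derivation k B B) (N : ℕ) : ∀ (m n : ℕ) (a b : B), m + n = N → d^[m + 1] a = 0 →
      d^[n + 1] b = 0 → ∃ l : ℕ, 0 < l ∧ d^[N] (a * b) = l * (d^[m] a * d^[n] b) := by
  induction N with
  | zero =>
    intro m n a b hmn _ _
    obtain ⟨rfl, rfl⟩ : m = 0 ∧ n = 0 := by omega
    exact ⟨1, one_pos, by simp⟩
  | succ N ih =>
    intro m n a b hmn ha hb
    have hsplit : d^[N + 1] (a * b) = d^[N] (a * d b) + d^[N] (d a * b) := by
      rw [Function.iterate_succ_apply, Derivation.leibniz, iterate_map_add, smul_eq_mul,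
        smul_eq_mul, mul_comm b]
    rw [hsplit]
    rcases m with _ | m
    · obtain ⟨n, rfl⟩ : ∃ n', n = n' + 1 := ⟨N, by omega⟩
      obtain ⟨l, hl, h⟩ := ih 0 n a (d b) (by omega) ha (by rwa [Function.iterate_succ_apply] at hb)
      refine ⟨l, hl, ?_⟩
      have ha' : d a = 0 := ha
      rw [h, ha', zero_mul, iterate_map_zero, add_zero]
      rfl
    · have ha' : d^[m + 1] (d a) = 0 := by rwa [Function.iterate_succ_apply] at ha
      obtain ⟨l, hl, h⟩ := ih m n (d a) b (by omega) ha' hb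
      rcases n with _ | n
      · have hb' : d b = 0 := hb
        refine ⟨l, hl, ?_⟩
        rw [h, hb', mul_zero, iterate_map_zero, zero_add]
        rfl
      · obtain ⟨l', hl', h'⟩ := ih (m + 1) n a (d b) (by omega) ha
          (by rwa [Function.iterate_succ_apply] at hb)
        refine ⟨l' + l, by omega, ?_⟩
        rw [h, h', Function.iterate_succ_apply (n := m), Function.iterate_succ_apply (n := n)]
        push_cast
        ring

lemma Derivation.exists_iterate_ne_zero {k B : Type*} [CommRing k] [CommRing B] [Algebra k B]
    {d : Derivation k B B} {a : B} (ha : a ≠ 0) (hd : ∃ m, d^[m] a = 0) :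
    ∃ m, d^[m] a ≠ 0 ∧ d^[m + 1] a = 0 := by
  classical
  have h0 : Nat.find hd ≠ 0 := fun h => ha (by simpa [h] using Nat.find_spec hd)
  refine ⟨Nat.find hd - 1, Nat.find_min hd (by omega), ?_⟩
  rw [Nat.sub_add_cancel (by omega)]
  exact Nat.find_spec hd

/-- The kernel of a locally nilpotent derivation is factorially closed. -/
lemma Derivation.eq_zero_of_mul_of_locally_nilpotent {k B : Type*} [CommRing k] [CommRing B]
    [IsDomain B] [CharZero B] [Algebra k B] (d : Derivation k B B) (hd : ∀ h, ∃ m, d^[m] h = 0)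
    {a b : B} (hab0 : a * b ≠ 0) (hab : d (a * b) = 0) : d a = 0 := by
  obtain ⟨m, hm0, hm⟩ := exists_iterate_ne_zero (left_ne_zero_of_mul hab0) (hd a)
  obtain ⟨n, hn0, hn⟩ := exists_iterate_ne_zero (right_ne_zero_of_mul hab0) (hd b)
  rcases m with _ | m
  · exact hm
  obtain ⟨l, hl, h⟩ := d.exists_iterate_mul_eq (m + 1 + n) (m + 1) n a b rfl hm hn
  rw [show m + 1 + n = m + n + 1 by omega, Function.iterate_succ_apply, hab,
    iterate_map_zero] at h
  exact absurd h.symm (mul_ne_zero (by exact_mod_cast hl.ne') (mul_ne_zero hm0 hn0))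

namespace MvPolynomial

lemma exists_pderiv_eq (F : P) : ∃ G : P, pderiv 1 G = F := by
  induction F using MvPolynomial.induction_on' with
  | monomial m c =>
    refine ⟨monomial (m + Finsupp.single 1 1) (c / (m 1 + 1)), ?_⟩
    rw [pderiv_monomial, add_tsub_cancel_right]
    congr 1
    simp only [Finsupp.add_apply, Finsupp.single_eq_same]
    push_cast
    exact div_mul_cancel₀ _ (Nat.cast_add_one_ne_zero _)
  | add F G hF hG =>
    obtain ⟨F', rfl⟩ := hF
    obtain ⟨G', rfl⟩ := hG
    exact ⟨F' + G', map_add _ _ _⟩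

lemma injective_of_surjective {ψ : P →ₐ[ℂ] P} (h : Function.Surjective ψ) :
    Function.Injective ψ := by
  by_contra hψ
  have := trdeg_le_one_of_not_injective ψ h hψ
  rw [MvPolynomial.trdeg_of_isDomain] at this
  norm_num at this

/-- If the bracket with `p` is locally nilpotent then `p` lies in a proper retract. -/
lemma isRetractive_of_locally_nilpotent {p : P} (hp : poisson p ≠ 0)
    (hnil : ∀ h, ∃ m, (poisson p)^[m] h = 0) : IsRetractive p := by
  classical
  have hfc : FactoriallyClosed p := fun a b h0 h =>
    (poisson p).eq_zero_of_mul_of_locally_nilpotent hnil h0 h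
  obtain ⟨u, hu, hpu, hprime, hgen⟩ := hfc.exists_generator hp
  obtain ⟨f, hf⟩ := hgen p (poisson_self p)
  set δ := poisson u with hδ
  set w := Polynomial.aeval u (Polynomial.derivative f) with hw
  have hpδ : ∀ h, poisson p h = w * δ h := fun h => by
    rw [poisson_swap, ← hf, Derivation.map_aeval, poisson_swap h u, smul_eq_mul]
    ring
  have hw0 : w ≠ 0 := fun h0 => hp (by ext1 h; rw [hpδ, h0, zero_mul]; rfl)
  have hδu : ∀ g : Polynomial ℂ, δ (Polynomial.aeval u g) = 0 := fun g => by
    rw [Derivation.map_aeval, hδ, poisson_self, smul_zero]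
  have hδnil : ∀ h, ∃ m, δ^[m] h = 0 := fun h => by
    obtain ⟨m, hm⟩ := hnil h
    have : ∀ m, (poisson p)^[m] h = w ^ m * δ^[m] h := fun m => by
      induction m with
      | zero => simp
      | succ m ih =>
        rw [Function.iterate_succ_apply', ih, hpδ, Derivation.leibniz, Derivation.leibniz_pow, hw,
          hδu, Function.iterate_succ_apply' (f := δ)]
        simp only [smul_eq_mul]
        ring
    rw [this] at hm
    exact ⟨m, (mul_eq_zero.1 hm).resolve_left (pow_ne_zero _ hw0)⟩
  have hker : ∀ r, δ r = 0 → ∃ g : Polynomial ℂ, Polynomial.aeval u g = r := fun r hr =>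
    hgen r (by rw [hpδ, hr, mul_zero])
  have hex : ∃ n : ℕ, ∃ (s : P) (g : Polynomial ℂ), g ≠ 0 ∧ δ s = Polynomial.aeval u g ∧
      g.natDegree = n := by
    obtain ⟨h, hh⟩ : ∃ h, δ h ≠ 0 := by
      by_contra! hcon
      exact hu (Derivation.ext hcon)
    obtain ⟨m, hm0, hm⟩ := Derivation.exists_iterate_ne_zero hh (hδnil (δ h))
    rw [Function.iterate_succ_apply'] at hm
    obtain ⟨g, hg⟩ := hker _ hm
    refine ⟨_, δ^[m] h, g, ?_, ?_, rfl⟩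
    · rintro rfl
      exact hm0 (by rw [← hg, map_zero])
    · rw [hg, ← Function.iterate_succ_apply' (f := δ), Function.iterate_succ_apply]
  obtain ⟨s, g, hg0, hsg, hgn⟩ := Nat.find_spec hex
  have hdeg : g.natDegree = 0 := by
    by_contra hne
    obtain ⟨c, hc⟩ := Complex.exists_root (f := g) (by
      rw [Polynomial.degree_eq_natDegree hg0]; exact_mod_cast Nat.pos_of_ne_zero hne)
    obtain ⟨g₁, hg₁⟩ := Polynomial.dvd_iff_isRoot.2 hc
    obtain ⟨t, ht⟩ := exists_not_dvd_poisson hu (w := u - C c) (by rw [totalDegree_sub_C])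
    have hϖ : Polynomial.aeval u (Polynomial.X - Polynomial.C c) = u - C c := by simp
    have hδϖ : δ (u - C c) = 0 := by rw [← hϖ, hδu]
    obtain ⟨c', s₁, hs₁⟩ := exists_dvd_sub_C (hprime c) δ (hδϖ ▸ dvd_zero _) ht (s := s) (by
      rw [hsg, hg₁, map_mul, hϖ]; exact dvd_mul_right _ _)
    have hδs : δ s = (u - C c) * δ s₁ := by
      rw [← sub_add_cancel s (C c'), map_add, hs₁, Derivation.leibniz, hδϖ, smul_zero, add_zero,
        smul_eq_mul, hδ, poisson_apply_C, add_zero]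
    rw [hsg, hg₁, map_mul, hϖ] at hδs
    have hg₁0 : g₁ ≠ 0 := by rintro rfl; exact hg0 (by rw [hg₁, mul_zero])
    refine Nat.find_min hex (m := g₁.natDegree) ?_
      ⟨s₁, g₁, hg₁0, (mul_left_cancel₀ (hprime c).ne_zero hδs).symm, rfl⟩
    rw [← hgn, hg₁, Polynomial.natDegree_mul (Polynomial.X_sub_C_ne_zero c) hg₁0,
      Polynomial.natDegree_X_sub_C]
    omega
  obtain ⟨e, rfl⟩ := Polynomial.natDegree_eq_zero.1 hdeg
  have he : e ≠ 0 := by rintro rfl; simp at hg0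
  set t := C e⁻¹ * s with ht
  have hδt : δ t = 1 := by
    rw [ht, Derivation.leibniz, hsg, hδ, poisson_apply_C, smul_zero, add_zero, Polynomial.aeval_C,
      MvPolynomial.algebraMap_eq, smul_eq_mul, ← C_mul, inv_mul_cancel₀ he, C_1]
  let ψ : P →ₐ[ℂ] P := aeval ![u, t]
  have hψ0 : ψ (X 0) = u := by simp [ψ]
  have hψ1 : ψ (X 1) = t := by simp [ψ]
  have hψu : ∀ g : Polynomial ℂ, Polynomial.aeval u g ∈ ψ.range := fun g =>
    ⟨Polynomial.aeval (X 0) g, by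
      rw [← hψ0]; exact (Polynomial.aeval_algHom_apply ψ (X 0) g).symm⟩
  have hsurj : Function.Surjective ψ := by
    have : ∀ m h, δ^[m] h = 0 → h ∈ ψ.range := fun m => by
      induction m with
      | zero => rintro h rfl; exact zero_mem _
      | succ m ih =>
        intro h hh
        obtain ⟨F, hF⟩ := ih (δ h) (by rwa [← Function.iterate_succ_apply])
        obtain ⟨G, rfl⟩ := exists_pderiv_eq F
        have h1 : δ (h - ψ G) = 0 := by
          rw [map_sub, derivation_apply_algHom, hψ0, hψ1, hδt, hδ, poisson_self, mul_zero, zero_add,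
            mul_one, ← hδ, ← hF]
          exact sub_self _
        obtain ⟨g, hg⟩ := hker _ h1
        rw [← sub_add_cancel h (ψ G), ← hg]
        exact add_mem (hψu g) ⟨G, rfl⟩
    intro h
    obtain ⟨m, hm⟩ := hδnil h
    exact this m h hm
  let Ψ : P ≃ₐ[ℂ] P := AlgEquiv.ofBijective ψ ⟨injective_of_surjective hsurj, hsurj⟩
  let ρ : P →ₐ[ℂ] P := aeval ![X 0, 0]
  have hρ : ρ.comp ρ = ρ := algHom_ext fun i => by fin_cases i <;> simp [ρ]
  let π : P →ₐ[ℂ] P := (Ψ : P →ₐ[ℂ] P).comp (ρ.comp (Ψ.symm : P →ₐ[ℂ] P))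
  have hπ : ∀ x, π (ψ x) = ψ (ρ x) := fun x => by
    change Ψ (ρ (Ψ.symm (Ψ x))) = Ψ (ρ x)
    rw [AlgEquiv.symm_apply_apply]
  refine isRetractive_of_idempotent hp (π := π) ?_ (fun h => ?_) ?_
  · ext1 i
    obtain ⟨y, hy⟩ := hsurj (X i)
    rw [AlgHom.comp_apply, ← hy, hπ, hπ, ← AlgHom.comp_apply ρ ρ, hρ]
  · have h1 := hπ (X 1)
    rw [h, AlgHom.id_apply, hψ1] at h1
    have h2 : ρ (X 1) = 0 := by simp [ρ]
    rw [h2, map_zero] at h1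
    rw [h1, map_zero] at hδt
    exact zero_ne_one hδt
  · have h1 : π u = u := by
      rw [← hψ0, hπ]
      simp [ρ]
    rw [← hf, ← Polynomial.aeval_algHom_apply, h1]

end MvPolynomial

/-- A derivation of a domain extends to its field of fractions. -/
lemma Derivation.exists_extend {R A L : Type*} [CommRing R] [CommRing A] [Algebra R A] [Field L]
    [Algebra A L] [Algebra R L] [IsScalarTower R A L] [IsFractionRing A L]
    (d : Derivation R A A) :
    ∃ D : Derivation R L L, ∀ a, D (algebraMap A L a) = algebraMap A L (d a) := by
  have : Algebra.FormallyEtale A L := Algebra.FormallyEtale.of_isLocalization (nonZeroDivisors A)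
  have hb := KaehlerDifferential.isBaseChange_of_formallyEtale R A L
  let e : Derivation R A L := (Algebra.linearMap A L).compDer d
  refine ⟨(hb.lift e.liftKaehlerDifferential).compDer (KaehlerDifferential.D R L), fun a => ?_⟩
  rw [show ∀ x, ((hb.lift e.liftKaehlerDifferential).compDer (KaehlerDifferential.D R L)) x =
      hb.lift e.liftKaehlerDifferential (KaehlerDifferential.D R L x) from fun _ => rfl,
      ← KaehlerDifferential.map_D R R A L, hb.lift_eq,
    Derivation.liftKaehlerDifferential_comp_D]
  rfl

/-- A derivation killing an element `t` is linear over the field generated by `t`. -/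
lemma Derivation.exists_extendScalars {F L : Type*} [Field F] [Field L] [Algebra F L]
    (d : Derivation F L L) {t : L} (ht : d t = 0) :
    ∃ D : Derivation (IntermediateField.adjoin F {t}) L L, ∀ h, D h = d h := by
  have hK : ∀ x ∈ IntermediateField.adjoin F {t}, d x = 0 := fun x hx => by
    induction hx using IntermediateField.adjoin_induction with
    | mem x hx => rw [Set.mem_singleton_iff.1 hx, ht]
    | algebraMap x => exact d.map_algebraMap x
    | add x y _ _ hx hy => rw [_root_.map_add, hx, hy, add_zero]
    | inv x _ hx => rw [d.leibniz_inv, hx, smul_zero]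
    | mul x y _ _ hx hy => rw [d.leibniz, hx, hy, smul_zero, smul_zero, add_zero]
  refine ⟨Derivation.mk'
    { toFun := d, map_add' := d.map_add, map_smul' := fun c x => ?_ } d.leibniz, fun h => rfl⟩
  simp [Algebra.smul_def, d.leibniz, hK c.1 c.2]

lemma AlgHom.exists_extendScalars {F L : Type*} [Field F] [Field L] [Algebra F L]
    (φ : L →ₐ[F] L) {t : L} (ht : φ t = t) :
    ∃ Φ : L →ₐ[IntermediateField.adjoin F {t}] L, ∀ h, Φ h = φ h := by
  have hK : ∀ x ∈ IntermediateField.adjoin F {t}, φ x = x := fun x hx => by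
    induction hx using IntermediateField.adjoin_induction with
    | mem x hx => rw [Set.mem_singleton_iff.1 hx, ht]
    | algebraMap x => exact φ.commutes x
    | add x y _ _ hx hy => rw [map_add, hx, hy]
    | inv x _ hx => rw [map_inv₀, hx]
    | mul x y _ _ hx hy => rw [map_mul, hx, hy]
  exact ⟨{ φ with commutes' := fun x => hK x x.2 }, fun h => rfl⟩

namespace MvPolynomial

lemma natDegree_linear_le {S : Type*} [CommRing S] (a s c : S) (i j : ℕ) :
    (Polynomial.C a * (Polynomial.X ^ i * (Polynomial.C s + Polynomial.C c * Polynomial.X) ^ j)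
      : Polynomial S).natDegree ≤ i + j := by
  have h1 : (Polynomial.C s + Polynomial.C c * Polynomial.X : Polynomial S).natDegree ≤ 1 := by
    compute_degree
  refine (Polynomial.natDegree_C_mul_le _ _).trans (Polynomial.natDegree_mul_le_of_le
    (Polynomial.natDegree_X_pow_le i) ?_)
  exact (Polynomial.natDegree_pow_le_of_le j h1).trans (by simp)

lemma coeff_linear {S : Type*} [CommRing S] (a s c : S) (i j : ℕ) :
    (Polynomial.C a * (Polynomial.X ^ i * (Polynomial.C s + Polynomial.C c * Polynomial.X) ^ j)
      : Polynomial S).coeff (i + j) = a * c ^ j := by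
  have h1 : (Polynomial.C s + Polynomial.C c * Polynomial.X : Polynomial S).natDegree ≤ 1 := by
    compute_degree
  have h2 := Polynomial.coeff_pow_of_natDegree_le (m := j) h1
  rw [mul_one] at h2
  rw [Polynomial.coeff_C_mul, add_comm i j, Polynomial.coeff_X_pow_mul, h2]
  simp

/-- Linear Noether normalisation, as a monic relation for `x` over polynomials in
`z = y - c x`. -/
lemma exists_monic_relation {p : P} (hp : 0 < p.totalDegree) : ∃ c : ℂ, ∀ (S : Type) [CommRing S]
    [Nontrivial S] [Algebra ℂ S] (s t : S), ∃ Q : Polynomial S, Q.Monic ∧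
      ∀ (L : Type) [CommRing L] [Algebra ℂ L] [Algebra S L] [IsScalarTower ℂ S L] (x : L),
        Q.eval₂ (algebraMap S L) x = 0 ↔
          aeval ![x, algebraMap S L s + algebraMap ℂ L c * x] p = algebraMap S L t := by
  set d := p.totalDegree with hd
  let e : Polynomial ℂ := ∑ m ∈ p.support with m 0 + m 1 = d,
    Polynomial.monomial (m 1) (coeff m p)
  have hle : ∀ m ∈ p.support, m 0 + m 1 ≤ d := fun m hm => by
    simpa [Finsupp.sum_fintype] using le_totalDegree hm
  have he : e ≠ 0 := by
    have hp0 : p.support.Nonempty := by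
      rw [support_nonempty]
      rintro rfl
      simp [hd] at hp
    obtain ⟨m, hm, hmd⟩ := Finset.exists_mem_eq_sup p.support hp0 fun s => s.sum fun _ e => e
    replace hmd : m 0 + m 1 = d := by
      rw [hd, totalDegree, hmd, Finsupp.sum_fintype _ _ fun _ => rfl, Fin.sum_univ_two]
    intro h0
    have h1 : e.coeff (m 1) = coeff m p := by
      rw [Polynomial.finsetSum_coeff, Finset.sum_eq_single m]
      · simp
      · intro m' hm' hne
        rw [Finset.mem_filter] at hm'
        rw [Polynomial.coeff_monomial, if_neg]
        intro h
        refine hne (Finsupp.ext fun i => ?_)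
        fin_cases i
        · change m' 0 = m 0
          omega
        · exact h
      · intro h
        exact absurd (Finset.mem_filter.2 ⟨hm, hmd⟩) h
    rw [h0, Polynomial.coeff_zero] at h1
    exact mem_support_iff.1 hm h1.symm
  obtain ⟨c, hc⟩ : ∃ c, e.eval c ≠ 0 := by
    by_contra! h
    exact he (Polynomial.funext (by simpa using h))
  refine ⟨c, fun S _ _ _ s t => ?_⟩
  let w : Polynomial S := Polynomial.C s + Polynomial.C (algebraMap ℂ S c) * Polynomial.X
  let q : Polynomial S := aeval ![Polynomial.X, w] p
  have hq : q = ∑ m ∈ p.support, Polynomial.C (algebraMap ℂ S (coeff m p)) *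
      (Polynomial.X ^ m 0 * w ^ m 1) := by
    simp only [q]
    rw [aeval_def, eval₂_eq']
    simp [Fin.prod_univ_two, Polynomial.C_eq_algebraMap]
  have hq1 : q.natDegree ≤ d := by
    rw [hq]
    exact Polynomial.natDegree_sum_le_of_forall_le _ _ fun m hm =>
      (natDegree_linear_le _ _ _ _ _).trans (hle m hm)
  have hq2 : q.coeff d = algebraMap ℂ S (e.eval c) := by
    rw [hq, Polynomial.finsetSum_coeff, Polynomial.eval_finsetSum, map_sum, Finset.sum_filter]
    refine Finset.sum_congr rfl fun m hm => ?_
    split_ifs with h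
    · rw [← h, coeff_linear]
      simp
    · exact Polynomial.coeff_eq_zero_of_natDegree_lt
        ((natDegree_linear_le _ _ _ _ _).trans_lt (lt_of_le_of_ne (hle m hm) h))
  refine ⟨Polynomial.C (algebraMap ℂ S (e.eval c)⁻¹) * (q - Polynomial.C t), ?_, ?_⟩
  · refine Polynomial.monic_of_natDegree_le_of_coeff_eq_one d ?_ ?_
    · refine (Polynomial.natDegree_C_mul_le _ _).trans ((Polynomial.natDegree_sub_le _ _).trans ?_)
      simp [hq1]
    · rw [Polynomial.coeff_C_mul, Polynomial.coeff_sub, hq2, Polynomial.coeff_C_of_ne_zero hp.ne',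
        sub_zero,
        ← map_mul, inv_mul_cancel₀ hc, map_one]
  · intro L _ _ _ _ x
    have h1 : q.eval₂ (algebraMap S L) x =
        aeval ![x, algebraMap S L s + algebraMap ℂ L c * x] p := by
      rw [hq, Polynomial.eval₂_finsetSum, aeval_def, eval₂_eq']
      refine Finset.sum_congr rfl fun m _ => ?_
      simp [w, Polynomial.eval₂_mul, Polynomial.eval₂_pow, Fin.prod_univ_two,
        ← IsScalarTower.algebraMap_apply]
    rw [Polynomial.eval₂_mul, Polynomial.eval₂_sub, h1, Polynomial.eval₂_C, Polynomial.eval₂_C,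
      IsUnit.mul_right_eq_zero, sub_eq_zero]
    exact ((IsUnit.mk0 _ (inv_ne_zero hc)).map _).map _

end MvPolynomial

namespace MvPolynomial

lemma derivation_eq_zero {d : Derivation ℂ P P} (h0 : d (X 0) = 0) (h1 : d (X 1) = 0) : d = 0 :=
  derivation_ext fun i => by fin_cases i <;> simpa

lemma totalDegree_pos_of_poisson_ne_zero {p : P} (hp : poisson p ≠ 0) : 0 < p.totalDegree := by
  rw [Nat.pos_iff_ne_zero]
  intro h
  rw [totalDegree_eq_zero_iff_eq_C] at h
  exact hp (by rw [h, poisson_C])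

section

variable {L : Type} [Field L] [Algebra P L] [IsFractionRing P L] [Algebra ℂ L]
  [IsScalarTower ℂ P L]

lemma exists_poisson_extend (p : P) :
    ∃ D : Derivation (IntermediateField.adjoin ℂ {algebraMap P L p}) L L,
      ∀ a, D (algebraMap P L a) = algebraMap P L (poisson p a) := by
  obtain ⟨d, hd⟩ := (poisson p).exists_extend (L := L)
  obtain ⟨D, hD⟩ := d.exists_extendScalars (t := algebraMap P L p)
      (by rw [hd, poisson_self, map_zero])
  exact ⟨D, fun a => by rw [hD, hd]⟩

variable (L) in
theorem exists_placeSystem {p : P} (hp : poisson p ≠ 0) :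
    ∃ (z : P) (_ : Algebra (Polynomial (IntermediateField.adjoin ℂ {algebraMap P L p})) L)
      (_ : IsScalarTower (IntermediateField.adjoin ℂ {algebraMap P L p})
        (Polynomial (IntermediateField.adjoin ℂ {algebraMap P L p})) L),
      algebraMap (Polynomial (IntermediateField.adjoin ℂ {algebraMap P L p})) L Polynomial.X =
        algebraMap P L z ∧
      (∀ h : P, IsIntegral (Polynomial (IntermediateField.adjoin ℂ {algebraMap P L p}))
        (algebraMap P L h)) ∧
      Algebra.trdeg (IntermediateField.adjoin ℂ {algebraMap P L p}) L ≤ 1 ∧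
      ∃ (ι : Type) (_ : Fintype ι) (v : ι → Valuation L ℝ≥0),
        IsPlaceSystem (IntermediateField.adjoin ℂ {algebraMap P L p}) v := by
  obtain ⟨c, hc⟩ := exists_monic_relation (totalDegree_pos_of_poisson_ne_zero hp)
  have hD := exists_poisson_extend (L := L) p
  have : CharZero L := charZero_of_injective_algebraMap (algebraMap ℂ L).injective
  have hpK := IntermediateField.mem_adjoin_simple_self ℂ (algebraMap P L p)
  set K := IntermediateField.adjoin ℂ {algebraMap P L p} with hK
  obtain ⟨D, hD⟩ := hD
  let z : P := X 1 - C c * X 0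
  let alg : Algebra (Polynomial K) L :=
    (Polynomial.aeval (R := K) (algebraMap P L z)).toRingHom.toAlgebra
  have halg : ∀ f, algebraMap (Polynomial K) L f = Polynomial.aeval (algebraMap P L z) f :=
    fun f => rfl
  have tow : IsScalarTower K (Polynomial K) L := IsScalarTower.of_algebraMap_eq fun k => by
    rw [halg, Polynomial.algebraMap_eq, Polynomial.aeval_C]
  have tow2 : IsScalarTower ℂ (Polynomial K) L := IsScalarTower.of_algebraMap_eq fun k => by
    rw [IsScalarTower.algebraMap_apply ℂ K (Polynomial K), ← IsScalarTower.algebraMap_apply,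
      ← IsScalarTower.algebraMap_apply]
  have hX : algebraMap (Polynomial K) L Polynomial.X = algebraMap P L z := by
    rw [halg, Polynomial.aeval_X]
  have haev : ∀ (x : Fin 2 → P) (f : P), aeval (fun i => algebraMap P L (x i)) f =
      algebraMap P L (aeval x f) := fun x f => by
    exact (comp_aeval_apply (f := x) (IsScalarTower.toAlgHom ℂ P L) f).symm
  have h0 : IsIntegral (Polynomial K) (algebraMap P L (X 0)) := by
    obtain ⟨Q, hQ, hQ2⟩ := hc (Polynomial K) Polynomial.X (Polynomial.C ⟨_, hpK⟩)
    refine ⟨Q, hQ, (hQ2 L _).2 ?_⟩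
    have h1 : algebraMap (Polynomial K) L (Polynomial.C ⟨_, hpK⟩) = algebraMap P L p := by
      rw [halg, Polynomial.aeval_C]
      rfl
    have h2 : algebraMap (Polynomial K) L Polynomial.X +
        algebraMap ℂ L c * algebraMap P L (X 0) = algebraMap P L (X 1) := by
      rw [hX, IsScalarTower.algebraMap_apply ℂ P L, ← map_mul, ← map_add, algebraMap_eq]
      simp [z]
    rw [h1, h2]
    have h3 : (![algebraMap P L (X 0), algebraMap P L (X 1)] : Fin 2 → L) =
        fun i => algebraMap P L (X i) := by
      funext i
      fin_cases i <;> rfl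
    rw [h3, haev, aeval_X_left_apply]
  have hint : ∀ h : P, IsIntegral (Polynomial K) (algebraMap P L h) := fun h => by
    have hC : ∀ a : ℂ, IsIntegral (Polynomial K) (algebraMap P L (C a)) := fun a => by
      rw [← algebraMap_eq, ← IsScalarTower.algebraMap_apply,
        IsScalarTower.algebraMap_apply ℂ (Polynomial K) L]
      exact isIntegral_algebraMap
    induction h using MvPolynomial.induction_on with
    | C a => exact hC a
    | add f g hf hg => rw [map_add]; exact hf.add hg
    | mul_X f i hf =>
      rw [map_mul]
      refine hf.mul ?_
      fin_cases i
      · exact h0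
      · have h1 : (X 1 : P) = z + C c * X 0 := by simp [z]
        change IsIntegral _ (algebraMap P L (X 1))
        rw [h1, map_add, map_mul, ← hX]
        exact isIntegral_algebraMap.add ((hC c).mul h0)
  have hz : D (algebraMap P L z) ≠ 0 := by
    intro hz
    have h3 : ∀ h : P, poisson p h = 0 := fun h => by
      have h4 : IsAlgebraic (Algebra.adjoin K {algebraMap P L z}) (algebraMap P L h) := by
        obtain ⟨Q, hQ, hQ2⟩ := hint h
        let g : Polynomial K →ₐ[K] Algebra.adjoin K {algebraMap P L z} :=
          Polynomial.aeval ⟨algebraMap P L z, Algebra.self_mem_adjoin_singleton K _⟩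
        have hg : (algebraMap (Algebra.adjoin K {algebraMap P L z}) L).comp g.toRingHom =
            algebraMap (Polynomial K) L := by
          refine Polynomial.ringHom_ext' ?_ ?_
          · ext k
            simp [g, halg]
          · simp [g, halg]
        refine IsIntegral.isAlgebraic ⟨Q.map g.toRingHom, hQ.map _, ?_⟩
        rw [Polynomial.eval₂_map, hg, hQ2]
      have := Derivation.eq_zero_of_mem_adjoin_singleton D hz
      have := D.eq_zero_of_isAlgebraic this h4
      rw [hD] at this
      exact (FaithfulSMul.algebraMap_eq_zero_iff P L).1 this
    exact hp (derivation_eq_zero (h3 _) (h3 _))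
  have htr : Transcendental K (algebraMap P L z) := fun h => by
    refine hz (D.eq_zero_of_isAlgebraic (S := ⊥) (fun s hs => ?_)
      (h.extendScalars (algebraMap K (⊥ : Subalgebra K L)).injective))
    obtain ⟨s, rfl⟩ := Algebra.mem_bot.1 hs
    exact D.map_algebraMap s
  have hinj : Function.Injective (algebraMap (Polynomial K) L) :=
    transcendental_iff_injective.1 htr
  let alg2 : Algebra (RatFunc K) L := (IsFractionRing.lift hinj).toAlgebra
  have tow3 : IsScalarTower (Polynomial K) (RatFunc K) L :=
    IsScalarTower.of_algebraMap_eq fun f => (IsFractionRing.lift_algebraMap hinj f).symm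
  have hfin : FiniteDimensional (RatFunc K) L := by
    let S : Set L := {algebraMap P L (X 0), algebraMap P L (X 1)}
    have hS : ∀ x ∈ S, IsIntegral (RatFunc K) x := by
      rintro x (rfl | rfl) <;> exact (hint _).tower_top
    have : Finite S := (Set.toFinite _).to_subtype
    have hfin := IntermediateField.finiteDimensional_adjoin hS
    have hmem : ∀ h : P, algebraMap P L h ∈ IntermediateField.adjoin (RatFunc K) S := fun h => by
      induction h using MvPolynomial.induction_on with
      | C a =>
        rw [← algebraMap_eq, ← IsScalarTower.algebraMap_apply,
          IsScalarTower.algebraMap_apply ℂ (Polynomial K) L,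
          IsScalarTower.algebraMap_apply (Polynomial K) (RatFunc K) L]
        exact (IntermediateField.adjoin (RatFunc K) S).algebraMap_mem _
      | add f g hf hg => rw [map_add]; exact add_mem hf hg
      | mul_X f i hf =>
        rw [map_mul]
        refine mul_mem hf (IntermediateField.subset_adjoin _ _ ?_)
        fin_cases i
        · exact Or.inl rfl
        · exact Or.inr rfl
    have htop : IntermediateField.adjoin (RatFunc K) S = ⊤ := by
      rw [eq_top_iff]
      rintro x -
      obtain ⟨a, b, -, rfl⟩ := IsFractionRing.div_surjective P x
      exact div_mem (hmem a) (hmem b)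
    rw [htop] at hfin
    exact Module.Finite.equiv (IntermediateField.topEquiv (F := RatFunc K) (E := L)).toLinearEquiv
  obtain ⟨v, hv⟩ := Places.exists_isPlaceSystem K L
  exact ⟨z, alg, tow, hX, hint, Places.trdeg_le_one K L, _, Fintype.ofFinite _, v, by convert hv⟩

end

end MvPolynomial

namespace MvPolynomial

section

variable {L : Type} [Field L] [Algebra P L] [IsFractionRing P L] [Algebra ℂ L]
  [IsScalarTower ℂ P L] {p : P}

local notation "K" => IntermediateField.adjoin ℂ {algebraMap P L p}

lemma exists_algHom_extend {φ : P →ₐ[ℂ] P} (hφ : Function.Injective φ) (hp : φ p = p) :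
    ∃ Φ : L →ₐ[K] L, ∀ a, Φ (algebraMap P L a) = algebraMap P L (φ a) := by
  have hinj : Function.Injective ((IsScalarTower.toAlgHom ℂ P L).comp φ) :=
    (FaithfulSMul.algebraMap_injective P L).comp hφ
  let f : L →ₐ[ℂ] L := IsFractionRing.liftAlgHom hinj
  have hf : ∀ a, f (algebraMap P L a) = algebraMap P L (φ a) := fun a =>
    IsFractionRing.lift_algebraMap hinj a
  obtain ⟨Φ, hΦ⟩ := f.exists_extendScalars (t := algebraMap P L p) (by rw [hf, hp])
  exact ⟨Φ, fun a => by rw [hΦ, hf]⟩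

omit [IsScalarTower ℂ P L] in
lemma map_derivation_extend {Φ : L →ₐ[K] L} {D : Derivation K L L} {φ : P →ₐ[ℂ] P} {d : P → P}
    {J : P} (hΦ : ∀ a, Φ (algebraMap P L a) = algebraMap P L (φ a))
    (hD : ∀ a, D (algebraMap P L a) = algebraMap P L (d a))
    (hJ : ∀ a, d (φ a) = J * φ (d a)) (h : L) : D (Φ h) = algebraMap P L J * Φ (D h) := by
  obtain ⟨a, b, -, rfl⟩ := IsFractionRing.div_surjective P h
  simp only [map_div₀, hΦ, Derivation.leibniz_div, hD, hJ, map_mul, smul_eq_mul, map_sub, map_pow,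
    map_inv₀]
  ring

lemma exists_eq_div {k : L} (hk : k ∈ K) : ∃ a ∈ Algebra.adjoin ℂ {p},
    ∃ b ∈ Algebra.adjoin ℂ {p}, b ≠ 0 ∧ k * algebraMap P L b = algebraMap P L a := by
  obtain ⟨r, s, rfl⟩ := IntermediateField.mem_adjoin_simple_iff _ _ |>.1 hk
  rw [Polynomial.aeval_algebraMap_apply, Polynomial.aeval_algebraMap_apply]
  by_cases hs : Polynomial.aeval p s = 0
  · exact ⟨0, zero_mem _, 1, one_mem _, one_ne_zero, by simp [hs]⟩
  · refine ⟨_, Polynomial.aeval_mem_adjoin_singleton _ _ , _,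
      Polynomial.aeval_mem_adjoin_singleton _ _ , hs, div_mul_cancel₀ _ ?_⟩
    rwa [Ne, FaithfulSMul.algebraMap_eq_zero_iff]

lemma exists_common_denominator {ι : Type*} (s : Finset ι) (k : ι → K) :
    ∃ b ∈ Algebra.adjoin ℂ {p}, b ≠ 0 ∧ ∀ i ∈ s, ∃ a ∈ Algebra.adjoin ℂ {p},
      k i * algebraMap P L b = algebraMap P L a := by
  classical
  induction s using Finset.induction_on with
  | empty => exact ⟨1, one_mem _, one_ne_zero, by simp⟩
  | insert j s _ ih =>
    obtain ⟨b, hb, hb0, h⟩ := ih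
    obtain ⟨a', ha', b', hb', hb0', h'⟩ := exists_eq_div (k j).2
    refine ⟨b * b', mul_mem hb hb', mul_ne_zero hb0 hb0', fun i hi => ?_⟩
    rcases Finset.mem_insert.1 hi with rfl | hi
    · exact ⟨a' * b, mul_mem ha' hb, by rw [map_mul, map_mul, ← h']; ring⟩
    · obtain ⟨a, ha, h⟩ := h i hi
      exact ⟨a * b', mul_mem ha hb', by rw [map_mul, map_mul, ← h]; ring⟩

/-- Elements of `L` integral over `ℂ(p)[z]` have a denominator in `ℂ[p]`. -/
lemma exists_mul_eq_algebraMap [Algebra (Polynomial K) L] [IsScalarTower K (Polynomial K) L] {z : P}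
    (hX : algebraMap (Polynomial K) L Polynomial.X = algebraMap P L z) {h : L}
    (hh : IsIntegral (Polynomial K) h) : ∃ r ∈ Algebra.adjoin ℂ {p}, r ≠ 0 ∧
      ∃ a, algebraMap P L r * h = algebraMap P L a := by
  let M : Submonoid P :=
    { carrier := {r | r ∈ Algebra.adjoin ℂ {p} ∧ r ≠ 0}
      one_mem' := ⟨one_mem _, one_ne_zero⟩
      mul_mem' := fun ha hb => ⟨mul_mem ha.1 hb.1, mul_ne_zero ha.2 hb.2⟩ }
  have hM : M ≤ nonZeroDivisors P := fun r hr => mem_nonZeroDivisors_of_ne_zero hr.2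
  let A : Subalgebra P L := Localization.subalgebra.ofField L M hM
  have hloc : IsLocalization M A := Localization.subalgebra.isLocalization_ofField L M hM
  have hA : IsIntegrallyClosed A := isIntegrallyClosed_of_isLocalization A M hM
  have hfrac : IsFractionRing A L := Localization.subalgebra.isFractionRing_ofField L M hM
  have hmem : ∀ x : L, x ∈ A ↔ ∃ a s : P, ∃ _ : s ∈ M,
    x = algebraMap P L a * (algebraMap P L s)⁻¹ := fun x => Iff.rfl
  have hrange : ∀ f : Polynomial K, algebraMap (Polynomial K) L f ∈ A.toSubring := fun f => by
    induction f using Polynomial.induction_on' with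
    | add f g hf hg => rw [map_add]; exact add_mem hf hg
    | monomial n k =>
      rw [← Polynomial.C_mul_X_pow_eq_monomial, map_mul, map_pow, hX, ← Polynomial.algebraMap_eq,
        ← IsScalarTower.algebraMap_apply]
      refine mul_mem ?_ (pow_mem (A.algebraMap_mem z) n)
      obtain ⟨a, -, b, hb, hb0, h⟩ := exists_eq_div k.2
      refine (hmem _).2 ⟨a, b, ⟨hb, hb0⟩, ?_⟩
      rw [eq_mul_inv_iff_mul_eq₀ (by rwa [Ne, FaithfulSMul.algebraMap_eq_zero_iff])]
      exact h
  have hh2 : IsIntegral A h := by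
    obtain ⟨Q, hQ, hQ2⟩ := hh
    refine ⟨Q.map ((algebraMap (Polynomial K) L).codRestrict A.toSubring hrange), hQ.map _, ?_⟩
    rw [Polynomial.eval₂_map]
    exact hQ2
  obtain ⟨⟨y, hy⟩, rfl⟩ := IsIntegrallyClosed.isIntegral_iff.1 hh2
  obtain ⟨a, s, hs, rfl⟩ := (hmem y).1 hy
  refine ⟨s, hs.1, hs.2, a, ?_⟩
  have : algebraMap P L s ≠ 0 := by rw [Ne, FaithfulSMul.algebraMap_eq_zero_iff]; exact hs.2
  change algebraMap P L s * (algebraMap P L a * (algebraMap P L s)⁻¹) = _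
  field_simp

lemma isAlgebraic_iff_poisson_eq_zero (hp : poisson p ≠ 0) (htr : Algebra.trdeg K L ≤ 1) (r : P) :
    IsAlgebraic K (algebraMap P L r) ↔ poisson p r = 0 := by
  have : CharZero L := charZero_of_injective_algebraMap (algebraMap ℂ L).injective
  obtain ⟨D, hD⟩ := exists_poisson_extend (L := L) p
  constructor
  · intro h
    have h2 := D.eq_zero_of_isAlgebraic (S := ⊥) (fun s hs => by
      obtain ⟨s, rfl⟩ := Algebra.mem_bot.1 hs
      exact D.map_algebraMap s) (h.extendScalars (algebraMap K (⊥ : Subalgebra K L)).injective)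
    rwa [hD, FaithfulSMul.algebraMap_eq_zero_iff] at h2
  · intro hr
    by_contra h
    have halg := isAlgebraic_adjoin_singleton_of_trdeg_le_one htr h
    refine hp (Derivation.ext fun a => ?_)
    have h2 := D.eq_zero_of_isAlgebraic
      (Derivation.eq_zero_of_mem_adjoin_singleton D (by rw [hD, hr, map_zero]))
      (halg.isAlgebraic (algebraMap P L a))
    rwa [hD, FaithfulSMul.algebraMap_eq_zero_iff] at h2

end

end MvPolynomial

namespace MvPolynomial

section

variable {L : Type} [Field L] [Algebra P L] [IsFractionRing P L] [Algebra ℂ L]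
  [IsScalarTower ℂ P L] {p : P}

lemma pow_apply_eq_self {φ : P →ₐ[ℂ] P} (hφ : φ p = p) (n : ℕ) : (φ ^ n) p = p := by
  induction n with
  | zero => simp
  | succ n ih => rw [pow_succ, AlgHom.mul_apply, hφ, ih]

omit [IsFractionRing P L] [IsScalarTower ℂ P L] in
lemma pow_apply_algebraMap {K : IntermediateField ℂ L} {Φ : L →ₐ[K] L} {φ : P →ₐ[ℂ] P}
    (hΦ : ∀ a, Φ (algebraMap P L a) = algebraMap P L (φ a)) (n : ℕ) (a : P) :
    (Φ ^ n) (algebraMap P L a) = algebraMap P L ((φ ^ n) a) := by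
  induction n generalizing a with
  | zero => simp
  | succ n ih => rw [pow_succ, AlgHom.mul_apply, hΦ, ih, pow_succ, AlgHom.mul_apply]

omit [IsFractionRing P L] [IsScalarTower ℂ P L] in
lemma iterate_apply_algebraMap {K : IntermediateField ℂ L} {D : Derivation K L L} {d : P → P}
    (hD : ∀ a, D (algebraMap P L a) = algebraMap P L (d a)) (n : ℕ) (a : P) :
    D^[n] (algebraMap P L a) = algebraMap P L (d^[n] a) := by
  induction n generalizing a with
  | zero => simp
  | succ n ih => rw [Function.iterate_succ_apply, hD, ih, Function.iterate_succ_apply]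

variable (L) in
/-- The dichotomy for an injective endomorphism fixing `p`: up to passing to a power, either it
is of finite order type at infinity, or it is expanding there. -/
theorem exists_growth {φ : P →ₐ[ℂ] P} (hp : poisson p ≠ 0) (hφ : Function.Injective φ)
    (hφp : φ p = p) : ∃ n > 0, ∃ J : P, J ≠ 0 ∧
      (∀ h, poisson p ((φ ^ n) h) = J * (φ ^ n) (poisson p h)) ∧
      J = poisson ((φ ^ n) (X 0)) ((φ ^ n) (X 1)) ∧
      ((poisson p J = 0 ∧ ∀ k h, ∃ (N : ℕ) (r : ℕ → P),
          (∀ i, r i ∈ Algebra.adjoin ℂ {p}) ∧ r 0 ≠ 0 ∧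
          ∑ i ∈ Finset.range (N + 1), r i * (((φ ^ n) ^ k) ^ i) h = 0) ∨
        (∀ h, ∃ m, (poisson p)^[m] h = 0) ∨
        ((∃ r ∈ Algebra.adjoin ℂ {p}, r ≠ 0 ∧ J ∣ r) ∧
          (∀ a (B : ℕ), (∀ N, ∃ m ≥ N, (((φ ^ n) ^ m) a).totalDegree ≤ B) → poisson p a = 0) ∧
          (poisson p J = 0 → ∃ (ι : Type) (_ : Finite ι) (v : ι → Valuation P ℝ≥0),
            (∀ i h, v i (poisson p h) ≤ v i h) ∧
            (∀ i r, poisson p r = 0 → r ≠ 0 → v i r = 1) ∧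
            ∀ (h : ℕ → P), (∃ B, ∀ i m, v i (h m) ≤ B) →
              ¬ LinearIndependent (IntermediateField.adjoin ℂ {algebraMap P L p})
                (fun m => algebraMap P L (h m))))) := by
  obtain ⟨z, _, _, hX, hint, htr, ι, _, v, hv⟩ := exists_placeSystem L hp
  obtain ⟨Φ, hΦ⟩ := exists_algHom_extend (L := L) hφ hφp
  obtain ⟨D, hD⟩ := exists_poisson_extend (L := L) p
  have halg := isAlgebraic_iff_poisson_eq_zero (L := L) hp htr
  have hinj : Function.Injective (algebraMap P L) := FaithfulSMul.algebraMap_injective P L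
  obtain ⟨n, hn, hc⟩ := hv.exists_pow_pullback Φ (by rw [hX, hΦ]; exact hint _)
  choose c hc0 hc using hc
  have hΨ := pow_apply_algebraMap hΦ n
  have hψp := pow_apply_eq_self hφp n
  generalize Φ ^ n = Ψ at hc hΨ
  refine ⟨n, hn, poisson ((φ ^ n) (X 0)) ((φ ^ n) (X 1)), ?_⟩
  generalize φ ^ n = ψ at hΨ hψp
  generalize hJdef : poisson (ψ (X 0)) (ψ (X 1)) = J
  have hJψ : ∀ h, poisson p (ψ h) = J * ψ (poisson p h) := fun h => by
    conv_lhs => rw [← hψp]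
    rw [poisson_map, hJdef]
  have hJΨ := map_derivation_extend hΨ hD hJψ
  have hz : IsIntegral (Polynomial (IntermediateField.adjoin ℂ {algebraMap P L p}))
      (Ψ (algebraMap (Polynomial (IntermediateField.adjoin ℂ {algebraMap P L p})) L
        Polynomial.X)) := by rw [hX, hΨ]; exact hint _
  have hJ0 : J ≠ 0 := by
    intro hJ0
    refine hp (Derivation.ext fun a => (halg a).1 ?_)
    rw [← isAlgebraic_algHom_iff Ψ Ψ.injective, hΨ, halg, hJψ, hJ0, zero_mul]
  have hJ0' : algebraMap P L J ≠ 0 := by rwa [Ne, FaithfulSMul.algebraMap_eq_zero_iff]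
  have hD0 : D ≠ 0 := by
    rintro rfl
    refine hp (Derivation.ext fun a => hinj ?_)
    rw [← hD]
    simp
  have hDint : ∀ h, IsIntegral (Polynomial (IntermediateField.adjoin ℂ {algebraMap P L p})) h →
      IsIntegral (Polynomial (IntermediateField.adjoin ℂ {algebraMap P L p})) (D h) := by
    intro h hh
    obtain ⟨r, hr, hr0, a, ha⟩ := exists_mul_eq_algebraMap hX hh
    have hr1 : algebraMap P L r ≠ 0 := by rwa [Ne, FaithfulSMul.algebraMap_eq_zero_iff]
    have hrK : (algebraMap P L r)⁻¹ ∈ IntermediateField.adjoin ℂ {algebraMap P L p} := by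
      refine inv_mem ?_
      obtain ⟨f, rfl⟩ := Algebra.adjoin_mem_exists_aeval ℂ p hr
      rw [← Polynomial.aeval_algebraMap_apply]
      exact IntermediateField.algebra_adjoin_le_adjoin _ _
        (Polynomial.aeval_mem_adjoin_singleton _ _)
    have h1 : D h = (algebraMap P L r)⁻¹ * algebraMap P L (poisson p a) := by
      rw [eq_inv_mul_iff_mul_eq₀ hr1, ← hD, ← ha, D.leibniz, hD,
        Derivation.eq_zero_of_mem_adjoin_singleton _ (poisson_self p) r hr]
      simp
    rw [h1]
    refine IsIntegral.mul ?_ (hint _)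
    have h2 := isIntegral_algebraMap (R := Polynomial (IntermediateField.adjoin ℂ
      {algebraMap P L p})) (A := L) (x := Polynomial.C ⟨_, hrK⟩)
    rwa [← Polynomial.algebraMap_eq, ← IsScalarTower.algebraMap_apply] at h2
  obtain ⟨d, hd1, hcd⟩ := hv.exists_eq_scaling hz hc0 hc
  simp only [hcd] at hc
  refine ⟨hJ0, hJψ, rfl, ?_⟩
  rcases hd1.eq_or_lt with rfl | hd1
  · left
    simp only [NNReal.rpow_one] at hc
    refine ⟨(halg J).1 (hv.isAlgebraic_of_scaling_eq_one hc hJΨ hJ0' (hint _) hD0), fun k h => ?_⟩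
    have hΨk := pow_apply_algebraMap hΨ k
    have hck : ∀ i h, v i ((Ψ ^ k) h) = v i h := fun i h => by
      simpa using IsPlaceSystem.apply_pow (d := fun _ => 1) (by simpa using hc) k i h
    generalize Ψ ^ k = Θ at hΨk hck
    generalize ψ ^ k = θ at hΨk
    obtain ⟨f, hf0, hf⟩ := hv.exists_aeval_eq_zero (by rw [hX, hΨk]; exact hint _) hck (hint h)
    obtain ⟨b, hb, hb0, hab⟩ := exists_common_denominator (Finset.range (f.natDegree + 1)) f.coeff
    choose! r hr hr2 using hab
    have hb0' : algebraMap P L b ≠ 0 := by rwa [Ne, FaithfulSMul.algebraMap_eq_zero_iff]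
    refine ⟨f.natDegree, fun i => if i ∈ Finset.range (f.natDegree + 1) then r i else 0,
      fun i => ?_, ?_, hinj ?_⟩
    · dsimp only
      split_ifs with hi
      · exact hr i hi
      · exact zero_mem _
    · dsimp only
      rw [if_pos (by simp)]
      intro h0
      have := hr2 0 (by simp)
      rw [h0, map_zero, mul_eq_zero, or_iff_left hb0'] at this
      exact hf0 (by exact_mod_cast this)
    · rw [Polynomial.aeval_eq_sum_range, LinearMap.sum_apply] at hf
      rw [map_sum, map_zero, ← mul_zero (algebraMap P L b), ← hf, Finset.mul_sum]
      refine Finset.sum_congr rfl fun i hi => ?_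
      dsimp only
      rw [if_pos hi, map_mul, ← hr2 i hi, ← pow_apply_algebraMap hΨk, LinearMap.smul_apply,
        Algebra.smul_def, ← mul_assoc, mul_comm _ (algebraMap P L b), Module.End.pow_apply,
        AlgHom.coe_pow]
      rfl
  right
  rcases hv.exists_mul_eq_one_or_locally_nilpotent hd1 hc hJΨ hJ0' (hint _) hDint with h | h
  swap
  · left
    intro a
    obtain ⟨m, hm⟩ := h _ (hint a)
    refine ⟨m, hinj ?_⟩
    rw [← iterate_apply_algebraMap hD, hm, map_zero]
  right
  refine ⟨?_, fun a B hB => ?_, fun hJ => ?_⟩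
  · obtain ⟨g, hg, hJg⟩ := h
    obtain ⟨r, hr, hr0, a, ha⟩ := exists_mul_eq_algebraMap hX hg
    refine ⟨r, hr, hr0, a, hinj ?_⟩
    rw [map_mul, ← ha, mul_left_comm, hJg, mul_one]
  · rw [← halg]
    have : Module.Finite ℂ (restrictTotalDegree (Fin 2) ℂ B) := inferInstance
    obtain ⟨S, hS⟩ := (Module.Finite.iff_fg.1 this)
    have hfin : Module.Finite (IntermediateField.adjoin ℂ {algebraMap P L p})
        (Submodule.span (IntermediateField.adjoin ℂ {algebraMap P L p})
          (algebraMap P L '' (S : Set P))) :=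
      FiniteDimensional.span_of_finite _ (S.finite_toSet.image _)
    refine hv.isAlgebraic_of_frequently_mem hd1 hc (hint _)
      (Submodule.span _ (algebraMap P L '' (S : Set P))) fun N => ?_
    obtain ⟨m, hm, hmB⟩ := hB N
    refine ⟨m, hm, ?_⟩
    rw [pow_apply_algebraMap hΨ]
    rw [← mem_restrictTotalDegree, ← hS] at hmB
    generalize (ψ ^ m) a = y at hmB
    induction hmB using Submodule.span_induction with
    | mem x hx => exact Submodule.subset_span ⟨x, hx, rfl⟩
    | zero => rw [map_zero]; exact zero_mem _
    | add x y _ _ hx hy => rw [map_add]; exact add_mem hx hy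
    | smul c x _ hx =>
      have h1 : algebraMap P L (c • x) = c • algebraMap P L x :=
        map_smul (IsScalarTower.toAlgHom ℂ P L) c x
      rw [h1]
      exact Submodule.smul_of_tower_mem _ c hx
  · refine ⟨ι, inferInstance, fun i => (v i).comap (algebraMap P L),
        fun i h => ?_, fun i r hr hr0 => ?_, ?_⟩
    · rw [Valuation.comap_apply, ← hD]
      exact hv.derivation_le_of_isAlgebraic hd1 hc hJΨ hJ0' ((halg J).2 hJ) i _
    · exact hv.eq_one_of_isAlgebraic ((halg r).2 hr)
        (by rwa [Ne, FaithfulSMul.algebraMap_eq_zero_iff]) i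
    · rintro h ⟨B, hB⟩ hli
      have hfin := hv.finite_bounded B
      let h' : ℕ → hv.bounded B := fun m => ⟨algebraMap P L (h m), hint _, fun i => hB i m⟩
      have hli' : LinearIndependent _ h' :=
        LinearIndependent.of_comp (hv.bounded B).subtype hli
      exact Infinite.not_finite (α := ℕ) hli'.finite

end

end MvPolynomial

namespace MvPolynomial

section

variable (L : Type) [Field L] [Algebra P L] [IsFractionRing P L] [Algebra ℂ L]
  [IsScalarTower ℂ P L]

include L in
lemma exists_pow_apply_eq_self_of_fractionRing {φ : P →ₐ[ℂ] P} {p : P} (hp : poisson p ≠ 0)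
    (hφ : Function.Injective φ) (hφp : φ p = p) {r : P} (hr : poisson p r = 0) :
    ∃ m > 0, (φ ^ m) r = r := by
  classical
  obtain ⟨z, _, _, -, -, htr, -⟩ := exists_placeSystem L hp
  obtain ⟨Φ, hΦ⟩ := exists_algHom_extend (L := L) hφ hφp
  obtain ⟨f, hf0, hf⟩ := (isAlgebraic_iff_poisson_eq_zero hp htr r).2 hr
  have hroot : ∀ n : ℕ, algebraMap P L ((φ ^ n) r) ∈
      (f.aroots L).toFinset := fun n => by
    rw [Multiset.mem_toFinset, Polynomial.mem_aroots]
    refine ⟨hf0, ?_⟩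
    rw [← pow_apply_algebraMap hΦ n, Polynomial.aeval_algHom_apply, hf, map_zero]
  obtain ⟨i, -, j, -, hij, h⟩ := Set.infinite_univ.exists_ne_map_eq_of_mapsTo
    (s := (Set.univ : Set ℕ)) (fun n _ => hroot n) (Finset.finite_toSet _)
  replace h := FaithfulSMul.algebraMap_injective P L h
  have key : ∀ i j : ℕ, i < j → (φ ^ i) r = (φ ^ j) r → ∃ m > 0, (φ ^ m) r = r := by
    intro i j hij h
    refine ⟨j - i, by omega, ?_⟩
    have hi : Function.Injective (φ ^ i) := by
      clear h
      induction i with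
      | zero => exact fun a b h => by simpa using h
      | succ n ih => rw [pow_succ]; exact (ih (by omega)).comp hφ
    apply hi
    rw [← AlgHom.mul_apply, ← pow_add, h]
    congr 2; omega
  rcases lt_or_gt_of_ne hij with h' | h'
  · exact key i j h' h
  · exact key j i h' h.symm

end

lemma exists_pow_apply_eq_self {φ : P →ₐ[ℂ] P} {p : P} (hp : poisson p ≠ 0)
    (hφ : Function.Injective φ) (hφp : φ p = p) {r : P} (hr : poisson p r = 0) :
    ∃ m > 0, (φ ^ m) r = r :=
  exists_pow_apply_eq_self_of_fractionRing (FractionRing P) hp hφ hφp hr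

lemma pow_injective {φ : P →ₐ[ℂ] P} (hφ : Function.Injective φ) (n : ℕ) :
    Function.Injective (φ ^ n) := by
  induction n with
  | zero => exact fun a b h => by simpa using h
  | succ n ih => rw [pow_succ]; exact ih.comp hφ

/-- A cocycle `J` becomes invariant after passing to a power. -/
lemma exists_pow_invariant_jacobian {ψ : P →ₐ[ℂ] P} {p J : P} (hp : poisson p ≠ 0)
    (hψ : Function.Injective ψ) (hψp : ψ p = p) (hJ0 : J ≠ 0) (hJ : poisson p J = 0)
    (h : ∀ h, poisson p (ψ h) = J * ψ (poisson p h)) : ∃ m > 0, ∃ J', J ∣ J' ∧ J' ≠ 0 ∧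
      poisson p J' = 0 ∧ (ψ ^ m) J' = J' ∧
      ∀ h, poisson p ((ψ ^ m) h) = J' * (ψ ^ m) (poisson p h) := by
  obtain ⟨m, hm, hmJ⟩ := exists_pow_apply_eq_self hp hψ hψp hJ
  have hD : ∀ k : ℕ, poisson p ((ψ ^ k) J) = 0 := fun k => by
    induction k with
    | zero => simpa using hJ
    | succ k ih => rw [pow_succ', AlgHom.mul_apply, h, ih, map_zero, mul_zero]
  have hmm : ∀ k : ℕ, (ψ ^ m) ((ψ ^ k) J) = (ψ ^ k) J := fun k => by
    rw [← AlgHom.mul_apply, ← pow_add, add_comm, pow_add, AlgHom.mul_apply, hmJ]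
  have hcoc : ∀ k h, poisson p ((ψ ^ k) h) =
      (∏ i ∈ Finset.range k, (ψ ^ i) J) * (ψ ^ k) (poisson p h) := by
    intro k
    induction k with
    | zero => simp
    | succ k ih =>
      intro a
      rw [pow_succ, AlgHom.mul_apply, ih, h, map_mul, Finset.prod_range_succ, AlgHom.mul_apply]
      ring
  refine ⟨m, hm, ∏ i ∈ Finset.range m, (ψ ^ i) J, ?_, ?_, ?_, ?_, hcoc m⟩
  · simpa using Finset.dvd_prod_of_mem (fun i => (ψ ^ i) J) (Finset.mem_range.2 hm)
  · exact Finset.prod_ne_zero_iff.2 fun i _ =>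
      (map_ne_zero_iff _ (pow_injective hψ i)).2 hJ0
  · exact Finset.prod_induction _ (fun a => poisson p a = 0)
      (fun a b ha hb => by rw [Derivation.leibniz, ha, hb]; simp)
      (Derivation.map_one_eq_zero _) fun i _ => hD i
  · rw [map_prod]; exact Finset.prod_congr rfl fun i _ => hmm i

end MvPolynomial

lemma Prime.pow_succ_dvd_of_dvd_mul {A : Type*} [CommRing A] [IsDomain A] {ϖ : A}
    (hϖ : Prime ϖ) {s m : ℕ} {f a : A} (hf : ¬ ϖ ^ m ∣ f) (h : ϖ ^ (m + s) ∣ f * a) :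
    ϖ ^ (s + 1) ∣ a := by
  induction m generalizing f with
  | zero => simp at hf
  | succ m ih =>
    by_cases hd : ϖ ∣ f
    · obtain ⟨f, rfl⟩ := hd
      refine ih (f := f) (fun hm => hf ?_) ?_
      · rw [pow_succ']; exact mul_dvd_mul_left _ hm
      · rwa [add_right_comm, pow_succ', mul_assoc, mul_dvd_mul_iff_left hϖ.ne_zero] at h
    · exact (pow_dvd_pow _ (by omega)).trans (hϖ.pow_dvd_of_dvd_mul_left _ hd h)

namespace MvPolynomial

lemma exists_pow_not_dvd {ϖ f : P} (hϖ : Prime ϖ) (hf : f ≠ 0) : ∃ m : ℕ, ¬ ϖ ^ m ∣ f := by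
  obtain ⟨n, hn⟩ := FiniteMultiplicity.of_prime_left hϖ hf
  exact ⟨n + 1, hn⟩

lemma apply_eq_self_of_mem_adjoin {θ : P →ₐ[ℂ] P} {p r : P} (hθ : θ p = p)
    (hr : r ∈ Algebra.adjoin ℂ {p}) : θ r = r := by
  obtain ⟨f, rfl⟩ := (Algebra.adjoin_singleton_eq_range_aeval ℂ p).le hr
  change θ (Polynomial.aeval p f) = Polynomial.aeval p f
  rw [← Polynomial.aeval_algHom_apply, hθ]

lemma iterate_poisson_mul {p r : P} (hr : poisson p r = 0) (m : ℕ) (h : P) :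
    (poisson p)^[m] (r * h) = r * (poisson p)^[m] h := by
  induction m with
  | zero => rfl
  | succ m ih =>
    rw [Function.iterate_succ_apply', ih, Derivation.leibniz, hr,
      Function.iterate_succ_apply' (f := poisson p)]
    simp

lemma iterate_poisson_pow_apply {p J : P} {θ : P →ₐ[ℂ] P} (hDJ : poisson p J = 0)
    (hθJ : θ J = J) (hcoc : ∀ h, poisson p (θ h) = J * θ (poisson p h)) (m i : ℕ) (h : P) :
    (poisson p)^[m] ((θ ^ i) h) = J ^ (m * i) * (θ ^ i) ((poisson p)^[m] h) := by
  have h1 : ∀ h, poisson p ((θ ^ i) h) = J ^ i * (θ ^ i) (poisson p h) := fun h => by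
    induction i with
    | zero => simp
    | succ i ih =>
      rw [pow_succ', AlgHom.mul_apply, hcoc, ih, map_mul, map_pow, hθJ, AlgHom.mul_apply, pow_succ']
      ring
  have h2 : ∀ n, poisson p (J ^ n) = 0 := fun n => by rw [Derivation.leibniz_pow, hDJ]; simp
  induction m with
  | zero => simp
  | succ m ih =>
    rw [Function.iterate_succ_apply', ih, Derivation.leibniz, h2, h1,
      Function.iterate_succ_apply' (f := poisson p)]
    simp only [smul_eq_mul, mul_zero, add_zero]
    ring

lemma locally_nilpotent_of_not_isUnit {p J : P} {θ : P →ₐ[ℂ] P} (hθp : θ p = p)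
    (hJ0 : J ≠ 0) (hJ : ¬ IsUnit J) (hDJ : poisson p J = 0) (hθJ : θ J = J)
    (hcoc : ∀ h, poisson p (θ h) = J * θ (poisson p h))
    (hrel : ∀ h, ∃ (N : ℕ) (r : ℕ → P), (∀ i, r i ∈ Algebra.adjoin ℂ {p}) ∧ r 0 ≠ 0 ∧
      ∑ i ∈ Finset.range (N + 1), r i * (θ ^ i) h = 0) (h : P) :
    ∃ m, (poisson p)^[m] h = 0 := by
  obtain ⟨ϖ, hirr, hϖJ⟩ := WfDvdMonoid.exists_irreducible_factor hJ hJ0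
  have hϖ := hirr.prime
  obtain ⟨N, r, hr, hr0, hsum⟩ := hrel h
  obtain ⟨m, hm⟩ := exists_pow_not_dvd hϖ hr0
  have hDr : ∀ i, poisson p (r i) = 0 := fun i =>
    (poisson p).eq_zero_of_mem_adjoin_singleton (poisson_self p) _ (hr i)
  have hθr : ∀ j i, (θ ^ j) (r i) = r i := fun j i =>
    apply_eq_self_of_mem_adjoin (pow_apply_eq_self hθp j) (hr i)
  have hθJ' : ∀ j : ℕ, (θ ^ j) J = J := fun j => pow_apply_eq_self hθJ j
  refine ⟨m, ?_⟩
  have key : ∀ j : ℕ, ∑ i ∈ Finset.range (N + 1),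
      r i * (J ^ (m * i) * (θ ^ (i + j)) ((poisson p)^[m] h)) = 0 := by
    intro j
    have h1 : (θ ^ j) ((poisson p)^[m] (∑ i ∈ Finset.range (N + 1), r i * (θ ^ i) h)) = 0 := by
      rw [hsum, iterate_map_zero, map_zero]
    have h2 : ∀ f : ℕ → P, (poisson p)^[m] (∑ i ∈ Finset.range (N + 1), f i) =
        ∑ i ∈ Finset.range (N + 1), (poisson p)^[m] (f i) := fun f => by
      have := map_sum ((poisson p : P →ₗ[ℂ] P) ^ m) f (Finset.range (N + 1))
      simp only [Module.End.pow_apply] at this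
      exact this
    rw [h2, map_sum] at h1
    rw [← h1]
    refine Finset.sum_congr rfl fun i _ => ?_
    rw [iterate_poisson_mul (hDr i), iterate_poisson_pow_apply hDJ hθJ hcoc, map_mul, map_mul, hθr,
      map_pow, hθJ', ← AlgHom.mul_apply, ← pow_add, add_comm i j]
  have hdvd : ∀ s j : ℕ, ϖ ^ s ∣ (θ ^ j) ((poisson p)^[m] h) := by
    intro s
    induction s with
    | zero => simp
    | succ s ih =>
      intro j
      refine hϖ.pow_succ_dvd_of_dvd_mul hm ?_
      have h1 := key j
      rw [Finset.sum_range_succ'] at h1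
      simp only [mul_zero, pow_zero, zero_add, one_mul] at h1
      rw [add_eq_zero_iff_neg_eq] at h1
      rw [← h1, dvd_neg]
      refine Finset.dvd_sum fun i _ => Dvd.dvd.mul_left ?_ _
      rw [pow_add]
      refine mul_dvd_mul ?_ (ih _)
      rw [mul_add, mul_one, pow_add]
      exact (pow_dvd_pow_of_dvd hϖJ m).mul_left _
  by_contra h0
  obtain ⟨n, hn⟩ := exists_pow_not_dvd hϖ h0
  exact hn (by simpa using hdvd n 0)

end MvPolynomial

lemma isAlgebraic_map_of_map_eq_zero {k B B' : Type*} [Field k] [CommRing B] [IsDomain B]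
    [CommRing B'] [Algebra k B] [Algebra k B'] (ρ : B →ₐ[k] B') {b t : B} (hb : b ≠ 0)
    (ht : IsAlgebraic (Algebra.adjoin k {b}) t) (h0 : ρ b = 0) : IsAlgebraic k (ρ t) := by
  obtain ⟨F, hF0, hF⟩ := ht
  let f : Polynomial k →+* Algebra.adjoin k {b} :=
    ((Polynomial.aeval b).codRestrict _ fun g =>
        Polynomial.aeval_mem_adjoin_singleton k b).toRingHom
  have hf : Function.Surjective f := fun ⟨x, hx⟩ => by
    obtain ⟨g, hg⟩ := (Algebra.adjoin_singleton_eq_range_aeval k b).le hx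
    exact ⟨g, Subtype.ext hg⟩
  obtain ⟨G, rfl⟩ := Polynomial.map_surjective f hf F
  have hG0 : G ≠ 0 := fun h => hF0 (by rw [h, Polynomial.map_zero])
  have hX : Prime (Polynomial.C (Polynomial.X : Polynomial k)) :=
    Polynomial.prime_C_iff.2 Polynomial.prime_X
  obtain ⟨G', hG', hdvd⟩ :=
    (FiniteMultiplicity.of_prime_left hX hG0).exists_eq_pow_mul_and_not_dvd
  set n := multiplicity (Polynomial.C (Polynomial.X : Polynomial k)) G
  have hev : ∀ H : Polynomial (Polynomial k), Polynomial.aeval t (H.map f) =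
      H.eval₂ (Polynomial.aeval b : Polynomial k →ₐ[k] B).toRingHom t := fun H => by
    rw [Polynomial.aeval_def, Polynomial.eval₂_map]
    rfl
  rw [hev, hG', Polynomial.eval₂_mul, Polynomial.eval₂_pow, Polynomial.eval₂_C] at hF
  have hF' := (mul_eq_zero.1 hF).resolve_left (pow_ne_zero _ (by simpa using hb))
  refine ⟨G'.map (Polynomial.evalRingHom 0), fun h => hdvd ?_, ?_⟩
  · rw [Polynomial.C_dvd_iff_dvd_coeff]
    intro i
    have := congrArg (Polynomial.coeff · i) h
    simp only [Polynomial.coeff_map, Polynomial.coe_evalRingHom, Polynomial.coeff_zero] at this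
    rw [Polynomial.X_dvd_iff, Polynomial.coeff_zero_eq_eval_zero, this]
  · have h2 := congrArg ρ hF'
    rw [← RingHom.coe_coe ρ, Polynomial.hom_eval₂, map_zero] at h2
    rw [Polynomial.aeval_def, Polynomial.eval₂_map, ← h2]
    congr 1
    ext a
    · simp
    · simp [h0]

namespace MvPolynomial

/-- An endomorphism of unit Jacobian reflects divisibility by primes. -/
lemma dvd_of_prime_dvd_map {φ : P →ₐ[ℂ] P} (hJ : IsUnit (poisson (φ (X 0)) (φ (X 1))))
    {π ϖ b : P} (hπ : Prime π) (hϖ : Prime ϖ) (h1 : ϖ ∣ φ π) (h2 : ϖ ∣ φ b) : π ∣ b := by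
  by_contra hb
  set I := Ideal.span {π} with hI
  set I' := Ideal.span {ϖ} with hI'
  have hprime : I.IsPrime := (Ideal.span_singleton_prime hπ.ne_zero).2 hπ
  have hprime' : I'.IsPrime := (Ideal.span_singleton_prime hϖ.ne_zero).2 hϖ
  let q : P →ₐ[ℂ] P ⧸ I := Ideal.Quotient.mkₐ ℂ I
  let q' : P →ₐ[ℂ] P ⧸ I' := Ideal.Quotient.mkₐ ℂ I'
  have hq0 : ∀ a, q a = 0 ↔ π ∣ a := fun a => by
    rw [← Ideal.mem_span_singleton, ← hI]; exact Ideal.Quotient.eq_zero_iff_mem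
  have hq0' : ∀ a, q' a = 0 ↔ ϖ ∣ a := fun a => by
    rw [← Ideal.mem_span_singleton, ← hI']; exact Ideal.Quotient.eq_zero_iff_mem
  have hinj : ¬ Function.Injective q := fun h => hπ.ne_zero (h (by rw [map_zero, hq0]))
  have hker : ∀ a ∈ I, (q'.comp φ) a = 0 := fun a ha => by
    rw [AlgHom.comp_apply, hq0']
    exact h1.trans (map_dvd φ (Ideal.mem_span_singleton.1 ha))
  let ρ : P ⧸ I →ₐ[ℂ] P ⧸ I' := Ideal.Quotient.liftₐ I (q'.comp φ) hker
  have hρ : ∀ a, ρ (q a) = q' (φ a) := fun a => rfl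
  have htr : Transcendental ℂ (q b) := fun halg => by
    obtain ⟨c, hc⟩ := exists_algebraMap_eq_of_isAlgebraic halg
    have h3 := congrArg ρ hc
    rw [hρ, (hq0' _).2 h2, AlgHom.commutes, map_eq_zero_iff _ (algebraMap ℂ (P ⧸ I')).injective]
        at h3
    rw [h3, map_zero] at hc
    exact hb ((hq0 b).1 hc.symm)
  have hb0 : q b ≠ 0 := fun h => hb ((hq0 b).1 h)
  have hconst : ∀ t, ∃ c, ϖ ∣ φ t - C c := fun t => by
    have h4 := isAlgebraic_map_of_map_eq_zero ρ hb0
      (isAlgebraic_adjoin_of_not_injective q hinj htr t) (by rw [hρ, hq0']; exact h2)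
    obtain ⟨c, hc⟩ := exists_algebraMap_eq_of_isAlgebraic h4
    refine ⟨c, ?_⟩
    rw [← hq0', map_sub, ← hρ, ← hc, ← MvPolynomial.algebraMap_eq, AlgHom.commutes, sub_self]
  obtain ⟨c, u, hu⟩ := hconst (X 0)
  obtain ⟨d, w, hw⟩ := hconst (X 1)
  rw [sub_eq_iff_eq_add] at hu hw
  refine hϖ.not_isUnit (isUnit_of_dvd_unit ?_ hJ)
  have e1 : poisson (φ (X 0)) ϖ = -(ϖ * poisson ϖ u) := by
    rw [poisson_swap, hu, map_add, poisson_apply_C, Derivation.leibniz, poisson_self]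
    simp
  rw [hw, map_add, poisson_apply_C, Derivation.leibniz, e1]
  simp only [smul_eq_mul, add_zero]
  exact dvd_add (dvd_mul_right _ _) ((Dvd.intro _ rfl).neg_right.mul_left _ )

lemma dvd_of_map_dvd_map {φ : P →ₐ[ℂ] P} (hφ : Function.Injective φ)
    (hJ : IsUnit (poisson (φ (X 0)) (φ (X 1)))) {a b : P} (ha : a ≠ 0) (h : φ a ∣ φ b) : a ∣ b := by
  induction a using UniqueFactorizationMonoid.induction_on_prime generalizing b with
  | h₁ => exact absurd rfl ha
  | h₂ x hx => exact hx.dvd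
  | h₃ a π ha0 hπ ih =>
    have hφπ0 : φ π ≠ 0 := (map_ne_zero_iff _ hφ).2 hπ.ne_zero
    have hnu : ¬ IsUnit (φ π) := fun hu => by
      obtain ⟨c, -, hc⟩ := isUnit_iff_eq_C_of_isReduced.1 hu
      have : π = C c := hφ (by rw [hc, ← MvPolynomial.algebraMap_eq, AlgHom.commutes])
      exact hπ.not_isUnit (by rw [this]; rw [hc] at hu; simpa using hu)
    obtain ⟨ϖ, hirr, hd⟩ := WfDvdMonoid.exists_irreducible_factor hnu hφπ0
    obtain ⟨b, rfl⟩ := dvd_of_prime_dvd_map hJ hπ hirr.prime hd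
      (hd.trans ((map_dvd φ (dvd_mul_right π a)).trans h))
    rw [map_mul, map_mul, mul_dvd_mul_iff_left hφπ0] at h
    exact mul_dvd_mul_left _ (ih ha0 h)

/-- An injective endomorphism of unit Jacobian, integral over `ℂ(p)`, is surjective. -/
lemma surjective_of_isUnit {p : P} {θ : P →ₐ[ℂ] P} (hθ : Function.Injective θ)
    (hθp : θ p = p) (hJ : IsUnit (poisson (θ (X 0)) (θ (X 1))))
    (hrel : ∀ h, ∃ (N : ℕ) (r : ℕ → P), (∀ i, r i ∈ Algebra.adjoin ℂ {p}) ∧ r 0 ≠ 0 ∧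
      ∑ i ∈ Finset.range (N + 1), r i * (θ ^ i) h = 0) : Function.Surjective θ := by
  intro h
  obtain ⟨N, r, hr, hr0, hsum⟩ := hrel h
  have hθr := fun i => apply_eq_self_of_mem_adjoin hθp (hr i)
  rw [Finset.sum_range_succ'] at hsum
  simp only [pow_zero, AlgHom.one_apply] at hsum
  rw [add_eq_zero_iff_neg_eq] at hsum
  have h1 : θ (-∑ i ∈ Finset.range N, r (i + 1) * (θ ^ i) h) = r 0 * h := by
    rw [← hsum, map_neg, map_sum]
    congr 1
    refine Finset.sum_congr rfl fun i _ => ?_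
    rw [map_mul, hθr, pow_succ', AlgHom.mul_apply]
  obtain ⟨g, hg⟩ := dvd_of_map_dvd_map hθ hJ hr0 (b := -∑ i ∈ Finset.range N, r (i + 1) * (θ ^ i) h)
    (by rw [h1, hθr]; exact dvd_mul_right _ _)
  refine ⟨g, ?_⟩
  rw [hg, map_mul, hθr] at h1
  exact mul_left_cancel₀ hr0 h1

/-- An injective endomorphism fixing `p` and integral over `ℂ(p)` is surjective, unless the
derivation attached to `p` is locally nilpotent. -/
lemma surjective_or_locally_nilpotent {p J : P} {ψ : P →ₐ[ℂ] P} (hp : poisson p ≠ 0)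
    (hψ : Function.Injective ψ) (hψp : ψ p = p) (hJ0 : J ≠ 0) (hJ : poisson p J = 0)
    (hcoc : ∀ h, poisson p (ψ h) = J * ψ (poisson p h))
    (hrel : ∀ k h, ∃ (N : ℕ) (r : ℕ → P), (∀ i, r i ∈ Algebra.adjoin ℂ {p}) ∧ r 0 ≠ 0 ∧
      ∑ i ∈ Finset.range (N + 1), r i * ((ψ ^ k) ^ i) h = 0) :
    Function.Surjective ψ ∨ ∀ h, ∃ m, (poisson p)^[m] h = 0 := by
  obtain ⟨m, hm, J', -, hJ0', hDJ', hθJ', hcoc'⟩ :=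
    exists_pow_invariant_jacobian hp hψ hψp hJ0 hJ hcoc
  have hθp := pow_apply_eq_self hψp m
  have hθ := pow_injective hψ m
  by_cases hu : IsUnit J'
  · left
    have hjac : poisson ((ψ ^ m) (X 0)) ((ψ ^ m) (X 1)) = J' := by
      obtain ⟨h, hh⟩ : ∃ h, poisson p h ≠ 0 := by
        by_contra! H
        exact hp (Derivation.ext H)
      have h1 := poisson_map (ψ ^ m) p h
      rw [hθp, hcoc'] at h1
      exact (mul_right_cancel₀ ((map_ne_zero_iff _ hθ).2 hh) h1).symm
    intro h
    obtain ⟨g, hg⟩ := surjective_of_isUnit hθ hθp (by rwa [hjac]) (hrel m) h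
    obtain ⟨k, rfl⟩ : ∃ k, m = k + 1 := ⟨m - 1, by omega⟩
    exact ⟨(ψ ^ k) g, by rw [← AlgHom.mul_apply, ← pow_succ', hg]⟩
  · exact .inr (locally_nilpotent_of_not_isUnit hθp hJ0' hu hDJ' hθJ' hcoc' (hrel m))

end MvPolynomial

/-- Eigenvectors for distinct eigenvalues sum to zero only if they vanish. -/
lemma eq_zero_of_forall_sum_pow_mul_eq_zero {ι L : Type*} [Field L] {s : Finset ι} {v y : ι → L}
    (hv : Set.InjOn v s) (h : ∀ k : ℕ, ∑ i ∈ s, v i ^ k * y i = 0) : ∀ i ∈ s, y i = 0 := by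
  classical
  intro i hi
  have hpoly : ∀ f : Polynomial L, ∑ i ∈ s, f.eval (v i) * y i = 0 := fun f => by
    simp_rw [Polynomial.eval_eq_sum_range, Finset.sum_mul]
    rw [Finset.sum_comm]
    refine Finset.sum_eq_zero fun k _ => ?_
    simp_rw [mul_assoc]
    rw [← Finset.mul_sum, h, mul_zero]
  have h1 := hpoly (∏ j ∈ s.erase i, (Polynomial.X - Polynomial.C (v j)))
  simp_rw [Polynomial.eval_prod] at h1
  rw [Finset.sum_eq_single_of_mem i hi fun j hj hji => by
    rw [Finset.prod_eq_zero (Finset.mem_erase.2 ⟨hji, hj⟩) (by simp), zero_mul]] at h1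
  refine (mul_eq_zero.1 h1).resolve_left (Finset.prod_ne_zero_iff.2 fun j hj => ?_)
  rw [Polynomial.eval_sub, Polynomial.eval_X, Polynomial.eval_C, sub_ne_zero]
  exact fun h => (Finset.mem_erase.1 hj).1 (hv (Finset.mem_of_mem_erase hj) hi h.symm)

lemma Derivation.iterate_eigenvector {F L : Type*} [CommRing F] [CommRing L] [Algebra F L]
    {D : Derivation F L L} {g θ : L} (hg : D g = θ * g) (hθ : D θ = 0) (k : ℕ) :
    D^[k] g = θ ^ k * g := by
  induction k with
  | zero => simp
  | succ k ih =>
    rw [Function.iterate_succ_apply', ih, Derivation.leibniz, hg, Derivation.leibniz_pow, hθ]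
    simp only [smul_eq_mul, smul_zero, mul_zero, add_zero]
    ring

/-- In transcendence degree one, nonzero eigenvalues are rationally proportional. -/
lemma Derivation.eigenvalue_eq_rat_mul {F L : Type} [Field F] [Field L] [CharZero L] [Algebra F L]
    {D : Derivation F L L} (htr : Algebra.trdeg F L ≤ 1) {g g' θ θ' : L} (hg0 : g ≠ 0)
    (hg0' : g' ≠ 0) (hg : D g = θ * g) (hg' : D g' = θ' * g') (hθ : D θ = 0) (hθ' : D θ' = 0)
    (h0 : θ ≠ 0) : ∃ q : ℚ, θ' = q * θ := by
  have hdep : ¬ AlgebraicIndependent F ![g, g'] := fun h => by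
    have := h.cardinalMk_le_trdeg.trans htr
    simp at this
  rw [algebraicIndependent_iff] at hdep
  push Not at hdep
  obtain ⟨f, hf, hf0⟩ := hdep
  let v : (Fin 2 →₀ ℕ) → L := fun m => m 0 * θ + m 1 * θ'
  let y : (Fin 2 →₀ ℕ) → L := fun m => algebraMap F L (f.coeff m) * (g ^ m 0 * g' ^ m 1)
  have hsum : ∑ m ∈ f.support, y m = 0 := by
    rw [MvPolynomial.aeval_def, MvPolynomial.eval₂_eq'] at hf
    rw [← hf]
    exact Finset.sum_congr rfl fun m _ => by simp [y]
  have hnat : ∀ n : ℕ, D (n : L) = 0 := fun n => by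
    simp
  have hvD : ∀ m, D (v m) = 0 := fun m => by
    simp [v, hθ, hθ']
  have hpow : ∀ (g θ : L), D g = θ * g → ∀ n : ℕ, D (g ^ n) = n * θ * g ^ n := fun g θ h n => by
    rw [Derivation.leibniz_pow, h]
    cases n with
    | zero => simp
    | succ n => simp [pow_succ]; ring
  have hyD : ∀ m, D (y m) = v m * y m := fun m => by
    simp only [y, v]
    rw [Derivation.leibniz, Derivation.map_algebraMap, Derivation.leibniz, hpow g θ hg,
      hpow g' θ' hg']
    simp only [smul_eq_mul, mul_zero, add_zero]
    ring
  have hk : ∀ k : ℕ, ∑ m ∈ f.support, v m ^ k * y m = 0 := fun k => by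
    have h1 := congrArg (((D : L →ₗ[F] L) ^ k)) hsum
    rw [map_sum, map_zero] at h1
    rw [← h1]
    refine Finset.sum_congr rfl fun m _ => ?_
    rw [Module.End.pow_apply]
    exact (Derivation.iterate_eigenvector (hyD m) (hvD m) k).symm
  have hninj : ¬ Set.InjOn v f.support := fun h => by
    obtain ⟨m, hm⟩ := MvPolynomial.support_nonempty.2 hf0
    have h2 := eq_zero_of_forall_sum_pow_mul_eq_zero h hk m hm
    simp only [y, mul_eq_zero, pow_eq_zero_iff', hg0, hg0', false_and, or_false,
      map_eq_zero] at h2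
    exact (MvPolynomial.mem_support_iff.1 hm) h2
  simp only [Set.InjOn] at hninj
  push Not at hninj
  obtain ⟨m, -, m', -, h1, hne⟩ := hninj
  simp only [v] at h1
  have h2 : m 1 ≠ m' 1 := fun h => by
    rw [h, add_left_inj, mul_left_inj' h0, Nat.cast_inj] at h1
    exact hne (Finsupp.ext fun i => by fin_cases i <;> assumption)
  have h3 : (m 1 : L) - m' 1 ≠ 0 := sub_ne_zero.2 (by exact_mod_cast h2)
  refine ⟨(m' 0 - m 0) / (m 1 - m' 1), ?_⟩
  push_cast
  rw [div_mul_eq_mul_div, eq_div_iff h3]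
  linear_combination h1

/-- A derivation extends to a finite extension in characteristic zero. -/
lemma Derivation.exists_extend_finite {F L L' : Type*} [Field F] [Field L] [Field L'] [CharZero L]
    [Algebra F L] [Algebra L L'] [Algebra F L'] [IsScalarTower F L L'] [FiniteDimensional L L']
    (D : Derivation F L L) :
    ∃ D' : Derivation F L' L', ∀ a, D' (algebraMap L L' a) = algebraMap L L' (D a) := by
  let _ : Differential L := ⟨D.restrictScalars ℤ⟩
  let _ : Differential L' := Differential.differentialFiniteDimensional L L'
  have h : DifferentialAlgebra L L' := Differential.differentialAlgebraFiniteDimensional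
  let d : Derivation ℤ L' L' := Differential.deriv
  have hd : ∀ a, d (algebraMap L L' a) = algebraMap L L' (D a) := h.deriv_algebraMap
  refine ⟨⟨⟨⟨d, d.map_add⟩, fun c x => ?_⟩, d.map_one_eq_zero, d.leibniz⟩, hd⟩
  change d (c • x) = c • d x
  rw [Algebra.smul_def, IsScalarTower.algebraMap_apply F L L', Derivation.leibniz, hd,
    Derivation.map_algebraMap, map_zero, smul_zero, add_zero, smul_eq_mul, Algebra.smul_def,
    IsScalarTower.algebraMap_apply F L L']

/-- A vector annihilated by a split differential operator with constant coefficients yields an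
eigenvector. -/
lemma Derivation.exists_eigenvector {F L : Type*} [Field F] [Field L] [Algebra F L]
    (D : Derivation F L L) (s : Multiset L) (hs : ∀ θ ∈ s, D θ = 0) {x : L} (hx : x ≠ 0)
    (h : ((s.map fun θ => Polynomial.X - Polynomial.C θ).prod.sum fun i c => c * D^[i] x) = 0) :
    ∃ θ ∈ s, ∃ g, g ≠ 0 ∧ D g = θ * g := by
  let act : L → Polynomial L →ₗ[L] L := fun x =>
    Polynomial.lsum fun i => LinearMap.toSpanSingleton L L (D^[i] x)
  have hact : ∀ x f, act x f = f.sum fun i c => c * D^[i] x := fun x f => rfl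
  have hX : ∀ x f, act x (Polynomial.X * f) = act (D x) f := fun x f => by
    induction f using Polynomial.induction_on' with
    | add p q hp hq => rw [mul_add, map_add, map_add, hp, hq]
    | monomial n c =>
      rw [Polynomial.X_mul_monomial, hact, hact, Polynomial.sum_monomial_index _ _ (by simp),
        Polynomial.sum_monomial_index _ _ (by simp), Function.iterate_succ_apply]
  have hC : ∀ θ, D θ = 0 → ∀ x f, act x (Polynomial.C θ * f) = act (θ * x) f := fun θ hθ x f => by
    rw [← Polynomial.smul_eq_C_mul, LinearMap.map_smul]
    have hD : ∀ i : ℕ, D^[i] (θ * x) = θ * D^[i] x := fun i => by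
      induction i with
      | zero => rfl
      | succ i ih =>
        rw [Function.iterate_succ_apply', ih, Derivation.leibniz, hθ,
          Function.iterate_succ_apply' (f := D)]
        simp
    rw [hact, hact, Polynomial.sum_def, Polynomial.sum_def, smul_eq_mul, Finset.mul_sum]
    exact Finset.sum_congr rfl fun i _ => by rw [hD]; ring
  have hsub : ∀ x y f, act (x - y) f = act x f - act y f := fun x y f => by
    rw [hact, hact, hact, Polynomial.sum_def, Polynomial.sum_def, Polynomial.sum_def,
      ← Finset.sum_sub_distrib]
    refine Finset.sum_congr rfl fun i _ => ?_
    rw [iterate_map_sub, mul_sub]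
  rw [← hact] at h
  induction s using Multiset.induction_on generalizing x with
  | empty =>
    rw [Multiset.map_zero, Multiset.prod_zero, hact, ← Polynomial.C_1,
      Polynomial.sum_C_index (by simp)] at h
    simp [hx] at h
  | cons θ s ih =>
    have hθ := hs θ (Multiset.mem_cons_self _ _)
    by_cases h0 : D x - θ * x = 0
    · exact ⟨θ, Multiset.mem_cons_self _ _, x, hx, sub_eq_zero.1 h0⟩
    · rw [Multiset.map_cons, Multiset.prod_cons, sub_mul, map_sub, hX, hC _ hθ, ← hsub] at h
      obtain ⟨θ', h1, h2⟩ := ih (fun θ h => hs θ (Multiset.mem_cons_of_mem h)) h0 h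
      exact ⟨θ', Multiset.mem_cons_of_mem h1, h2⟩

lemma Derivation.aeval_apply_eq_sum {F L : Type*} [CommRing F] [CommRing L] [Algebra F L]
    (D : Derivation F L L) (f : Polynomial F) (a : L) :
    Polynomial.aeval (D : Module.End F L) f a = f.sum fun i c => c • D^[i] a := by
  rw [Polynomial.aeval_eq_sum_range, Polynomial.sum_over_range _ (by simp), LinearMap.sum_apply]
  refine Finset.sum_congr rfl fun i _ => ?_
  rw [LinearMap.smul_apply, Module.End.pow_apply]
  rfl

/-- A derivation commutes with the automorphisms of an algebraic extension. -/
lemma Derivation.map_algEquiv {F L L' : Type*} [Field F] [Field L] [Field L'] [CharZero L']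
    [Algebra F L] [Algebra L L'] [Algebra F L'] [IsScalarTower F L L']
    [Algebra.IsAlgebraic L L'] {D : Derivation F L L} {D' : Derivation F L' L'}
    (h : ∀ a, D' (algebraMap L L' a) = algebraMap L L' (D a)) (γ : L' ≃ₐ[L] L') (x : L') :
    D' (γ x) = γ (D' x) := by
  let d : Derivation F L' L' := D' - ⟨⟨⟨fun x => γ.symm (D' (γ x)), fun x y => by simp⟩,
    fun c x => by
      have : γ (c • x) = c • γ x := by
        rw [Algebra.smul_def, IsScalarTower.algebraMap_apply F L L', _root_.map_mul,
          AlgEquiv.commutes, Algebra.smul_def, IsScalarTower.algebraMap_apply F L L']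
      dsimp only
      rw [this, D'.map_smul, Algebra.smul_def, IsScalarTower.algebraMap_apply F L L',
        _root_.map_mul, AlgEquiv.commutes, RingHom.id_apply, Algebra.smul_def,
        IsScalarTower.algebraMap_apply F L L']⟩, by
      change γ.symm (D' (γ 1)) = 0
      simp, fun x y => by
      change γ.symm (D' (γ (x * y))) = x • γ.symm (D' (γ y)) + y • γ.symm (D' (γ x))
      simp⟩
  have hd : ∀ x, d x = D' x - γ.symm (D' (γ x)) := fun x => rfl
  have h0 : ∀ s ∈ (IsScalarTower.toAlgHom F L L').range, d s = 0 := by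
    rintro _ ⟨s, rfl⟩
    change d (algebraMap L L' s) = 0
    rw [hd, AlgEquiv.commutes, h, AlgEquiv.commutes, sub_self]
  have halg : IsAlgebraic (IsScalarTower.toAlgHom F L L').range x := by
    obtain ⟨f, hf0, hf⟩ := Algebra.IsAlgebraic.isAlgebraic (R := L) x
    refine ⟨f.map (IsScalarTower.toAlgHom F L L').rangeRestrict.toRingHom, ?_, ?_⟩
    · rwa [Ne, Polynomial.map_eq_zero_iff]
      intro a b hab
      exact (algebraMap L L').injective (congrArg Subtype.val hab)
    · rw [Polynomial.aeval_def, Polynomial.eval₂_map]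
      exact hf
  have h1 := d.eq_zero_of_isAlgebraic h0 halg
  rw [hd, sub_eq_zero] at h1
  rw [h1, AlgEquiv.apply_symm_apply]

/-- In transcendence degree one, a derivation which is algebraic but not nilpotent on `a` has an
eigenvector of its square among the combinations of the iterated derivatives of `a`. -/
theorem Derivation.exists_sq_eigenvector {F L : Type} [Field F] [Field L] [CharZero L]
    [Algebra F L] (D : Derivation F L L) (hF : ∀ x, D x = 0 → ∃ c, algebraMap F L c = x)
    (htr : Algebra.trdeg F L ≤ 1) {a : L}
    (hdep : ∃ μ : Polynomial F, μ ≠ 0 ∧ Polynomial.aeval (D : Module.End F L) μ a = 0)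
    (hnil : ∀ m, D^[m] a ≠ 0) : ∃ (ν : Polynomial F) (q : F), q ≠ 0 ∧
      Polynomial.aeval (D : Module.End F L) ν a ≠ 0 ∧
      D (D (Polynomial.aeval (D : Module.End F L) ν a)) =
        algebraMap F L q * Polynomial.aeval (D : Module.End F L) ν a := by
  classical
  set T : Module.End F L := (D : Module.End F L) with hT
  have hTa : ∀ m a, (T ^ m) a = D^[m] a := fun m a => by rw [Module.End.pow_apply]; rfl
  have hmul : ∀ (f g : Polynomial F) x, Polynomial.aeval T (f * g) x =
      Polynomial.aeval T f (Polynomial.aeval T g x) := fun f g x => by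
    rw [_root_.map_mul]; rfl
  have hex : ∃ d : ℕ, ∃ N, ∃ μ : Polynomial F, μ ≠ 0 ∧ μ.natDegree = d ∧
      Polynomial.aeval T μ (D^[N] a) = 0 := by
    obtain ⟨μ, h, h'⟩ := hdep
    exact ⟨_, 0, μ, h, rfl, h'⟩
  obtain ⟨N, μ, hμ0, hμd, hμ⟩ := Nat.find_spec hex
  have hmin : ∀ (M : ℕ) (f : Polynomial F), f ≠ 0 → Polynomial.aeval T f (D^[M] a) = 0 →
      μ.natDegree ≤ f.natDegree := fun M f h h' => by
    rw [hμd]; exact Nat.find_min' hex ⟨M, f, h, rfl, h'⟩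
  set x := D^[N] a with hx
  have hμ00 : μ.coeff 0 ≠ 0 := fun h => by
    obtain ⟨f, rfl⟩ := Polynomial.X_dvd_iff.2 h
    have hf : f ≠ 0 := right_ne_zero_of_mul hμ0
    have := hmin (N + 1) f hf (by
      rw [mul_comm, hmul, Polynomial.aeval_X] at hμ
      rw [Function.iterate_succ_apply']
      exact hμ)
    rw [Polynomial.natDegree_X_mul hf] at this
    omega
  -- pass to the splitting field of `μ`
  let m : Polynomial L := μ.map (algebraMap F L)
  let L' := m.SplittingField
  have : CharZero L' := charZero_of_injective_algebraMap (algebraMap L L').injective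
  have : FiniteDimensional L L' := Polynomial.IsSplittingField.finiteDimensional L' m
  have : IsGalois L L' := {}
  obtain ⟨D', hD'⟩ := D.exists_extend_finite (L' := L')
  let m' : Polynomial L' := μ.map (algebraMap F L')
  have hm' : m' = m.map (algebraMap L L') := by
    rw [Polynomial.map_map, ← IsScalarTower.algebraMap_eq]
  have hm0 : m' ≠ 0 := (Polynomial.map_ne_zero_iff (algebraMap F L').injective).2 hμ0
  have hroot0 : ∀ θ ∈ m'.roots, Polynomial.aeval θ μ = 0 := fun θ hθ => by
    rw [← Polynomial.eval_map_algebraMap]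
    exact (Polynomial.mem_roots hm0).1 hθ
  have hcst : ∀ θ ∈ m'.roots, D' θ = 0 := fun θ hθ => by
    have halg : IsAlgebraic F θ := ⟨μ, hμ0, hroot0 θ hθ⟩
    refine D'.eq_zero_of_isAlgebraic (S := ⊥) (fun s hs => ?_)
      (halg.extendScalars (algebraMap F (⊥ : Subalgebra F L')).injective)
    obtain ⟨s, rfl⟩ := Algebra.mem_bot.1 hs
    exact D'.map_algebraMap s
  have hx0 : algebraMap L L' x ≠ 0 := by simpa [hx] using hnil N
  have hit : ∀ i : ℕ, D'^[i] (algebraMap L L' x) = algebraMap L L' (D^[i] x) := fun i => by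
    induction i with
    | zero => rfl
    | succ i ih => rw [Function.iterate_succ_apply', ih, hD', Function.iterate_succ_apply']
  have hsplit : m'.Splits := by rw [hm']; exact Polynomial.SplittingField.splits m
  obtain ⟨θ, hθ, g, hg0, hg⟩ := D'.exists_eigenvector m'.roots hcst hx0 (by
    have h1 : m' = Polynomial.C m'.leadingCoeff *
      (m'.roots.map fun θ => Polynomial.X - Polynomial.C θ).prod := hsplit.eq_prod_roots
    have h2 : (m'.sum fun i c => c * D'^[i] (algebraMap L L' x)) = 0 := by
      have h3 := congrArg (algebraMap L L') hμ
      rw [D.aeval_apply_eq_sum, Polynomial.sum_def, map_sum, map_zero] at h3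
      rw [Polynomial.sum_def, Polynomial.support_map_of_injective _ (algebraMap F L').injective,
        ← h3]
      refine Finset.sum_congr rfl fun i _ => ?_
      rw [hit, Polynomial.coeff_map, Algebra.smul_def, _root_.map_mul,
        ← IsScalarTower.algebraMap_apply]
    rw [h1, ← Polynomial.smul_eq_C_mul, Polynomial.sum_smul_index _ _ _ (by simp),
      Polynomial.sum_def] at h2
    simp_rw [mul_assoc] at h2
    rw [← Finset.mul_sum] at h2
    exact (mul_eq_zero.1 h2).resolve_left (Polynomial.leadingCoeff_ne_zero.2 hm0))
  have hθ0 : θ ≠ 0 := fun h => by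
    have := hroot0 θ hθ
    rw [h, ← Polynomial.coeff_zero_eq_aeval_zero', map_eq_zero] at this
    exact hμ00 this
  have htr' : Algebra.trdeg F L' ≤ 1 := by
    rw [← trdeg_add_eq F L (A := L'), trdeg_eq_zero (R := L) (A := L'), add_zero]
    exact htr
  -- the conjugates of `θ` are `± θ`
  have hfix : ∀ γ : L' ≃ₐ[L] L', γ (θ ^ 2) = θ ^ 2 := fun γ => by
    have hγ := D.map_algEquiv (D' := D') hD' γ
    obtain ⟨q, hq⟩ := Derivation.eigenvalue_eq_rat_mul (D := D') htr' hg0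
      ((map_ne_zero γ).2 hg0) hg (θ' := γ θ) (by rw [hγ, hg, _root_.map_mul]) (hcst θ hθ)
      (by rw [hγ, hcst θ hθ, map_zero]) hθ0
    have hpow : ∀ k : ℕ, (γ ^ k) θ = (q : L') ^ k * θ := fun k => by
      induction k with
      | zero => simp
      | succ k ih =>
        rw [pow_succ', AlgEquiv.mul_apply, ih, _root_.map_mul, hq, map_pow, map_ratCast]
        ring
    have h1 := hpow (orderOf γ)
    rw [pow_orderOf_eq_one, AlgEquiv.one_apply, eq_comm, mul_eq_right₀ hθ0] at h1
    have h2 : q ^ orderOf γ = 1 := by exact_mod_cast h1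
    have h3 : q ^ 2 = 1 := by
      rcases pow_eq_one_iff_cases.1 h2 with h | h | h
      · exact absurd h (orderOf_pos γ).ne'
      · rw [h, one_pow]
      · rw [h.1]; norm_num
    rw [map_pow, hq, mul_pow, ← Rat.cast_pow, h3, Rat.cast_one, one_mul]
  obtain ⟨q', hq'⟩ := (IsGalois.mem_range_algebraMap_iff_fixed (F := L) (θ ^ 2)).2 hfix
  obtain ⟨q, rfl⟩ := hF q' (by
    apply (algebraMap L L').injective
    rw [← hD', hq', Derivation.leibniz_pow, hcst θ hθ]
    simp)
  rw [← IsScalarTower.algebraMap_apply] at hq'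
  let c : Polynomial F := Polynomial.X ^ 2 - Polynomial.C q
  have hcθ : Polynomial.aeval θ c = 0 := by
    simp [c, hq']
  have hgcd : ¬ IsUnit (EuclideanDomain.gcd c μ) := fun h => by
    obtain ⟨u, w, huw⟩ := EuclideanDomain.gcd_isUnit_iff.1 h
    have := congrArg (Polynomial.aeval θ) huw
    simp [hcθ, hroot0 θ hθ] at this
  obtain ⟨w, hw⟩ := EuclideanDomain.gcd_dvd_left c μ
  obtain ⟨ν, hν⟩ := EuclideanDomain.gcd_dvd_right c μ
  set e := EuclideanDomain.gcd c μ
  have hν0 : ν ≠ 0 := fun h => hμ0 (by rw [hν, h, mul_zero])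
  have he0 : e ≠ 0 := fun h => hμ0 (by rw [hν, h, zero_mul])
  have hb : Polynomial.aeval T (ν * Polynomial.X ^ N) a = Polynomial.aeval T ν x := by
    rw [hmul, map_pow, Polynomial.aeval_X, hTa]
  refine ⟨ν * Polynomial.X ^ N, q, fun h => ?_, fun h => ?_, ?_⟩
  · rw [h, map_zero] at hq'
    exact hθ0 (pow_eq_zero_iff two_ne_zero |>.1 hq'.symm)
  · rw [hb] at h
    have h1 := hmin N ν hν0 h
    rw [hν, Polynomial.natDegree_mul he0 hν0] at h1
    exact hgcd (Polynomial.isUnit_iff_degree_eq_zero.2 (by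
      rw [Polynomial.degree_eq_natDegree he0]; norm_cast; omega))
  · rw [hb]
    have h1 : Polynomial.aeval T c (Polynomial.aeval T ν x) = 0 := by
      rw [← hmul, hw, mul_assoc, mul_comm w, ← mul_assoc, ← hν, mul_comm, hmul, hμ, map_zero]
    simp only [c, map_sub, map_pow, Polynomial.aeval_X, Polynomial.aeval_C, LinearMap.sub_apply,
      Module.algebraMap_end_apply] at h1
    rw [sub_eq_zero, hTa, Algebra.smul_def] at h1
    exact h1

namespace Polynomial

lemma exists_sq_sub_dvd {k : Type*} [Field k] [IsAlgClosed k] [DecidableEq k] {q e : Polynomial k}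
    (hq : Squarefree q) : ∃ a : Polynomial k, a.degree < q.degree ∧ q ∣ a ^ 2 - e := by
  have hq0 : q ≠ 0 := hq.ne_zero
  have hnd : q.roots.Nodup := Polynomial.nodup_roots (PerfectField.separable_iff_squarefree.2 hq)
  have hsq : ∀ x : k, ∃ s, s ^ 2 = e.eval x := fun x => by
    obtain ⟨s, hs⟩ := IsAlgClosed.exists_pow_nat_eq (e.eval x) two_pos
    exact ⟨s, hs⟩
  choose s hs using hsq
  have hcard : q.roots.toFinset.card = q.natDegree := by
    rw [Multiset.toFinset_card_of_nodup hnd, ← (IsAlgClosed.splits q).natDegree_eq_card_roots]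
  have hinj : Set.InjOn (id : k → k) q.roots.toFinset := Function.injective_id.injOn
  refine ⟨Lagrange.interpolate q.roots.toFinset id s, ?_, ?_⟩
  · have := Lagrange.degree_interpolate_lt s hinj
    rwa [hcard, ← Polynomial.degree_eq_natDegree hq0] at this
  · set a := Lagrange.interpolate q.roots.toFinset id s
    by_cases h0 : a ^ 2 - e = 0
    · rw [h0]; exact dvd_zero _
    rw [(IsAlgClosed.splits q).eq_prod_roots,
      (isUnit_C.2 (leadingCoeff_ne_zero.2 hq0).isUnit).mul_left_dvd,
      Multiset.prod_X_sub_C_dvd_iff_le_roots h0, Multiset.le_iff_subset hnd]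
    intro x hx
    rw [mem_roots h0, IsRoot.def, eval_sub, eval_pow]
    have := Lagrange.eval_interpolate_at_node s hinj (Multiset.mem_toFinset.2 hx)
    simp only [id] at this
    rw [this, hs, sub_self]

/-- Ternary quadratic forms over `k(t)`, with `k` algebraically closed, are isotropic. -/
theorem exists_sq_eq_mul_sq_add_mul_sq {k : Type*} [Field k] [IsAlgClosed k] {q e : Polynomial k}
    (hq : q ≠ 0) (he : e ≠ 0) : ∃ a b c : Polynomial k, ¬ (a = 0 ∧ b = 0 ∧ c = 0) ∧
      a ^ 2 = q * b ^ 2 + e * c ^ 2 := by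
  classical
  induction hn : q.natDegree + e.natDegree using Nat.strong_induction_on generalizing q e with
  | _ n ih =>
  wlog hle : e.natDegree ≤ q.natDegree generalizing q e
  · obtain ⟨a, b, c, h0, h⟩ := this he hq (by omega) (by omega)
    exact ⟨a, c, b, fun h' => h0 ⟨h'.1, h'.2.2, h'.2.1⟩, by rw [h]; ring⟩
  by_cases hd : q.natDegree = 0
  · obtain ⟨s, hs⟩ := IsAlgClosed.exists_pow_nat_eq (q.coeff 0) two_pos
    refine ⟨C s, 1, 0, fun h => one_ne_zero h.2.1, ?_⟩
    rw [eq_C_of_natDegree_eq_zero hd, ← C_pow, hs]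
    simp
  by_cases hsf : Squarefree q
  · obtain ⟨a₀, hdeg, q₁, hq₁⟩ := exists_sq_sub_dvd (e := e) hsf
    by_cases h0 : q₁ = 0
    · refine ⟨a₀, 0, 1, fun h => one_ne_zero h.2.2, ?_⟩
      rw [h0, mul_zero, sub_eq_zero] at hq₁
      rw [hq₁]; ring
    have hdeg' : a₀.natDegree < q.natDegree := by
      by_cases ha : a₀ = 0
      · rw [ha, natDegree_zero]; omega
      · exact natDegree_lt_natDegree ha hdeg
    have hlt : q₁.natDegree < q.natDegree := by
      have h1 := natDegree_mul hq h0
      rw [← hq₁] at h1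
      have h2 := natDegree_sub_le (a₀ ^ 2) e
      have h3 : (a₀ ^ 2).natDegree = 2 * a₀.natDegree := natDegree_pow _ _
      rcases le_max_iff.1 h2 with h | h <;> omega
    obtain ⟨a, b, c, hne, h⟩ := ih _ (by omega) h0 he rfl
    refine ⟨a * a₀ + e * c, q₁ * b, a + a₀ * c, fun ⟨h1, h2, h3⟩ => hne ?_, ?_⟩
    · have hb : b = 0 := (mul_eq_zero.1 h2).resolve_left h0
      have ha : a = -(a₀ * c) := eq_neg_of_add_eq_zero_left h3
      have hc : (q * q₁) * c = 0 := by rw [← hq₁]; rw [ha] at h1; linear_combination -h1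
      have hc : c = 0 := (mul_eq_zero.1 hc).resolve_left (mul_ne_zero hq h0)
      exact ⟨by rw [ha, hc, mul_zero, neg_zero], hb, hc⟩
    · linear_combination (a₀ ^ 2 - e) * h + q₁ * b ^ 2 * hq₁
  · rw [Squarefree] at hsf
    push Not at hsf
    obtain ⟨s, ⟨q', rfl⟩, hs⟩ := hsf
    have hs0 : s ≠ 0 := fun h => hq (by simp [h])
    have hq'0 : q' ≠ 0 := right_ne_zero_of_mul hq
    have hsd : 0 < s.natDegree := Nat.pos_of_ne_zero fun h => hs (by
      rw [isUnit_iff_degree_eq_zero, degree_eq_natDegree hs0, h]; rfl)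
    rw [natDegree_mul (mul_ne_zero hs0 hs0) hq'0, natDegree_mul hs0 hs0] at hn
    obtain ⟨a, b, c, hne, h⟩ := ih _ (by omega) hq'0 he rfl
    refine ⟨s * a, b, s * c, fun ⟨h1, h2, h3⟩ => hne ⟨?_, h2, ?_⟩, ?_⟩
    · exact (mul_eq_zero.1 h1).resolve_left hs0
    · exact (mul_eq_zero.1 h3).resolve_left hs0
    · linear_combination s ^ 2 * h

end Polynomial

namespace MvPolynomial

variable {p : P}

lemma poisson_eq_zero_of_isUnit {a : P} (ha : IsUnit a) : poisson p a = 0 := by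
  obtain ⟨c, -, rfl⟩ := (isUnit_iff_eq_C_of_isReduced).1 ha
  exact poisson_apply_C p c

lemma poisson_ne_zero_of_prime {ϖ : P} (hϖ : Prime ϖ) : poisson ϖ ≠ 0 := by
  intro h
  obtain ⟨c, rfl⟩ := exists_eq_C_of_poisson_eq_zero h
  refine hϖ.not_isUnit (isUnit_iff_eq_C_of_isReduced.2 ⟨c, ?_, rfl⟩)
  rw [isUnit_iff_ne_zero]
  rintro rfl
  exact hϖ.ne_zero C_0

lemma poisson_eq_zero_of_forall_prime {a : P} (ha : a ≠ 0)
    (h : ∀ ϖ, Prime ϖ → ϖ ∣ a → poisson p ϖ = 0) : poisson p a = 0 := by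
  induction a using UniqueFactorizationMonoid.induction_on_prime with
  | h₁ => exact absurd rfl ha
  | h₂ x hx => exact poisson_eq_zero_of_isUnit hx
  | h₃ b ϖ hb hϖ ih =>
    rw [Derivation.leibniz, h ϖ hϖ (dvd_mul_right _ _), smul_zero, add_zero,
      ih hb fun τ hτ hd => h τ hτ (hd.mul_left _), smul_zero]

lemma FactoriallyClosed.eq_zero_of_prime_dvd (hp : poisson p ≠ 0) (h : FactoriallyClosed p) {ϖ : P}
    (hϖ : Prime ϖ) (hd : ϖ ∣ poisson p ϖ) : poisson p ϖ = 0 := by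
  obtain ⟨g, hg⟩ := exists_not_dvd_poisson (poisson_ne_zero_of_prime hϖ) le_rfl
  obtain ⟨c, hc⟩ := exists_dvd_sub_C hϖ (poisson ϖ) (by rw [poisson_self]; exact dvd_zero _) hg
    (s := p) (by rw [poisson_swap]; exact hd.neg_right)
  refine h.of_dvd (fun h0 => hp ?_) ?_ hc
  · rw [sub_eq_zero.1 h0, poisson_C]
  · rw [map_sub, poisson_self, poisson_apply_C, sub_zero]

/-- A polynomial that divides its own derivative up to a factor in the kernel is in the kernel. -/
lemma FactoriallyClosed.eq_zero_of_dvd_mul (hp : poisson p ≠ 0) (h : FactoriallyClosed p) {r a : P}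
    (hr : poisson p r = 0) (hr0 : r ≠ 0) (ha : a ≠ 0) (hd : a ∣ r * poisson p a) :
    poisson p a = 0 := by
  refine poisson_eq_zero_of_forall_prime ha fun ϖ hϖ hϖa => ?_
  by_cases hϖr : ϖ ∣ r
  · exact h.of_dvd hr0 hr hϖr
  refine h.eq_zero_of_prime_dvd hp hϖ ?_
  obtain ⟨k, c, hc, rfl⟩ : ∃ k c, ¬ ϖ ∣ c ∧ a = ϖ ^ k * c := by
    obtain ⟨c, h1, h2⟩ := (FiniteMultiplicity.of_prime_left hϖ ha).exists_eq_pow_mul_and_not_dvd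
    exact ⟨_, c, h2, h1⟩
  rcases k with _ | k
  · exact absurd (by simpa using hϖa) hc
  have hk : ¬ ϖ ∣ ((k + 1 : ℕ) : P) := fun hdv => hϖ.not_isUnit <| isUnit_of_dvd_unit hdv <| by
    rw [isUnit_iff_eq_C_of_isReduced]
    exact ⟨(k + 1 : ℕ), isUnit_iff_ne_zero.2 (Nat.cast_ne_zero.2 k.succ_ne_zero), by simp⟩
  have h1 : ϖ ^ k * ϖ ∣ ϖ ^ k * (r * ((k + 1 : ℕ) : P) * c * poisson p ϖ) := by
    have h2 : ϖ ^ (k + 1) ∣ r * poisson p (ϖ ^ (k + 1) * c) := (dvd_mul_right _ _).trans hd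
    rw [Derivation.leibniz, Derivation.leibniz_pow, mul_add] at h2
    have h3 := (dvd_add_right ((dvd_mul_right _ _).mul_left r)).1 h2
    rw [← pow_succ]
    convert h3 using 1
    simp only [smul_eq_mul, nsmul_eq_mul, Nat.add_sub_cancel]
    ring
  rw [mul_dvd_mul_iff_left (pow_ne_zero _ hϖ.ne_zero)] at h1
  rcases hϖ.dvd_or_dvd h1 with h2 | h2
  · rcases hϖ.dvd_or_dvd h2 with h2 | h2
    · rcases hϖ.dvd_or_dvd h2 with h2 | h2
      exacts [absurd h2 hϖr, absurd h2 hk]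
    · exact absurd h2 hc
  · exact h2

/-- Constants of the extension of the bracket to the fraction field are fractions of constants. -/
lemma FactoriallyClosed.exists_mul_eq (hp : poisson p ≠ 0) (h : FactoriallyClosed p)
    {L : Type} [Field L] [Algebra P L] [IsFractionRing P L] {D : L → L}
    (hD : ∀ a, D (algebraMap P L a) = algebraMap P L (poisson p a))
    (hmul : ∀ a b, D (a * b) = a * D b + b * D a) {x : L} (hx : D x = 0) :
    ∃ r s, poisson p r = 0 ∧ poisson p s = 0 ∧ s ≠ 0 ∧
      x * algebraMap P L s = algebraMap P L r := by
  have hinj : Function.Injective (algebraMap P L) := IsFractionRing.injective P L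
  obtain ⟨a, b, hab, rfl⟩ := IsFractionRing.exists_reduced_fraction (A := P) x
  have hb0 : (b : P) ≠ 0 := nonZeroDivisors.ne_zero b.2
  set x := IsLocalization.mk' L a b with hxdef
  have hxb : x * algebraMap P L b = algebraMap P L a := IsLocalization.mk'_spec L a b
  have hda : algebraMap P L (poisson p a) = x * algebraMap P L (poisson p b) := by
    rw [← hD, ← hxb, hmul, hx, hD]; ring
  have hda' : poisson p a * b = a * poisson p b := hinj <| by
    rw [map_mul, map_mul, hda, ← hxb]; ring
  have hdvd : (b : P) ∣ poisson p b := by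
    refine hab.symm.dvd_of_dvd_mul_left ?_
    exact ⟨_, by rw [← hda', mul_comm]⟩
  have hb : poisson p b = 0 := h.eq_zero_of_dvd_mul hp (r := 1)
    (Derivation.map_one_eq_zero _) one_ne_zero hb0 (by rwa [one_mul])
  refine ⟨a, b, ?_, hb, hb0, hxb⟩
  exact hinj (by rw [hda, hb, map_zero, mul_zero])

/-- An eigenvector of the square of a derivation with square eigenvalue is constant. -/
lemma FactoriallyClosed.false_of_sq (hp : poisson p ≠ 0) (h : FactoriallyClosed p) {t q b α β : P}
    (ht : poisson p t = 0) (ht0 : t ≠ 0) (hq : poisson p q = 0) (hq0 : q ≠ 0) (hb : b ≠ 0)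
    (hdd : t * poisson p (t * poisson p b) = q * b) (hβ : β ≠ 0) (hαβ : α ^ 2 = q * β ^ 2) :
    False := by
  obtain ⟨θ, rfl⟩ : β ∣ α := (IsIntegrallyClosed.pow_dvd_pow_iff two_ne_zero).1
      ⟨q, by rw [hαβ, mul_comm]⟩
  obtain rfl : θ ^ 2 = q := mul_left_cancel₀ (pow_ne_zero 2 hβ) (by linear_combination hαβ)
  have hθ0 : θ ≠ 0 := by rintro rfl; simp at hq0
  have hθ : poisson p θ = 0 := h.of_dvd hq0 hq (dvd_pow_self θ two_ne_zero)
  have hmul : ∀ a b, poisson p (a * b) = a * poisson p b + b * poisson p a := fun a b => by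
    rw [Derivation.leibniz]; rfl
  have key : ∀ c η, η ≠ 0 → c ≠ 0 → t * poisson p c = η * c → False := fun c η hη hc he => by
    have h1 := h.eq_zero_of_dvd_mul hp ht ht0 hc ⟨η, by rw [he, mul_comm]⟩
    rw [h1, mul_zero] at he
    exact mul_ne_zero hη hc he.symm
  by_cases hc : t * poisson p b + θ * b = 0
  · exact key b (-θ) (neg_ne_zero.2 hθ0) hb (by linear_combination hc)
  · refine key _ θ hθ0 hc ?_
    rw [map_add, hmul θ, hθ]
    linear_combination hdd

end MvPolynomial

namespace MvPolynomial

variable {p : P}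

lemma FactoriallyClosed.exists_eq_mul_sq (h : FactoriallyClosed p) {q x y z : P}
    (hq : poisson p q = 0) (hx : x ≠ 0) (hy : y ≠ 0) (hxy : x * y = q * z ^ 2)
    (hdvd : ∀ ϖ, Prime ϖ → ϖ ∣ x → ϖ ∣ y → poisson p ϖ = 0) :
    ∃ r c, poisson p r = 0 ∧ x = r * c ^ 2 := by
  induction hn : x.totalDegree using Nat.strong_induction_on generalizing x z with
  | _ n ih =>
    by_cases hDx : poisson p x = 0
    · exact ⟨x, 1, hDx, by ring⟩
    have hqz : q * z ^ 2 ≠ 0 := hxy ▸ mul_ne_zero hx hy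
    have hq0 : q ≠ 0 := left_ne_zero_of_mul hqz
    obtain ⟨ϖ, hϖ, ⟨x₁, rfl⟩, hDϖ⟩ : ∃ ϖ, Prime ϖ ∧ ϖ ∣ x ∧ poisson p ϖ ≠ 0 := by
      by_contra! hcon
      exact hDx (poisson_eq_zero_of_forall_prime hx hcon)
    have hϖq : ¬ ϖ ∣ q := fun hd => hDϖ (h.of_dvd hq0 hq hd)
    have hϖy : ¬ ϖ ∣ y := fun hd => hDϖ (hdvd ϖ hϖ (dvd_mul_right _ _) hd)
    obtain ⟨z, rfl⟩ : ϖ ∣ z := by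
      have h1 : ϖ ∣ q * z ^ 2 := ⟨x₁ * y, by rw [← hxy, mul_assoc]⟩
      exact hϖ.dvd_of_dvd_pow ((hϖ.dvd_or_dvd h1).resolve_left hϖq)
    have h2 : x₁ * y = ϖ * (q * z ^ 2) :=
      mul_left_cancel₀ hϖ.ne_zero (by linear_combination hxy)
    obtain ⟨x, rfl⟩ : ϖ ∣ x₁ := (hϖ.dvd_or_dvd ⟨_, h2⟩).resolve_right hϖy
    have hx0 : x ≠ 0 := right_ne_zero_of_mul (right_ne_zero_of_mul hx)
    have hdeg := totalDegree_pos_of_poisson_ne_zero (poisson_ne_zero_of_prime hϖ)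
    obtain ⟨r, c, hr, rfl⟩ := ih x.totalDegree (by
        rw [← hn, totalDegree_mul_of_isDomain hϖ.ne_zero (mul_ne_zero hϖ.ne_zero hx0),
          totalDegree_mul_of_isDomain hϖ.ne_zero hx0]
        omega) hx0
      (z := z) (mul_left_cancel₀ hϖ.ne_zero (by linear_combination h2))
      (fun τ hτ hτx => hdvd τ hτ ((hτx.mul_left _).mul_left _)) rfl
    exact ⟨r, ϖ * c, hr, by ring⟩

lemma FactoriallyClosed.exists_sq_eq (hp : poisson p ≠ 0) (h : FactoriallyClosed p) {q e : P}
    (hq : poisson p q = 0) (hq0 : q ≠ 0) (he : poisson p e = 0) (he0 : e ≠ 0) :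
    ∃ α β γ, poisson p α = 0 ∧ poisson p β = 0 ∧ poisson p γ = 0 ∧
      ¬ (α = 0 ∧ β = 0 ∧ γ = 0) ∧ α ^ 2 = q * β ^ 2 + e * γ ^ 2 := by
  obtain ⟨u, hu, hpu, -, hgen⟩ := h.exists_generator hp
  obtain ⟨q, rfl⟩ := hgen q hq
  obtain ⟨e, rfl⟩ := hgen e he
  obtain ⟨a, b, c, habc, heq⟩ := Polynomial.exists_sq_eq_mul_sq_add_mul_sq (q := q) (e := e)
    (by rintro rfl; simp at hq0) (by rintro rfl; simp at he0)
  have hker : ∀ f : Polynomial ℂ, poisson p (Polynomial.aeval u f) = 0 := fun f =>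
    Derivation.eq_zero_of_mem_adjoin_singleton _ hpu _ (Polynomial.aeval_mem_adjoin_singleton ℂ u)
  have hinj : ∀ f : Polynomial ℂ, Polynomial.aeval u f = 0 → f = 0 :=
    transcendental_iff.1 (transcendental_of_poisson_ne_zero hu)
  refine ⟨Polynomial.aeval u a, Polynomial.aeval u b, Polynomial.aeval u c, hker a, hker b, hker c,
    fun hz => habc ⟨hinj a hz.1, hinj b hz.2.1, hinj c hz.2.2⟩, ?_⟩
  simpa using congrArg (Polynomial.aeval u) heq

/-- Halving the exponent of an eigenvector of the square of a rescaled bracket. -/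
lemma FactoriallyClosed.exists_halving (hp : poisson p ≠ 0) (h : FactoriallyClosed p) {t q a : P}
    (ht : poisson p t = 0) (ht0 : t ≠ 0) (hq : poisson p q = 0) (hq0 : q ≠ 0) (ha : a ≠ 0)
    (hdd : t * poisson p (t * poisson p a) = q * a) :
    ∃ c, c ≠ 0 ∧ t * poisson p (t * poisson p c) = C (1 / 4) * q * c ∧
      ∀ (v : Valuation P ℝ≥0) (B : ℝ≥0), 1 ≤ B → (∀ h, v (poisson p h) ≤ v h) →
        (∀ r, poisson p r = 0 → r ≠ 0 → v r = 1) → v a ≤ B → v c ≤ B := by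
  have hmul : ∀ a b, poisson p (a * b) = a * poisson p b + b * poisson p a := fun a b => by
    rw [Derivation.leibniz]; rfl
  have hmulR : ∀ {r}, poisson p r = 0 → ∀ a, poisson p (r * a) = r * poisson p a := fun hr a => by
    rw [hmul, hr, mul_zero, add_zero]
  set b := t * poisson p a with hb
  have hsq : ∀ {α β : P}, β ≠ 0 → α ^ 2 = q * β ^ 2 → False := fun hβ hαβ =>
    h.false_of_sq hp ht ht0 hq hq0 ha hdd hβ hαβ
  set e := b ^ 2 - q * a ^ 2 with he
  have he0 : e ≠ 0 := fun h0 => hsq ha (sub_eq_zero.1 h0)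
  have hDe : poisson p e = 0 := by
    refine (mul_eq_zero.1 (?_ : t * poisson p e = 0)).resolve_left ht0
    rw [he, map_sub, hmulR hq, pow_two, pow_two, hmul b b, hmul a a]
    linear_combination 2 * b * hdd - 2 * q * a * hb
  obtain ⟨α, β, γ, hα, hβ, hγ, h0, hαβγ⟩ := h.exists_sq_eq hp hq hq0 hDe he0
  have hγ0 : γ ≠ 0 := by
    rintro rfl
    have h1 : α ^ 2 = q * β ^ 2 := by rw [hαβγ]; ring
    by_cases hβ0 : β = 0
    · subst hβ0
      exact h0 ⟨by simpa using h1, rfl, rfl⟩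
    · exact hsq hβ0 h1
  set g := e * γ with hg
  have hg0 : g ≠ 0 := mul_ne_zero he0 hγ0
  have hDg : poisson p g = 0 := by rw [hg, hmulR hDe, hγ, mul_zero]
  set a' := α * a + β * b with ha'
  set b' := α * b + β * (q * a) with hb'
  have hda' : t * poisson p a' = b' := by
    rw [ha', map_add, hmulR hα, hmulR hβ, hb', ← hdd, hb]; ring
  have hdb' : t * poisson p b' = q * a' := by
    rw [hb', map_add, hmulR hα, hmulR hβ, hmulR hq, ha']
    linear_combination α * hdd - β * q * hb
  have hnorm : (b' + g) * (b' - g) = q * a' ^ 2 := by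
    rw [hb', ha', hg, he]
    linear_combination (b ^ 2 - q * a ^ 2) * hαβγ
  have ha0 : a' ≠ 0 := by
    intro h1
    have h2 : b' = 0 := by rw [← hda', h1, map_zero, mul_zero]
    rw [h1, h2] at hnorm
    exact pow_ne_zero 2 hg0 (by linear_combination -hnorm)
  have hne : (b' + g) * (b' - g) ≠ 0 := hnorm ▸ mul_ne_zero hq0 (pow_ne_zero 2 ha0)
  obtain ⟨r, c, hr, hrc⟩ := h.exists_eq_mul_sq hq (left_ne_zero_of_mul hne)
    (right_ne_zero_of_mul hne) hnorm fun ϖ hϖ h1 h2 => by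
      refine h.of_dvd hg0 hDg ?_
      have h3 : ϖ ∣ C 2 * g := by
        have h4 := dvd_sub h1 h2
        rwa [show b' + g - (b' - g) = C 2 * g by rw [map_ofNat]; ring] at h4
      refine (hϖ.dvd_or_dvd h3).resolve_left fun h4 => hϖ.not_isUnit (isUnit_of_dvd_unit h4 ?_)
      exact isUnit_iff_eq_C_of_isReduced.2 ⟨2, isUnit_iff_ne_zero.2 two_ne_zero, rfl⟩
  have hrc0 : r * c ^ 2 ≠ 0 := hrc ▸ left_ne_zero_of_mul hne
  have hr0 : r ≠ 0 := left_ne_zero_of_mul hrc0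
  have hc0 : c ≠ 0 := by rintro rfl; simp at hrc0
  set d := t * poisson p c with hd
  have h1 : 2 * r * c * d = q * a' := by
    rw [← hdb', ← add_zero (poisson p b'), ← hDg, ← map_add, hrc, hmulR hr, pow_two, hmul, hd]
    ring
  have hd0 : d ≠ 0 := by
    intro h2
    rw [h2, mul_zero] at h1
    exact mul_ne_zero hq0 ha0 h1.symm
  have h2 : 4 * r * d ^ 2 = q * (b' - g) := by
    refine mul_left_cancel₀ hrc0 ?_
    linear_combination (2 * r * c * d + q * a') * h1 - q * hnorm + q * (b' - g) * hrc
  have h3 : 4 * (t * poisson p d) = q * c := by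
    have h4 := congrArg (fun x => t * poisson p x) h2
    simp only [hmulR hq, map_sub, hDg, sub_zero] at h4
    rw [show 4 * r * d ^ 2 = r * (C 4 * d ^ 2) by rw [map_ofNat]; ring, hmulR hr,
      hmulR (poisson_apply_C p 4), pow_two, hmul, map_ofNat] at h4
    have h8 : (2 : P) * r * d ≠ 0 := mul_ne_zero (mul_ne_zero two_ne_zero hr0) hd0
    refine mul_left_cancel₀ h8 ?_
    linear_combination h4 + q * hdb' - q * h1
  refine ⟨c, hc0, ?_, fun v B hB hvD hvR hva => ?_⟩
  · have h4 : (C (1 / 4) : P) * 4 = 1 := by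
      rw [← map_ofNat (C : ℂ →+* P) 4, ← map_mul]; norm_num
    linear_combination C (1 / 4) * h3 - t * poisson p d * h4
  · have hle : ∀ r, poisson p r = 0 → v r ≤ 1 := fun r hr => by
      by_cases hr0 : r = 0
      · simp [hr0]
      · exact (hvR r hr hr0).le
    have hsm : ∀ {r x}, poisson p r = 0 → v x ≤ B → v (r * x) ≤ B := fun {r x} hr hx => by
      rw [map_mul]
      exact (mul_le_mul' (hle r hr) hx).trans (one_mul B).le
    have hvb : v b ≤ B := hsm ht ((hvD a).trans hva)
    have hX : v (b' + g) ≤ B :=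
      v.map_add_le (v.map_add_le (hsm hα hvb) (hsm hβ (hsm hq hva))) ((hle g hDg).trans hB)
    rw [hrc, map_mul, hvR r hr hr0, one_mul, map_pow] at hX
    by_contra! hcB
    have : B * B < v c ^ 2 := by rw [pow_two]; exact mul_lt_mul'' hcB hcB zero_le zero_le
    exact absurd (this.trans_le hX) (not_lt.2 (le_mul_of_one_le_left' hB))

end MvPolynomial

/-- A derivation of a field is linear over its field of constants. -/
lemma Derivation.exists_constants {k L : Type*} [Field k] [Field L] [Algebra k L]
    (D : Derivation k L L) : ∃ (F : IntermediateField k L) (D' : Derivation F L L),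
      (∀ x, D' x = D x) ∧ (∀ c : F, D (c : L) = 0) ∧ ∀ x, D x = 0 → x ∈ F := by
  let F : IntermediateField k L :=
    { carrier := {x | D x = 0}
      mul_mem' := fun {a b} (ha : D a = 0) (hb : D b = 0) => by
        rw [Set.mem_ofPred_eq, Derivation.leibniz, ha, hb, smul_zero, smul_zero, add_zero]
      add_mem' := fun {a b} (ha : D a = 0) (hb : D b = 0) => by
        rw [Set.mem_ofPred_eq, map_add, ha, hb, add_zero]
      algebraMap_mem' := fun r => D.map_algebraMap r
      inv_mem' := fun a (ha : D a = 0) => by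
        change D a⁻¹ = 0
        rw [Derivation.leibniz_inv, ha, smul_zero] }
  have hF : ∀ c : F, D (c : L) = 0 := fun c => c.2
  let f : L →ₗ[F] L :=
    { toFun := D
      map_add' := map_add D
      map_smul' := fun c x => by
        rw [Algebra.smul_def, Derivation.leibniz, RingHom.id_apply, Algebra.smul_def]
        change (c : L) • D x + x • D (c : L) = _
        rw [hF, smul_zero, add_zero]
        rfl }
  exact ⟨F, Derivation.mk' f fun a b => D.leibniz a b, fun x => rfl, hF, fun x hx => hx⟩

namespace MvPolynomial

variable {p : P}

lemma FactoriallyClosed.exists_mul_aeval_eq (hp : poisson p ≠ 0) (h : FactoriallyClosed p)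
    {F L : Type} [Field F] [Field L] [Algebra F L] [Algebra P L] [IsFractionRing P L]
    {D : Derivation F L L} (hD : ∀ a, D (algebraMap P L a) = algebraMap P L (poisson p a))
    (ν : Polynomial F) (a : P) : ∃ s b, poisson p s = 0 ∧ s ≠ 0 ∧
      algebraMap P L s * Polynomial.aeval (D : Module.End F L) ν (algebraMap P L a) =
        algebraMap P L b := by
  induction ν using Polynomial.induction_on' with
  | add f g hf hg =>
    obtain ⟨s, b, hs, hs0, hf⟩ := hf
    obtain ⟨s', b', hs', hs0', hg⟩ := hg
    refine ⟨s * s', s' * b + s * b', ?_, mul_ne_zero hs0 hs0', ?_⟩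
    · rw [Derivation.leibniz, hs, hs', smul_zero, smul_zero, add_zero]
    · rw [map_add, LinearMap.add_apply]
      simp only [map_add, map_mul]
      linear_combination algebraMap P L s' * hf + algebraMap P L s * hg
  | monomial n c =>
    obtain ⟨r, s, -, hs, hs0, hrs⟩ := h.exists_mul_eq hp hD
      (fun a b => by rw [Derivation.leibniz]; rfl) (D.map_algebraMap c)
    refine ⟨s, r * (poisson p)^[n] a, hs, hs0, ?_⟩
    have hit : ∀ m, D^[m] (algebraMap P L a) = algebraMap P L ((poisson p)^[m] a) := fun m => by
      induction m with
      | zero => rfl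
      | succ m ih => rw [Function.iterate_succ_apply', ih, hD, Function.iterate_succ_apply']
    rw [Derivation.aeval_apply_eq_sum, Polynomial.sum_monomial_index _ _ (by simp), hit,
      map_mul, ← hrs, Algebra.smul_def]
    ring

lemma linearIndependent_of_sq_eigenvector {k L : Type} [Field k] [Field L] [Algebra k L]
    [Algebra P L] [IsFractionRing P L] {D : Derivation k L L}
    (hD : ∀ a, D (algebraMap P L a) = algebraMap P L (poisson p a)) {t q : P} {c : ℕ → P}
    (hq : poisson p q = 0) (hq0 : q ≠ 0) (hc : ∀ m, c m ≠ 0)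
    (hdd : ∀ m, t * poisson p (t * poisson p (c m)) = C (1 / 4) ^ m * q * c m) :
    LinearIndependent k fun m => algebraMap P L (c m) := by
  have hinj : Function.Injective (algebraMap P L) := IsFractionRing.injective P L
  rw [linearIndependent_iff']
  intro s g hsum
  set e : ℕ → L := fun m => algebraMap P L (C (1 / 4) ^ m * q) with he
  set y : ℕ → L := fun m => g m • algebraMap P L (c m) with hy
  let δ : Derivation k L L := algebraMap P L t • D
  have hδ : ∀ a, δ (algebraMap P L a) = algebraMap P L (t * poisson p a) := fun a => by
    rw [map_mul, ← hD]; rfl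
  have hδe : ∀ m, δ (e m) = 0 := fun m => by
    rw [he, hδ, ← map_pow, Derivation.leibniz, hq, poisson_apply_C, smul_zero, smul_zero, add_zero,
      mul_zero, map_zero]
  have hδy : ∀ m, δ (δ (y m)) = e m * y m := fun m => by
    rw [hy, δ.map_smul, δ.map_smul, hδ, hδ, hdd, map_mul, mul_smul_comm]
  have hδpow : ∀ k m x, δ (e m ^ k * x) = e m ^ k * δ x := fun k m x => by
    rw [Derivation.leibniz, Derivation.leibniz_pow, hδe]; simp
  have hall : ∀ k, ∑ i ∈ s, e i ^ k * y i = 0 := fun k => by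
    induction k with
    | zero => simpa using hsum
    | succ k ih =>
      have h1 := congrArg (fun x => δ (δ x)) ih
      simp only [map_sum, hδpow, hδy, map_zero] at h1
      rw [← h1]
      exact Finset.sum_congr rfl fun i _ => by ring
  have hei : Set.InjOn e s := fun i _ j _ hij => by
    have h1 := mul_right_cancel₀ hq0 (hinj hij)
    rw [← map_pow, ← map_pow] at h1
    have h2 : (1 / 4 : ℂ) ^ i = (1 / 4) ^ j := C_injective _ _ h1
    have h3 : (1 / 4 : ℝ) ^ i = (1 / 4) ^ j := by simpa using congrArg norm h2
    exact pow_right_injective₀ (by norm_num) (by norm_num) h3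
  intro i hi
  have h1 := eq_zero_of_forall_sum_pow_mul_eq_zero hei hall i hi
  rw [hy] at h1
  refine (smul_eq_zero.1 h1).resolve_right fun h2 => hc i (hinj (by rw [h2, map_zero]))

/-- If the bracket with `p` has factorially closed kernel and contracts finitely many valuations
for which bounded sets are finite dimensional, it is locally nilpotent. -/
theorem FactoriallyClosed.locally_nilpotent (hp : poisson p ≠ 0) (h : FactoriallyClosed p)
    {k L : Type} [Field k] [Field L] [CharZero L] [Algebra k L] [Algebra P L] [IsFractionRing P L]
    {D : Derivation k L L} (hD : ∀ a, D (algebraMap P L a) = algebraMap P L (poisson p a))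
    (htr : Algebra.trdeg k L ≤ 1) {ι : Type} [Finite ι] {v : ι → Valuation P ℝ≥0}
    (hvD : ∀ i h, v i (poisson p h) ≤ v i h)
    (hvR : ∀ i r, poisson p r = 0 → r ≠ 0 → v i r = 1)
    (hdep : ∀ h : ℕ → P, (∃ B, ∀ i m, v i (h m) ≤ B) →
      ¬ LinearIndependent k fun m => algebraMap P L (h m)) (a : P) :
    ∃ m, (poisson p)^[m] a = 0 := by
  by_contra! hnil
  have hinj : Function.Injective (algebraMap P L) := IsFractionRing.injective P L
  have hmul : ∀ a b, poisson p (a * b) = a * poisson p b + b * poisson p a := fun a b => by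
    rw [Derivation.leibniz]; rfl
  have hbound : ∀ a, ∃ B : ℝ≥0, 1 ≤ B ∧ ∀ i, v i a ≤ B := fun a => by
    obtain ⟨B, hB⟩ := (Set.finite_range fun i => v i a).bddAbove
    exact ⟨max 1 B, le_max_left _ _, fun i => (hB ⟨i, rfl⟩).trans (le_max_right _ _)⟩
  obtain ⟨F, D', hDD', hF, hF'⟩ := D.exists_constants
  have hD' : ∀ a, D' (algebraMap P L a) = algebraMap P L (poisson p a) := fun a => by
    rw [hDD', hD]
  have hit : ∀ m, D'^[m] (algebraMap P L a) = algebraMap P L ((poisson p)^[m] a) := fun m => by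
    induction m with
    | zero => rfl
    | succ m ih => rw [Function.iterate_succ_apply', ih, hD', Function.iterate_succ_apply']
  have htr' : Algebra.trdeg F L ≤ 1 := by
    rw [← trdeg_add_eq k F (A := L)] at htr
    exact (self_le_add_left _ _).trans htr
  have hμ : ∃ μ : Polynomial F, μ ≠ 0 ∧
      Polynomial.aeval (D' : Module.End F L) μ (algebraMap P L a) = 0 := by
    have h1 : ¬ LinearIndependent F fun m => algebraMap P L ((poisson p)^[m] a) := fun hli => by
      refine hdep _ ?_ (hli.restrict_scalars (R := k) (K := F) ?_)
      · obtain ⟨B, -, hB⟩ := hbound a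
        refine ⟨B, fun i m => ?_⟩
        induction m with
        | zero => exact hB i
        | succ m ih => rw [Function.iterate_succ_apply']; exact (hvD _ _).trans ih
      · exact fun x y hxy => (algebraMap k F).injective (by simpa [Algebra.smul_def] using hxy)
    rw [not_linearIndependent_iff] at h1
    obtain ⟨s, g, hsum, i, hi, hgi⟩ := h1
    refine ⟨∑ j ∈ s, Polynomial.monomial j (g j), fun h0 => hgi ?_, ?_⟩
    · have h2 := congrArg (fun f => Polynomial.coeff f i) h0
      simpa [Polynomial.finsetSum_coeff, Polynomial.coeff_monomial, hi] using h2
    · rw [map_sum, LinearMap.sum_apply, ← hsum]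
      refine Finset.sum_congr rfl fun j _ => ?_
      rw [Derivation.aeval_apply_eq_sum, Polynomial.sum_monomial_index _ _ (by simp), hit]
  obtain ⟨ν, x, hx0, hν0, hν⟩ := D'.exists_sq_eigenvector
    (fun x hx => ⟨⟨x, hF' x (by rw [← hDD', hx])⟩, rfl⟩) htr' hμ
    (fun m hm => hnil m (hinj (by rw [← hit, hm, map_zero])))
  obtain ⟨s, b, hs, hs0, hsb⟩ := h.exists_mul_aeval_eq hp hD' ν a
  obtain ⟨r, t, hr, ht, ht0, hrt⟩ := h.exists_mul_eq hp hD'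
      (fun a b => by rw [Derivation.leibniz]; rfl) (D'.map_algebraMap x)
  have hx0' : algebraMap F L x ≠ 0 := (map_ne_zero _).2 hx0
  have hb0 : b ≠ 0 := by
    rintro rfl
    rw [map_zero] at hsb
    exact mul_ne_zero (fun h0 => hs0 (hinj (by rw [h0, map_zero]))) hν0 hsb
  have hr0 : r ≠ 0 := by
    rintro rfl
    rw [map_zero] at hrt
    exact mul_ne_zero hx0' (fun h0 => ht0 (hinj (by rw [h0, map_zero]))) hrt
  have hDs : D' (algebraMap P L s) = 0 := by rw [hD', hs, map_zero]
  have hDDb : t * poisson p (poisson p b) = r * b := hinj <| by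
    have hs' : ∀ y, D' (algebraMap P L s * y) = algebraMap P L s * D' y := fun y => by
      rw [Derivation.leibniz, hDs, smul_zero, add_zero, smul_eq_mul]
    rw [map_mul, map_mul, ← hD', ← hD', ← hsb, hs', hs', hν, ← hrt]
    ring
  have hq : poisson p (t * r) = 0 := by rw [hmul, ht, hr, mul_zero, mul_zero, add_zero]
  have hq0 : t * r ≠ 0 := mul_ne_zero ht0 hr0
  obtain ⟨B, hB, hbB⟩ := hbound b
  have hC0 : ∀ m, (C (1 / 4) : P) ^ m ≠ 0 := fun m => pow_ne_zero _ (by simp)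
  have hCD : ∀ m, poisson p (C (1 / 4) ^ m * (t * r)) = 0 := fun m => by
    rw [hmul, hq, ← map_pow, poisson_apply_C, mul_zero, mul_zero, add_zero]
  have hstep : ∀ m, ∃ c, c ≠ 0 ∧
      t * poisson p (t * poisson p c) = C (1 / 4) ^ m * (t * r) * c ∧ ∀ i, v i c ≤ B := fun m => by
    induction m with
    | zero =>
      refine ⟨b, hb0, ?_, hbB⟩
      rw [hmul t, ht]
      linear_combination t * hDDb
    | succ m ih =>
      obtain ⟨c, hc0, hdd, hcB⟩ := ih
      obtain ⟨c', hc0', hdd', hc'⟩ := h.exists_halving hp ht ht0 (hCD m)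
        (mul_ne_zero (hC0 m) hq0) hc0 hdd
      exact ⟨c', hc0', by rw [hdd']; ring, fun i => hc' (v i) B hB (hvD i) (hvR i) (hcB i)⟩
  choose c hc0 hdd hcB using hstep
  exact hdep c ⟨B, fun i m => hcB m i⟩ (linearIndependent_of_sq_eigenvector hD hq hq0 hc0 hdd)

end MvPolynomial

namespace MvPolynomial

variable {p : P}

lemma factoriallyClosed_of_totalDegree_le {ψ : P →ₐ[ℂ] P} (hp : poisson p ≠ 0)
    (hψ : Function.Injective ψ) (hψp : ψ p = p)
    (hdeg : ∀ a (B : ℕ), (∀ N, ∃ m ≥ N, ((ψ ^ m) a).totalDegree ≤ B) → poisson p a = 0) :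
    FactoriallyClosed p := by
  intro a b hab hD
  obtain ⟨M, hM, hr⟩ := exists_pow_apply_eq_self hp hψ hψp hD
  refine hdeg a (a * b).totalDegree fun N => ⟨M * N, Nat.le_mul_of_pos_left N hM, ?_⟩
  refine totalDegree_le_of_dvd_of_isDomain ?_ hab
  have h1 := pow_apply_eq_self hr N
  rw [← pow_mul, map_mul] at h1
  exact ⟨_, h1.symm⟩

/-- A polynomial fixed by an endomorphism which is not an automorphism lies in a proper retract. -/
theorem isRetractive_of_not_bijective {φ : P →ₐ[ℂ] P} (hφp : φ p = p)
    (hφ : ¬ Function.Bijective φ) : IsRetractive p := by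
  by_cases hp : poisson p = 0
  · obtain ⟨c, rfl⟩ := exists_eq_C_of_poisson_eq_zero hp
    exact isRetractive_C c
  by_cases hinj : Function.Injective φ
  swap
  · exact isRetractive_of_not_injective hp hφp hinj
  refine isRetractive_of_locally_nilpotent hp ?_
  obtain ⟨n, hn, J, hJ0, hcoc, -, ⟨hJ, hrel⟩ | hnil | ⟨⟨r, hr, hr0, hJr⟩, hdeg, hval⟩⟩ :=
    exists_growth (FractionRing P) hp hinj hφp
  · refine (surjective_or_locally_nilpotent hp (pow_injective hinj n) (pow_apply_eq_self hφp n) hJ0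
      hJ hcoc hrel).resolve_left fun hs => hφ ⟨hinj, fun y => ?_⟩
    obtain ⟨x, hx⟩ := hs y
    obtain ⟨m, rfl⟩ := Nat.exists_eq_add_of_lt hn
    exact ⟨(φ ^ m) x, by rw [← hx, ← AlgHom.mul_apply, ← pow_succ', zero_add]⟩
  · exact hnil
  · have h := factoriallyClosed_of_totalDegree_le hp (pow_injective hinj n)
      (pow_apply_eq_self hφp n) hdeg
    have hJ := h.of_dvd hr0
      (Derivation.eq_zero_of_mem_adjoin_singleton _ (poisson_self p) r hr) hJr
    obtain ⟨ι, _, v, hvD, hvR, hdep⟩ := hval hJ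
    obtain ⟨D, hD⟩ := exists_poisson_extend (L := FractionRing P) p
    obtain ⟨z, _, _, -, -, htr, -⟩ := exists_placeSystem (FractionRing P) hp
    have : CharZero (FractionRing P) :=
      charZero_of_injective_algebraMap (algebraMap ℂ (FractionRing P)).injective
    exact h.locally_nilpotent hp hD htr hvD hvR hdep

end MvPolynomial

/-- A polynomial `p ∈ ℂ[x,y]` is a test polynomial if and only if `p` does not
belong to any proper retract of `ℂ[x,y]`. -/
theorem test_iff_not_in_proper_retract (p : P) :
    IsTestPolynomial p ↔ ¬∃ R : Subalgebra ℂ P, IsProperRetract R ∧ p ∈ R := by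
  constructor
  · rintro h ⟨_, ⟨⟨π, hπ, rfl⟩, -, htop⟩, hp⟩
    obtain ⟨a, rfl⟩ := hp
    exact htop (AlgHom.range_eq_top _ |>.2 (h π (DFunLike.congr_fun hπ a)).2)
  · intro h φ hφ
    by_contra hbij
    obtain ⟨π, hπ, hbot, htop, hπp⟩ := isRetractive_of_not_bijective hφ hbij
    exact h ⟨π.range, ⟨⟨π, hπ, rfl⟩, hbot, htop⟩, p, hπp⟩
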